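/- The set 𝔊₁₅⁰ of isometry classes of unimodular hermitian 𝓞-lattices of rank 15 containing no vector of norm 1 is finite, and the mass Y₁₅ = Σ_{L ∈ 𝔊₁₅⁰} 1/|G(L)|, where G(L) is the automorphism group of L, equals 3619970721202760389 / (2¹⁸·3²⁰·5³·7²·11·13). -/

import Mathlib

noncomputable section
open Matrix Complex
open scoped ComplexOrder

/-- A primitive cube root of unity in `ℂ`. -/
def ω : ℂ := ⟨-1/2, Real.sqrt 3 / 2⟩

/-- The ring of Eisenstein integers `𝓞 = ℤ[ω]`, the ring of integers of `ℚ(√-3)`,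
realized as a subalgebra of `ℂ` (so that complex conjugation is available). -/
def 𝓞 : Subalgebra ℤ ℂ := Algebra.adjoin ℤ {ω}

/-- All entries of the matrix are Eisenstein integers. -/
def EntriesIn {n : ℕ} (H : Matrix (Fin n) (Fin n) ℂ) : Prop := ∀ i j, H i j ∈ 𝓞

/-- `U ∈ GLₙ(𝓞)`: entries in `𝓞`, with a two-sided inverse having entries in `𝓞`. -/
def InGL {n : ℕ} (U : Matrix (Fin n) (Fin n) ℂ) : Prop :=
  EntriesIn U ∧ ∃ V : Matrix (Fin n) (Fin n) ℂ, EntriesIn V ∧ U * V = 1 ∧ V * U = 1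

/-- `H` is the Gram matrix of a hermitian `𝓞`-lattice of rank `n`:
entries in `𝓞`, equal to its conjugate transpose, positive definite as a complex matrix. -/
def IsHermLattice {n : ℕ} (H : Matrix (Fin n) (Fin n) ℂ) : Prop :=
  EntriesIn H ∧ H.IsHermitian ∧ H.PosDef

/-- A unimodular hermitian `𝓞`-lattice: discriminant `det H = 1`. -/
def IsUnimodular {n : ℕ} (H : Matrix (Fin n) (Fin n) ℂ) : Prop :=
  IsHermLattice H ∧ H.det = 1

/-- Isometry of lattices given by Gram matrices: `H' = U * H * U*` for some `U ∈ GLₙ(𝓞)`. -/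
def LatIsometric {n : ℕ} (H H' : Matrix (Fin n) (Fin n) ℂ) : Prop :=
  ∃ U : Matrix (Fin n) (Fin n) ℂ, InGL U ∧ H' = U * H * Uᴴ

/-- A lattice is decomposable if it is isometric to one whose Gram matrix is block
diagonal with two blocks of smaller positive size. -/
def Decomposable {n : ℕ} (H : Matrix (Fin n) (Fin n) ℂ) : Prop :=
  ∃ H' : Matrix (Fin n) (Fin n) ℂ, LatIsometric H H' ∧ ∃ k : ℕ, 0 < k ∧ k < n ∧
    ∀ i j : Fin n, (((i : ℕ) < k ∧ ¬ (j : ℕ) < k) ∨ (¬ (i : ℕ) < k ∧ (j : ℕ) < k)) → H' i j = 0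

/-- The norm `x* H x` of a vector. -/
def latNorm {n : ℕ} (H : Matrix (Fin n) (Fin n) ℂ) (x : Fin n → ℂ) : ℂ :=
  star x ⬝ᵥ H.mulVec x

/-- A vector of `𝓞ⁿ`. -/
def IsLatVec {n : ℕ} (x : Fin n → ℂ) : Prop := ∀ i, x i ∈ 𝓞

/-- A root: a lattice vector of norm 2. -/
def IsRoot {n : ℕ} (H : Matrix (Fin n) (Fin n) ℂ) (x : Fin n → ℂ) : Prop :=
  IsLatVec x ∧ latNorm H x = 2

/-- The lattice contains no roots. -/
def RootFree {n : ℕ} (H : Matrix (Fin n) (Fin n) ℂ) : Prop :=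
  ∀ x : Fin n → ℂ, ¬ IsRoot H x

/-- The minimal norm of the lattice is `3`. -/
def MinNormThree {n : ℕ} (H : Matrix (Fin n) (Fin n) ℂ) : Prop :=
  (∀ x : Fin n → ℂ, IsLatVec x → x ≠ 0 → 3 ≤ (latNorm H x).re) ∧
  (∃ x : Fin n → ℂ, IsLatVec x ∧ latNorm H x = 3)

/-- The order of the automorphism group `{U ∈ GLₙ(𝓞) : U H U* = H}` of the lattice. -/
def autCard {n : ℕ} (H : Matrix (Fin n) (Fin n) ℂ) : ℕ :=
  Nat.card {U : Matrix (Fin n) (Fin n) ℂ // InGL U ∧ U * H * Uᴴ = H}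

/-- The lattice contains no vector of norm 1. -/
def NormOneFree {n : ℕ} (H : Matrix (Fin n) (Fin n) ℂ) : Prop :=
  ∀ x : Fin n → ℂ, IsLatVec x → latNorm H x ≠ 1

namespace EisensteinMass

/-- The Eisenstein integers in coordinates `re + im * ω`. -/
abbrev Eis := QuadraticAlgebra ℤ (-1) (-1)

lemma omega_sq : ω * ω = -1 - ω := by
  have h : (√3 : ℝ) * √3 = 3 := Real.mul_self_sqrt (by norm_num)
  apply Complex.ext <;> simp [ω] <;> nlinarith

/-- The embedding of the Eisenstein integers in `ℂ`. -/
def toC : Eis →+* ℂ where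
  toFun z := z.re + z.im * ω
  map_zero' := by simp
  map_one' := by simp [QuadraticAlgebra.re_one, QuadraticAlgebra.im_one]
  map_add' z w := by simp; ring
  map_mul' z w := by
    simp
    linear_combination -(z.im * w.im : ℂ) * omega_sq

lemma toC_apply (z : Eis) : toC z = z.re + z.im * ω := rfl

lemma toC_re (z : Eis) : (toC z).re = z.re - z.im / 2 := by
  simp [toC_apply, ω]; ring

lemma toC_im (z : Eis) : (toC z).im = z.im * (√3 / 2) := by
  simp [toC_apply, ω]

lemma toC_injective : Function.Injective toC := by
  intro z w h
  have h1 := congrArg Complex.re h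
  have h2 := congrArg Complex.im h
  rw [toC_re, toC_re] at h1
  rw [toC_im, toC_im] at h2
  have h3 : (√3 : ℝ) / 2 ≠ 0 := by positivity
  have h4 := mul_right_cancel₀ h3 h2
  ext
  · rw [h4] at h1
    exact_mod_cast sub_left_inj.mp h1
  · exact_mod_cast h4

lemma toC_star (z : Eis) : toC (star z) = star (toC z) := by
  apply Complex.ext
  · simp [toC_re]; ring
  · simp [toC_im]

lemma toC_eq_zero {z : Eis} : toC z = 0 ↔ z = 0 := by
  rw [← map_zero toC, toC_injective.eq_iff]

lemma mem_𝓞_iff {z : ℂ} : z ∈ 𝓞 ↔ ∃ w : Eis, toC w = z := by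
  constructor
  · intro h
    refine Algebra.adjoin_induction (p := fun z _ => ∃ w : Eis, toC w = z) ?_ ?_ ?_ ?_ h
    · rintro x rfl
      exact ⟨⟨0, 1⟩, by simp [toC_apply]⟩
    · intro r
      exact ⟨r, by simp⟩
    · rintro x y _ _ ⟨a, rfl⟩ ⟨b, rfl⟩
      exact ⟨a + b, map_add _ _ _⟩
    · rintro x y _ _ ⟨a, rfl⟩ ⟨b, rfl⟩
      exact ⟨a * b, map_mul _ _ _⟩
  · rintro ⟨w, rfl⟩
    rw [toC_apply]
    refine 𝓞.add_mem ?_ (𝓞.mul_mem ?_ (Algebra.subset_adjoin rfl))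
    · exact 𝓞.algebraMap_mem w.re
    · exact 𝓞.algebraMap_mem w.im

instance : IsDomain Eis := toC_injective.isDomain toC

/-- The norm `a² - ab + b²`. -/
def eNorm (z : Eis) : ℤ := z.re ^ 2 - z.re * z.im + z.im ^ 2

lemma normSq_toC (z : Eis) : Complex.normSq (toC z) = eNorm z := by
  have h : (√3 : ℝ) * √3 = 3 := Real.mul_self_sqrt (by norm_num)
  rw [Complex.normSq_apply, toC_re, toC_im, eNorm]
  push_cast
  linear_combination (z.im : ℝ) ^ 2 / 4 * h

lemma star_mul_self_eq (z : Eis) : star z * z = (eNorm z : Eis) := by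
  ext <;> simp only [eNorm, QuadraticAlgebra.re_mul, QuadraticAlgebra.im_mul,
    QuadraticAlgebra.re_star,
    QuadraticAlgebra.im_star, QuadraticAlgebra.re_intCast, QuadraticAlgebra.im_intCast,
    Int.cast_id] <;> ring

lemma eNorm_nonneg (z : Eis) : 0 ≤ eNorm z := by
  have := Complex.normSq_nonneg (toC z)
  rw [normSq_toC] at this
  exact_mod_cast this

lemma eNorm_eq_zero {z : Eis} : eNorm z = 0 ↔ z = 0 := by
  rw [← toC_eq_zero, ← Complex.normSq_eq_zero, normSq_toC, Int.cast_eq_zero]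

lemma eNorm_mul (z w : Eis) : eNorm (z * w) = eNorm z * eNorm w := by
  have := Complex.normSq_mul (toC z) (toC w)
  rw [← map_mul, normSq_toC, normSq_toC, normSq_toC] at this
  exact_mod_cast this

/-- Every complex number is within `1/√3` of an Eisenstein integer. -/
lemma exists_near (z : ℂ) : ∃ w : Eis, Complex.normSq (z + toC w) ≤ 1 / 3 := by
  have h3 : (√3 : ℝ) * √3 = 3 := Real.mul_self_sqrt (by norm_num)
  have h0 : (0 : ℝ) < √3 := by positivity
  obtain ⟨t, ht⟩ : ∃ t : ℝ, z.im = t * (√3 / 2) := ⟨z.im / (√3 / 2), by field_simp⟩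
  obtain ⟨s, hs⟩ : ∃ s : ℝ, z.re = s - t / 2 := ⟨z.re + t / 2, by ring⟩
  have key : ∀ w : Eis, Complex.normSq (z + toC w) =
      (s + w.re) ^ 2 - (s + w.re) * (t + w.im) + (t + w.im) ^ 2 := by
    intro w
    rw [Complex.normSq_apply, Complex.add_re, Complex.add_im, toC_re, toC_im, hs, ht]
    linear_combination (t + (w.im : ℝ)) ^ 2 / 4 * h3
  have hx := Int.fract_nonneg s
  have hx1 := Int.fract_lt_one s
  have hy := Int.fract_nonneg t
  have hy1 := Int.fract_lt_one t
  obtain ⟨x, hxs⟩ : ∃ x, x = Int.fract s := ⟨_, rfl⟩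
  obtain ⟨y, hyt⟩ : ∃ y, y = Int.fract t := ⟨_, rfl⟩
  have hsx : s = x + ⌊s⌋ := by rw [hxs]; exact (Int.fract_add_floor s).symm
  have hty : t = y + ⌊t⌋ := by rw [hyt]; exact (Int.fract_add_floor t).symm
  rw [← hxs] at hx hx1
  rw [← hyt] at hy hy1
  have key' : ∀ a b : ℤ, Complex.normSq (z + toC ⟨a - ⌊s⌋, b - ⌊t⌋⟩) =
      (x + a) ^ 2 - (x + a) * (y + b) + (y + b) ^ 2 := by
    intro a b
    rw [key]
    have e1 : s + ((a - ⌊s⌋ : ℤ) : ℝ) = x + a := by push_cast; linarith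
    have e2 : t + ((b - ⌊t⌋ : ℤ) : ℝ) = y + b := by push_cast; linarith
    simp only [e1, e2]
  by_contra! hcon
  have a0 := hcon ⟨0 - ⌊s⌋, 0 - ⌊t⌋⟩
  have a1 := hcon ⟨-1 - ⌊s⌋, -1 - ⌊t⌋⟩
  have a2 := hcon ⟨-1 - ⌊s⌋, 0 - ⌊t⌋⟩
  have a3 := hcon ⟨0 - ⌊s⌋, -1 - ⌊t⌋⟩
  rw [key'] at a0 a1 a2 a3
  push_cast at a0 a1 a2 a3
  rcases le_total y x with h | h
  · have b0 := mul_pos (sub_pos.mpr hx1) (sub_pos.mpr a0)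
    have b1 := mul_nonneg hy (sub_nonneg.mpr a1.le)
    have b2 := mul_nonneg (sub_nonneg.mpr h) (sub_nonneg.mpr a2.le)
    nlinarith [sq_nonneg (1 - x - (x - y)), sq_nonneg (1 - x - y), sq_nonneg (x - y - y)]
  · have b0 := mul_pos (sub_pos.mpr hy1) (sub_pos.mpr a0)
    have b1 := mul_nonneg hx (sub_nonneg.mpr a1.le)
    have b2 := mul_nonneg (sub_nonneg.mpr h) (sub_nonneg.mpr a3.le)
    nlinarith [sq_nonneg (1 - y - (y - x)), sq_nonneg (1 - y - x), sq_nonneg (y - x - x)]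

instance : IsPrincipalIdealRing Eis := by
  refine ⟨fun I => ?_⟩
  by_cases hI : I = ⊥
  · rw [hI]; exact ⟨0, by simp⟩
  obtain ⟨a0, ha0, hne⟩ := Submodule.exists_mem_ne_zero_of_ne_bot hI
  let S : Set ℕ := {k | ∃ a ∈ I, a ≠ 0 ∧ (eNorm a).toNat = k}
  have hS : S.Nonempty := ⟨_, a0, ha0, hne, rfl⟩
  obtain ⟨a, ha, hane, hak⟩ := Nat.sInf_mem hS
  refine ⟨a, le_antisymm ?_ ?_⟩
  · intro b hb
    have hC : toC a ≠ 0 := fun h => hane (toC_eq_zero.mp h)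
    obtain ⟨w, hw⟩ := exists_near (toC b / toC a)
    have h1 : toC (b + w * a) = (toC b / toC a + toC w) * toC a := by
      rw [map_add, map_mul]; field_simp
    have h2 : (eNorm (b + w * a) : ℝ) ≤ 1 / 3 * eNorm a := by
      rw [← normSq_toC, h1, Complex.normSq_mul, normSq_toC]
      gcongr
      exact_mod_cast eNorm_nonneg a
    have hpos : 0 < eNorm a := lt_of_le_of_ne (eNorm_nonneg a) (fun h => hane (eNorm_eq_zero.mp h.symm))
    have h3 : eNorm (b + w * a) < eNorm a := by
      have : (0 : ℝ) < eNorm a := by exact_mod_cast hpos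
      have : (eNorm (b + w * a) : ℝ) < eNorm a := by linarith
      exact_mod_cast this
    have h4 : b + w * a = 0 := by
      by_contra hne'
      have := Nat.sInf_le (show (eNorm (b + w * a)).toNat ∈ S from
        ⟨_, I.add_mem hb (I.mul_mem_left w ha), hne', rfl⟩)
      have := eNorm_nonneg (b + w * a)
      omega
    rw [eq_neg_of_add_eq_zero_left h4]
    rw [← neg_mul]
    exact Submodule.smul_mem _ _ (Submodule.mem_span_singleton_self a)
  · rw [Submodule.span_singleton_le_iff_mem]; exact ha

lemma finite_eNorm_le (B : ℝ) : {z : Eis | (eNorm z : ℝ) ≤ B}.Finite := by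
  obtain ⟨N, hN⟩ := exists_nat_ge (2 * B + 2)
  have : Set.Finite ((fun p : ℤ × ℤ => (⟨p.1, p.2⟩ : Eis)) ''
      (Set.Icc (-(N : ℤ)) N ×ˢ Set.Icc (-(N : ℤ)) N)) :=
    Set.Finite.image _ ((Set.finite_Icc _ _).prod (Set.finite_Icc _ _))
  refine this.subset fun z hz => ⟨(z.re, z.im), ?_, rfl⟩
  have h1 : 2 * (eNorm z : ℝ) + 2 ≤ N := by
    have : (eNorm z : ℝ) ≤ B := hz
    linarith
  have h2 : 2 * eNorm z + 2 ≤ N := by exact_mod_cast h1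
  simp only [eNorm] at h2
  simp only [Set.mem_prod, Set.mem_Icc]
  refine ⟨⟨?_, ?_⟩, ?_, ?_⟩ <;> nlinarith [sq_nonneg (z.re - z.im), sq_nonneg (z.re - 1),
    sq_nonneg (z.re + 1), sq_nonneg (z.im - 1), sq_nonneg (z.im + 1), sq_nonneg (z.re - 2 * z.im),
    sq_nonneg (2 * z.re - z.im)]

end EisensteinMass

namespace EisensteinMass

variable {n : ℕ}

/-- Square matrices over the Eisenstein integers. -/
abbrev EMat (n : ℕ) := Matrix (Fin n) (Fin n) Eis

/-- Positive definiteness of an Eisenstein matrix. -/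
def PD (H : EMat n) : Prop := (H.map toC).PosDef

/-- The norm of a vector with respect to a Hermitian form. -/
def nrm (H : EMat n) (x : Fin n → Eis) : ℤ := (star x ⬝ᵥ H *ᵥ x).re

lemma map_mul_toC {l m k : Type*} [Fintype m] (A : Matrix l m Eis) (B : Matrix m k Eis) :
    (A * B).map toC = A.map toC * B.map toC := Matrix.map_mul

lemma map_conj {l m : Type*} (A : Matrix l m Eis) : Aᴴ.map toC = (A.map toC)ᴴ :=
  conjTranspose_map _ toC_star

lemma map_inj {l m : Type*} {A B : Matrix l m Eis} (h : A.map toC = B.map toC) : A = B :=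
  Matrix.map_injective toC_injective h

lemma map_dot (x : Fin n → Eis) (y : Fin n → Eis) :
    toC (x ⬝ᵥ y) = (toC ∘ x) ⬝ᵥ (toC ∘ y) := by simp [dotProduct]

lemma map_mulVec (A : EMat n) (y : Fin n → Eis) :
    toC ∘ (A *ᵥ y) = A.map toC *ᵥ (toC ∘ y) := by
  ext i; simp [mulVec, dotProduct]

lemma map_star (x : Fin n → Eis) : toC ∘ star x = star (toC ∘ x) := by
  ext i; simp [toC_star]

lemma det_map_toC (A : EMat n) : (A.map toC).det = toC A.det := (RingHom.map_det toC A).symm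

lemma PD.herm {H : EMat n} (h : PD H) : Hᴴ = H :=
  map_inj (by rw [map_conj]; exact h.1)

lemma im_eq_zero_of_star {z : Eis} (h : star z = z) : z.im = 0 := by
  have := congrArg QuadraticAlgebra.im h
  simp at this
  omega

lemma intCast_re_of_star {z : Eis} (h : star z = z) : ((z.re : ℤ) : Eis) = z := by
  ext
  · simp
  · simp [im_eq_zero_of_star h]

lemma star_herm {H : EMat n} (h : Hᴴ = H) (x y : Fin n → Eis) :
    star (star x ⬝ᵥ H *ᵥ y) = star y ⬝ᵥ H *ᵥ x := by
  rw [star_dotProduct, star_star, star_mulVec, h, ← dotProduct_mulVec]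

lemma nrm_cast {H : EMat n} (h : Hᴴ = H) (x : Fin n → Eis) :
    (nrm H x : Eis) = star x ⬝ᵥ H *ᵥ x := intCast_re_of_star (star_herm h x x)

lemma nrm_toC {H : EMat n} (h : Hᴴ = H) (x : Fin n → Eis) :
    (nrm H x : ℂ) = star (toC ∘ x) ⬝ᵥ H.map toC *ᵥ (toC ∘ x) := by
  rw [← map_star, ← map_mulVec, ← map_dot, ← nrm_cast h, map_intCast]

lemma toC_comp_eq_zero {x : Fin n → Eis} : toC ∘ x = 0 ↔ x = 0 := by
  constructor
  · intro h; ext1 i; exact toC_eq_zero.mp (congrFun h i)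
  · rintro rfl; ext i; simp

lemma PD.nrm_pos {H : EMat n} (h : PD H) {x : Fin n → Eis} (hx : x ≠ 0) : 0 < nrm H x := by
  have h1 := h.dotProduct_mulVec_pos (x := toC ∘ x) (by rwa [Ne, toC_comp_eq_zero])
  rw [← nrm_toC h.herm] at h1
  exact_mod_cast h1

lemma nrm_zero (H : EMat n) : nrm H 0 = 0 := by simp [nrm]

lemma PD.nrm_nonneg {H : EMat n} (h : PD H) (x : Fin n → Eis) : 0 ≤ nrm H x := by
  by_cases hx : x = 0
  · rw [hx, nrm_zero]
  · exact (h.nrm_pos hx).le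

lemma form_mulVec (H C : EMat n) (x y : Fin n → Eis) :
    star (C *ᵥ x) ⬝ᵥ H *ᵥ (C *ᵥ y) = star x ⬝ᵥ (Cᴴ * H * C) *ᵥ y := by
  rw [star_mulVec, ← dotProduct_mulVec, mulVec_mulVec, mulVec_mulVec, mul_assoc]

lemma nrm_mulVec (H C : EMat n) (x : Fin n → Eis) : nrm H (C *ᵥ x) = nrm (Cᴴ * H * C) x := by
  rw [nrm, nrm, form_mulVec]

lemma nrm_smul {H : EMat n} (h : Hᴴ = H) (a : Eis) (x : Fin n → Eis) :
    nrm H (a • x) = eNorm a * nrm H x := by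
  have : ((nrm H (a • x) : ℤ) : Eis) = ((eNorm a * nrm H x : ℤ) : Eis) := by
    rw [nrm_cast h, Int.cast_mul, nrm_cast h, ← star_mul_self_eq, mulVec_smul, star_smul,
      smul_dotProduct, dotProduct_smul, smul_eq_mul, smul_eq_mul, mul_assoc]
  simpa using congrArg QuadraticAlgebra.re this

lemma nrm_form_smul (a : ℤ) (H : EMat n) (x : Fin n → Eis) :
    nrm ((a : Eis) • H) x = a * nrm H x := by
  simp [nrm, smul_mulVec, dotProduct_smul]

open scoped MatrixOrder in
lemma PD.factor {H : EMat n} (h : PD H) :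
    ∃ A : Matrix (Fin n) (Fin n) ℂ, IsUnit A ∧ H.map toC = Aᴴ * A :=
  CStarAlgebra.isStrictlyPositive_iff_eq_star_mul_self.mp (Matrix.PosDef.isStrictlyPositive h)

lemma star_dot_self (y : Fin n → ℂ) : star y ⬝ᵥ y = ((∑ i, Complex.normSq (y i) : ℝ) : ℂ) := by
  simp [dotProduct, Complex.normSq_eq_conj_mul_self]

lemma nrm_factor {H : EMat n} (h : PD H) {A : Matrix (Fin n) (Fin n) ℂ}
    (hA : H.map toC = Aᴴ * A) (x : Fin n → Eis) :
    (nrm H x : ℝ) = ∑ i, Complex.normSq ((A *ᵥ (toC ∘ x)) i) := by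
  have : ((nrm H x : ℝ) : ℂ) = ((∑ i, Complex.normSq ((A *ᵥ (toC ∘ x)) i) : ℝ) : ℂ) := by
    rw [← star_dot_self]
    push_cast
    rw [nrm_toC h.herm, hA, star_mulVec, ← dotProduct_mulVec, mulVec_mulVec]
  exact_mod_cast this

lemma PD.coord_bound {H : EMat n} (h : PD H) :
    ∃ c : ℝ, 0 ≤ c ∧ ∀ x i, (eNorm (x i) : ℝ) ≤ c * nrm H x := by
  obtain ⟨A, hA, hHA⟩ := h.factor
  obtain ⟨B, hB⟩ := hA.exists_left_inv
  refine ⟨∑ i, ∑ j, ‖B i j‖ ^ 2, by positivity, fun x i => ?_⟩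
  have h1 : toC (x i) = ∑ j, B i j * (A *ᵥ (toC ∘ x)) j := by
    have : B *ᵥ (A *ᵥ (toC ∘ x)) = toC ∘ x := by rw [mulVec_mulVec, hB, one_mulVec]
    exact (congrFun this i).symm
  rw [← normSq_toC, nrm_factor h hHA, Complex.normSq_eq_norm_sq, h1]
  calc ‖∑ j, B i j * (A *ᵥ (toC ∘ x)) j‖ ^ 2
      ≤ (∑ j, ‖B i j‖ * ‖(A *ᵥ (toC ∘ x)) j‖) ^ 2 := by
        gcongr
        refine (norm_sum_le _ _).trans_eq ?_
        simp
    _ ≤ (∑ j, ‖B i j‖ ^ 2) * ∑ j, ‖(A *ᵥ (toC ∘ x)) j‖ ^ 2 := Finset.sum_mul_sq_le_sq_mul_sq _ _ _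
    _ ≤ _ := by
        simp_rw [Complex.normSq_eq_norm_sq]
        refine mul_le_mul_of_nonneg_right ?_ (by positivity)
        exact Finset.single_le_sum (f := fun i => ∑ j, ‖B i j‖ ^ 2)
          (fun _ _ => by positivity) (Finset.mem_univ i)

lemma PD.finite_le {H : EMat n} (h : PD H) (m : ℤ) : {x | nrm H x ≤ m}.Finite := by
  obtain ⟨c, hc, hb⟩ := h.coord_bound
  refine (Set.Finite.pi' fun _ : Fin n => finite_eNorm_le (c * m)).subset fun x hx i => ?_
  refine (hb x i).trans ?_
  have : (nrm H x : ℝ) ≤ m := by exact_mod_cast hx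
  gcongr

lemma PD.finite_eq {H : EMat n} (h : PD H) (m : ℤ) : {x | nrm H x = m}.Finite :=
  (h.finite_le m).subset fun _ hx => le_of_eq hx

lemma nrm_col (H C : EMat n) (j : Fin n) : nrm H (C.col j) = ((Cᴴ * H * C) j j).re := by
  have : C.col j = C *ᵥ Pi.single j 1 := by simp
  rw [this, nrm_mulVec, nrm]
  congr 1
  rw [Pi.star_single]
  simp

/-- Matrices carrying a fixed form to a fixed form are finite in number. -/
lemma PD.finite_sim {H : EMat n} (h : PD H) (K : EMat n) : {C : EMat n | Cᴴ * H * C = K}.Finite := by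
  have : {D : Fin n → Fin n → Eis | ∀ j, D j ∈ {x | nrm H x = (K j j).re}}.Finite :=
    Set.Finite.pi' fun j => h.finite_eq _
  refine (this.image fun D => (Matrix.of D)ᵀ).subset fun C hC => ⟨fun j => C.col j, fun j => ?_, rfl⟩
  have hC' : Cᴴ * H * C = K := hC
  simp only [Set.mem_ofPred_eq]
  rw [nrm_col, hC']

lemma PD.det_star {H : EMat n} (h : PD H) : star H.det = H.det := by
  rw [← det_conjTranspose, h.herm]

lemma PD.det_pos {H : EMat n} (h : PD H) : 0 < H.det.re := by
  have h1 := Matrix.PosDef.det_pos h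
  rw [det_map_toC, ← intCast_re_of_star h.det_star, map_intCast] at h1
  exact_mod_cast h1

lemma PD.det_eq_one {H : EMat n} (h : PD H) (hu : IsUnit H.det) : H.det = 1 := by
  have h1 := h.det_pos
  obtain ⟨w, hw⟩ := hu.exists_right_inv
  have h2 : eNorm H.det * eNorm w = 1 := by
    rw [← eNorm_mul, hw]; simp [eNorm, QuadraticAlgebra.re_one, QuadraticAlgebra.im_one]
  have h3 : eNorm H.det = H.det.re ^ 2 := by simp [eNorm, im_eq_zero_of_star h.det_star]
  rw [h3] at h2
  have h4 := Int.isUnit_iff.mp (IsUnit.of_mul_eq_one _ h2)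
  have h5 : H.det.re = 1 := by rcases h4 with h4 | h4 <;> nlinarith
  rw [← intCast_re_of_star h.det_star, h5, Int.cast_one]

lemma PD.congr {H C : EMat n} (h : PD H) (hC : C.det ≠ 0) : PD (Cᴴ * H * C) := by
  have : IsUnit (C.map toC) := by
    rw [Matrix.isUnit_iff_isUnit_det, det_map_toC]
    exact (Ne.isUnit (by rwa [Ne, toC_eq_zero]))
  rw [PD, map_mul_toC, map_mul_toC, map_conj]
  exact this.posDef_star_left_conjugate_iff.mpr h

lemma pd_smul_iff {H : EMat n} {a : ℤ} (ha : 0 < a) : PD ((a : Eis) • H) ↔ PD H := by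
  have : ((a : Eis) • H).map toC = (a : ℝ) • H.map toC := by
    ext i j; simp
  have ha' : (0 : ℝ) < a := by exact_mod_cast ha
  rw [PD, PD, this]
  constructor
  · intro h
    have := h.smul (inv_pos.mpr ha')
    rwa [smul_smul, inv_mul_cancel₀ ha'.ne', one_smul] at this
  · intro h
    exact h.smul ha'

end EisensteinMass

namespace EisensteinMass

variable {n : ℕ}

/-- A primitive vector is the first column of an invertible matrix. -/
lemma exists_completion (x : Fin (n + 1) → Eis) (hx : x ≠ 0)
    (hp : ∀ (a : Eis) (y : Fin (n + 1) → Eis), x = a • y → IsUnit a) :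
    ∃ U : EMat (n + 1), IsUnit U.det ∧ U.col 0 = x := by
  obtain ⟨k, S⟩ := Submodule.smithNormalForm (Pi.basisFun Eis (Fin (n + 1)))
    (Submodule.span Eis {x})
  have hxS : x ∈ Submodule.span Eis {x} := Submodule.mem_span_singleton_self x
  have hk : Nonempty (Fin k) := by
    have : Nontrivial (Submodule.span Eis {x}) :=
      ⟨⟨x, hxS⟩, 0, fun h => hx (congrArg Subtype.val h)⟩
    exact S.bN.index_nonempty
  obtain ⟨i0⟩ := hk
  obtain ⟨d, hd⟩ := Submodule.mem_span_singleton.mp (S.bN i0).2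
  have hd0 : d ≠ 0 := by
    rintro rfl
    rw [zero_smul] at hd
    exact S.bN.ne_zero i0 (Subtype.ext hd.symm)
  have hrep : ∀ j, j ≠ S.f i0 → S.bM.repr x j = 0 := by
    intro j hj
    have h1 := congrArg (fun y => S.bM.repr y j) hd
    simp only [S.snf, map_smul, Finsupp.smul_apply, Module.Basis.repr_self, smul_eq_mul,
      Finsupp.single_apply, if_neg hj.symm, mul_zero] at h1
    exact (mul_eq_zero.mp h1).resolve_left hd0
  have hx' : x = S.bM.repr x (S.f i0) • S.bM (S.f i0) := by
    conv_lhs => rw [← S.bM.sum_repr x]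
    rw [Finset.sum_eq_single (S.f i0)]
    · intro j _ hj; rw [hrep j hj, zero_smul]
    · simp
  obtain ⟨u, hu⟩ := hp _ _ hx'
  let b := (S.bM.reindex (Equiv.swap (S.f i0) 0)).unitsSMul (Function.update 1 0 u)
  refine ⟨(Pi.basisFun Eis (Fin (n + 1))).toMatrix b, ?_, ?_⟩
  · exact (Pi.basisFun Eis (Fin (n + 1))).isUnit_det b
  · rw [hx', ← hu]
    ext1 i
    simp [b, Matrix.col_apply, Module.Basis.toMatrix_apply, Module.Basis.unitsSMul_apply, Units.smul_def]

lemma PD.exists_min {H : EMat (n + 1)} (h : PD H) :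
    ∃ x, x ≠ 0 ∧ ∀ y, y ≠ 0 → nrm H x ≤ nrm H y := by
  let S : Set ℕ := {k | ∃ x, x ≠ 0 ∧ (nrm H x).toNat = k}
  have hS : S.Nonempty := ⟨_, fun _ => 1, fun h => one_ne_zero (congrFun h 0), rfl⟩
  obtain ⟨x, hx, hxk⟩ := Nat.sInf_mem hS
  refine ⟨x, hx, fun y hy => ?_⟩
  have := Nat.sInf_le (show (nrm H y).toNat ∈ S from ⟨y, hy, rfl⟩)
  have := h.nrm_nonneg y
  omega

lemma isUnit_of_eNorm {a : Eis} (h : eNorm a = 1) : IsUnit a := by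
  refine IsUnit.of_mul_eq_one (star a) ?_
  rw [mul_comm, star_mul_self_eq, h, Int.cast_one]

lemma primitive_of_min {H : EMat (n + 1)} (h : PD H) {x : Fin (n + 1) → Eis} (hx : x ≠ 0)
    (hmin : ∀ y, y ≠ 0 → nrm H x ≤ nrm H y) (a : Eis) (y : Fin (n + 1) → Eis)
    (hxy : x = a • y) : IsUnit a := by
  have hy : y ≠ 0 := by rintro rfl; exact hx (by rw [hxy, smul_zero])
  have ha : a ≠ 0 := by rintro rfl; exact hx (by rw [hxy, zero_smul])
  have h1 := hmin y hy
  have h2 := h.nrm_pos hy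
  rw [hxy, nrm_smul h.herm] at h1
  have h3 : 0 < eNorm a := lt_of_le_of_ne (eNorm_nonneg a) fun h => ha (eNorm_eq_zero.mp h.symm)
  exact isUnit_of_eNorm (by nlinarith)

lemma mulVec_ne_zero {U : EMat n} (hU : IsUnit U.det) {y : Fin n → Eis} (hy : y ≠ 0) :
    U *ᵥ y ≠ 0 := by
  intro h
  apply hy
  have := congrArg (fun z => U⁻¹ *ᵥ z) h
  simpa [mulVec_mulVec, Matrix.nonsing_inv_mul U hU] using this

lemma PD.exists_reduced {H : EMat (n + 1)} (h : PD H) :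
    ∃ U : EMat (n + 1), IsUnit U.det ∧
      (∃ x, x ≠ 0 ∧ ((Uᴴ * H * U) 0 0).re = nrm H x) ∧
      ∀ y, y ≠ 0 → ((Uᴴ * H * U) 0 0).re ≤ nrm (Uᴴ * H * U) y := by
  obtain ⟨x, hx, hmin⟩ := h.exists_min
  obtain ⟨U, hU, hUx⟩ := exists_completion x hx (primitive_of_min h hx hmin)
  refine ⟨U, hU, ⟨x, hx, ?_⟩, fun y hy => ?_⟩
  · rw [← nrm_col, hUx]
  · rw [← nrm_col, hUx, ← nrm_mulVec]
    exact hmin _ (mulVec_ne_zero hU hy)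

/-- The Schur complement of the first diagonal entry, cleared of denominators. -/
def schur (H : EMat (n + 1)) : EMat n :=
  Matrix.of fun i j => H 0 0 * H i.succ j.succ - H i.succ 0 * H 0 j.succ

def schurP (H : EMat (n + 1)) : EMat (n + 1) :=
  Matrix.of (Fin.cons (Fin.cons 1 0) fun i => Fin.cons (-H i.succ 0) (H 0 0 • Pi.single i 1))

lemma schurP_mul_zero (H : EMat (n + 1)) (j) : (schurP H * H) 0 j = H 0 j := by
  simp [schurP, Matrix.mul_apply, Fin.sum_univ_succ]

lemma schurP_mul_succ (H : EMat (n + 1)) (i : Fin n) (j) :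
    (schurP H * H) i.succ j = -H i.succ 0 * H 0 j + H 0 0 * H i.succ j := by
  simp [schurP, Matrix.mul_apply, Fin.sum_univ_succ, Pi.single_apply]

lemma schurP_det (H : EMat (n + 1)) : (schurP H).det = H 0 0 ^ n := by
  rw [det_succ_row_zero, Fin.sum_univ_succ]
  have : (schurP H).submatrix Fin.succ Fin.succ = H 0 0 • (1 : EMat n) := by
    ext i j <;> simp [schurP, Matrix.one_apply, Pi.single_apply, eq_comm]
  simp [schurP] at this ⊢
  simp [this]

lemma schur_det (H : EMat (n + 1)) : H 0 0 ^ n * H.det = H 0 0 * (schur H).det := by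
  rw [← schurP_det, ← det_mul, det_succ_column_zero, Fin.sum_univ_succ]
  have : (schurP H * H).submatrix Fin.succ Fin.succ = schur H := by
    ext1 i j; simp only [submatrix_apply, schurP_mul_succ, schur, of_apply]; ring
  simp only [schurP_mul_zero, schurP_mul_succ, Fin.succAbove_zero, this]
  rw [Finset.sum_eq_zero]
  · simp
  · intro i _; ring

lemma PD.corner {H : EMat (n + 1)} (h : PD H) :
    0 < (H 0 0).re ∧ (((H 0 0).re : ℤ) : Eis) = H 0 0 := by
  have h1 : star (H 0 0) = H 0 0 := congrFun (congrFun h.herm 0) 0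
  refine ⟨?_, intCast_re_of_star h1⟩
  have := Matrix.PosDef.diag_pos h (i := 0)
  rw [map_apply, ← intCast_re_of_star h1, map_intCast] at this
  exact_mod_cast this

lemma PD.corner_ne {H : EMat (n + 1)} (h : PD H) : H 0 0 ≠ 0 := by
  rw [← h.corner.2]
  exact_mod_cast h.corner.1.ne'

lemma PD.corner_star {H : EMat (n + 1)} (h : PD H) : star (H 0 0) = H 0 0 :=
  congrFun (congrFun h.herm 0) 0

lemma PD.schur {H : EMat (n + 1)} (h : PD H) : PD (schur H) := by
  rw [← pd_smul_iff h.corner.1, h.corner.2]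
  have h1 : PD ((schurP H)ᴴᴴ * H * (schurP H)ᴴ) := h.congr (by
    rw [det_conjTranspose, schurP_det, Ne, star_eq_zero]
    exact pow_ne_zero _ h.corner_ne)
  rw [conjTranspose_conjTranspose] at h1
  have h2 := Matrix.PosDef.submatrix h1 (Fin.succ_injective n)
  have e : H 0 0 • EisensteinMass.schur H =
      (schurP H * H * (schurP H)ᴴ).submatrix Fin.succ Fin.succ := by
    ext1 i j
    simp only [submatrix_apply]
    rw [Matrix.mul_apply, Fin.sum_univ_succ]
    simp only [schurP_mul_succ]
    simp [schurP, Pi.single_apply, EisensteinMass.schur, apply_ite star, h.corner_star]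
    ring
  rw [e]
  exact h2

lemma schur_nrm {H : EMat (n + 1)} (h : PD H) (x : Eis) (y : Fin n → Eis) :
    (H 0 0).re * nrm H (Fin.cons x y) =
      eNorm (H 0 0 * x + ∑ j, H 0 (Fin.succ j) * y j) + nrm (schur H) y := by
  have hH : ∀ i j, star (H i j) = H j i := fun i j => congrFun (congrFun h.herm j) i
  have key : (((H 0 0).re * nrm H (Fin.cons x y) : ℤ) : Eis) =
      ((eNorm (H 0 0 * x + ∑ j, H 0 (Fin.succ j) * y j) + nrm (schur H) y : ℤ) : Eis) := by
    obtain ⟨β, hβ⟩ : ∃ β, β = ∑ j, H 0 (Fin.succ j) * y j := ⟨_, rfl⟩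
    have hβs : ∑ i, star (y i) * H i.succ 0 = star β := by
      rw [hβ, star_sum]
      exact Finset.sum_congr rfl fun i _ => by rw [star_mul, hH]
    obtain ⟨Y, hY⟩ : ∃ Y, Y = ∑ i, star (y i) * ∑ j, H i.succ (Fin.succ j) * y j := ⟨_, rfl⟩
    have hS : star y ⬝ᵥ schur H *ᵥ y = H 0 0 * Y - star β * β := by
      rw [hY, ← hβs, Finset.mul_sum, Finset.sum_mul, ← Finset.sum_sub_distrib]
      refine Finset.sum_congr rfl fun i _ => ?_
      have : (schur H *ᵥ y) i = H 0 0 * (∑ j, H i.succ (Fin.succ j) * y j) - H i.succ 0 * β := by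
        change ∑ j, schur H i j * y j = _
        rw [hβ, Finset.mul_sum, Finset.mul_sum, ← Finset.sum_sub_distrib]
        refine Finset.sum_congr rfl fun j _ => ?_
        simp only [schur, of_apply]; ring
      rw [this, Pi.star_apply]; ring
    have hz : star (Fin.cons x y : Fin (n + 1) → Eis) ⬝ᵥ H *ᵥ (Fin.cons x y) =
        star x * (H 0 0 * x + β) + (star β * x + Y) := by
      rw [← hβs, hY, hβ, Finset.sum_mul, ← Finset.sum_add_distrib]
      simp only [dotProduct, mulVec, Fin.sum_univ_succ, Fin.cons_zero, Fin.cons_succ, Pi.star_apply]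
      congr 1
      exact Finset.sum_congr rfl fun i _ => by ring
    push_cast
    rw [h.corner.2, nrm_cast h.herm, nrm_cast h.schur.herm, ← star_mul_self_eq, ← hβ, hS, hz]
    rw [star_add, star_mul, hH]
    ring
  simpa using congrArg QuadraticAlgebra.re key

lemma exists_small (a : ℤ) (ha : 0 < a) (β : Eis) :
    ∃ x : Eis, 3 * eNorm ((a : Eis) * x + β) ≤ a ^ 2 := by
  obtain ⟨w, hw⟩ := exists_near (toC β / a)
  have haC : (a : ℂ) ≠ 0 := by exact_mod_cast ha.ne'
  refine ⟨w, ?_⟩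
  have h1 : toC ((a : Eis) * w + β) = (toC β / a + toC w) * (a : ℝ) := by
    rw [map_add, map_mul, map_intCast]; push_cast; field_simp; ring
  have h2 : (eNorm ((a : Eis) * w + β) : ℝ) ≤ 1 / 3 * a ^ 2 := by
    rw [← normSq_toC, h1, Complex.normSq_mul, Complex.normSq_ofReal, ← pow_two]
    gcongr
  have h3 : (3 * eNorm ((a : Eis) * w + β) : ℝ) ≤ a ^ 2 := by linarith
  exact_mod_cast h3

lemma schur_min {H : EMat (n + 1)} (h : PD H)
    (hmin : ∀ y, y ≠ 0 → (H 0 0).re ≤ nrm H y) {y : Fin n → Eis} (hy : y ≠ 0) :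
    2 * (H 0 0).re ^ 2 ≤ 3 * nrm (schur H) y := by
  obtain ⟨x, hx⟩ := exists_small _ h.corner.1 (∑ j, H 0 (Fin.succ j) * y j)
  rw [h.corner.2] at hx
  have h1 := schur_nrm h x y
  have h2 := hmin (Fin.cons x y) (fun h0 => hy (funext fun i => by
    simpa using congrFun h0 i.succ))
  have h3 := h.corner.1
  nlinarith

lemma det_congr {U : EMat n} (hU : IsUnit U.det) (H : EMat n) : (Uᴴ * H * U).det = H.det := by
  obtain ⟨w, hw⟩ := hU.exists_right_inv
  have h2 : eNorm U.det * eNorm w = 1 := by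
    rw [← eNorm_mul, hw]; simp [eNorm, QuadraticAlgebra.re_one, QuadraticAlgebra.im_one]
  have h3 : eNorm U.det = 1 := by
    have := eNorm_nonneg U.det
    rcases Int.isUnit_iff.mp (IsUnit.of_mul_eq_one _ h2) with h | h <;> omega
  rw [det_mul, det_mul, det_conjTranspose, mul_right_comm, star_mul_self_eq, h3]
  simp

/-- Hermite's inequality over the Eisenstein integers. -/
lemma hermite : ∀ (n : ℕ) (H : EMat (n + 1)), PD H → (∀ y, y ≠ 0 → (H 0 0).re ≤ nrm H y) →
    (2 / 3 : ℝ) ^ (n * (n + 1) / 2) * (H 0 0).re ^ (n + 1) ≤ H.det.re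
  | 0, H, h, _ => by simp
  | n + 1, H, h, hmin => by
    obtain ⟨U, hU, ⟨y, hy, hya⟩, hmin'⟩ := h.schur.exists_reduced
    have ih := hermite n _ (h.schur.congr hU.ne_zero) hmin'
    rw [det_congr hU] at ih
    have h1 := schur_min h hmin hy
    rw [← hya] at h1
    have ha := h.corner.1
    have h2 : (H 0 0).re ^ (n + 1) * H.det.re = (H 0 0).re * (schur H).det.re := by
      have := schur_det H
      rw [← h.corner.2, ← intCast_re_of_star h.det_star, ← intCast_re_of_star h.schur.det_star] at this
      exact_mod_cast this
    obtain ⟨a, haa⟩ : ∃ a : ℝ, a = (H 0 0).re := ⟨_, rfl⟩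
    obtain ⟨a', haa'⟩ : ∃ a : ℝ, a = ((Uᴴ * schur H * U) 0 0).re := ⟨_, rfl⟩
    have ha0 : 0 < a := by rw [haa]; exact_mod_cast ha
    have h1' : 2 / 3 * a ^ 2 ≤ a' := by
      have : 2 * a ^ 2 ≤ 3 * a' := by rw [haa, haa']; exact_mod_cast h1
      linarith
    have h2' : a ^ (n + 1) * H.det.re = a * (schur H).det.re := by rw [haa]; exact_mod_cast h2
    rw [← haa'] at ih
    rw [← haa]
    have h4 : (n + 1) * (n + 1 + 1) / 2 = n * (n + 1) / 2 + (n + 1) := by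
      have : (n + 1) * (n + 1 + 1) = n * (n + 1) + (n + 1) * 2 := by ring
      rw [this, Nat.add_mul_div_right _ _ (by norm_num)]
    have h3 : (2 / 3 : ℝ) ^ (n * (n + 1) / 2) * (2 / 3 * a ^ 2) ^ (n + 1) ≤ (schur H).det.re :=
      le_trans (by gcongr) ih
    have h5 : a ^ (n + 1) * ((2 / 3 : ℝ) ^ ((n + 1) * (n + 1 + 1) / 2) * a ^ (n + 1 + 1)) =
        a * ((2 / 3 : ℝ) ^ (n * (n + 1) / 2) * (2 / 3 * a ^ 2) ^ (n + 1)) := by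
      rw [h4, mul_pow, ← pow_mul, pow_add (2 / 3 : ℝ)]; ring
    have h6 : a ^ (n + 1) * ((2 / 3 : ℝ) ^ ((n + 1) * (n + 1 + 1) / 2) * a ^ (n + 1 + 1)) ≤
        a ^ (n + 1) * H.det.re := by
      rw [h5, h2']; gcongr
    exact le_of_mul_le_mul_left h6 (by positivity)

end EisensteinMass

namespace EisensteinMass

variable {n : ℕ}

/-- The block matrix with first row `(1, t)` and lower right block `U`. -/
def blk (t : Fin n → Eis) (U : EMat n) : EMat (n + 1) :=
  Matrix.of (Fin.cons (Fin.cons 1 t) fun i => Fin.cons 0 (U i))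

@[simp] lemma blk_zero_zero (t : Fin n → Eis) (U : EMat n) : blk t U 0 0 = 1 := rfl
@[simp] lemma blk_zero_succ (t : Fin n → Eis) (U : EMat n) (j : Fin n) :
    blk t U 0 j.succ = t j := rfl
@[simp] lemma blk_succ_zero (t : Fin n → Eis) (U : EMat n) (i : Fin n) :
    blk t U i.succ 0 = 0 := rfl
@[simp] lemma blk_succ_succ (t : Fin n → Eis) (U : EMat n) (i j : Fin n) :
    blk t U i.succ j.succ = U i j := rfl

lemma blk_det (t : Fin n → Eis) (U : EMat n) : (blk t U).det = U.det := by
  rw [det_succ_column_zero, Fin.sum_univ_succ]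
  have : (blk t U).submatrix Fin.succ Fin.succ = U := rfl
  simp [this]

lemma mul_blk_zero (H : EMat (n + 1)) (t : Fin n → Eis) (U : EMat n) (i) :
    (H * blk t U) i 0 = H i 0 := by
  simp [Matrix.mul_apply, Fin.sum_univ_succ]

lemma mul_blk_succ (H : EMat (n + 1)) (t : Fin n → Eis) (U : EMat n) (i) (j : Fin n) :
    (H * blk t U) i j.succ = H i 0 * t j + ∑ k, H i (Fin.succ k) * U k j := by
  simp [Matrix.mul_apply, Fin.sum_univ_succ]

lemma blk_conj_mul_zero (H : EMat (n + 1)) (t : Fin n → Eis) (U : EMat n) (j) :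
    ((blk t U)ᴴ * H) 0 j = H 0 j := by
  simp [Matrix.mul_apply, Fin.sum_univ_succ]

lemma blk_conj_mul_succ (H : EMat (n + 1)) (t : Fin n → Eis) (U : EMat n) (i : Fin n) (j) :
    ((blk t U)ᴴ * H) i.succ j = star (t i) * H 0 j + ∑ k, star (U k i) * H (Fin.succ k) j := by
  simp [Matrix.mul_apply, Fin.sum_univ_succ]

lemma schur_blk (H : EMat (n + 1)) (t : Fin n → Eis) (U : EMat n) :
    schur ((blk t U)ᴴ * H * blk t U) = Uᴴ * schur H * U := by
  ext1 i j
  rw [Matrix.mul_assoc, Matrix.mul_assoc]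
  simp only [schur, of_apply, blk_conj_mul_zero, blk_conj_mul_succ, mul_blk_zero, mul_blk_succ,
    Matrix.mul_apply (M := Uᴴ), conjTranspose_apply]
  have : ∀ k, (Matrix.of (fun i j => H 0 0 * H (Fin.succ i) (Fin.succ j) -
      H i.succ 0 * H 0 j.succ) * U : EMat n) k j =
      H 0 0 * (H k.succ 0 * t j + ∑ l, H k.succ (Fin.succ l) * U l j) -
        H k.succ 0 * (H 0 0 * t j + ∑ l, H 0 (Fin.succ l) * U l j) := by
    intro k
    rw [Matrix.mul_apply, mul_add, mul_add, add_sub_add_comm, Finset.mul_sum, Finset.mul_sum,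
      ← Finset.sum_sub_distrib]
    simp only [of_apply]
    rw [show H 0 0 * (H k.succ 0 * t j) - H k.succ 0 * (H 0 0 * t j) = 0 by ring, zero_add]
    exact Finset.sum_congr rfl fun l _ => by ring
  simp only [this]
  obtain ⟨β, hβ⟩ : ∃ β, β = H 0 0 * t j + ∑ l, H 0 (Fin.succ l) * U l j := ⟨_, rfl⟩
  rw [← hβ, mul_add, add_mul, Finset.mul_sum, Finset.sum_mul, add_sub_add_comm,
    ← Finset.sum_sub_distrib,
    show H 0 0 * (star (t i) * β) - star (t i) * H 0 0 * β = 0 by ring, zero_add]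
  exact Finset.sum_congr rfl fun l _ => by ring

lemma schur_ext {H K : EMat (n + 1)} (hH : Hᴴ = H) (hK : Kᴴ = K) (h0 : H 0 0 ≠ 0)
    (h00 : H 0 0 = K 0 0) (h1 : ∀ i : Fin n, H i.succ 0 = K i.succ 0)
    (hs : schur H = schur K) : H = K := by
  have h2 : ∀ i : Fin n, H 0 i.succ = K 0 i.succ := fun i => by
    have a := congrFun (congrFun hH 0) i.succ
    have b := congrFun (congrFun hK 0) i.succ
    rw [conjTranspose_apply] at a b
    rw [← a, ← b, h1]
  ext1 i j
  refine Fin.cases (Fin.cases h00 h2 j) (fun i => Fin.cases (h1 i) (fun j => ?_) j) i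
  have := congrFun (congrFun hs i) j
  simp only [schur, of_apply, h2, h1, ← h00] at this
  exact mul_left_cancel₀ h0 (sub_left_inj.mp this)

lemma conj_mul_assoc (H U V : EMat n) : (U * V)ᴴ * H * (U * V) = Vᴴ * (Uᴴ * H * U) * V := by
  rw [conjTranspose_mul]; simp only [Matrix.mul_assoc]

/-- There are finitely many classes of Hermitian forms of bounded determinant. -/
lemma finite_classes : ∀ (n d : ℕ), ∃ T : Set (EMat n), T.Finite ∧
    ∀ H, PD H → H.det.re ≤ d → ∃ U, IsUnit U.det ∧ Uᴴ * H * U ∈ T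
  | 0, d => ⟨Set.univ, Set.finite_univ, fun H _ _ => ⟨1, by simp, trivial⟩⟩
  | n + 1, d => by
    obtain ⟨B, hB⟩ := exists_nat_ge (d / (2 / 3 : ℝ) ^ (n * (n + 1) / 2))
    obtain ⟨T', hT', hT⟩ := finite_classes n (B ^ n * d)
    have hA : {z : Eis | (eNorm z : ℝ) ≤ B ^ 2}.Finite := finite_eNorm_le _
    have hb : {z : Fin n → Eis | ∀ i, z i ∈ {z : Eis | (eNorm z : ℝ) ≤ B ^ 2}}.Finite :=
      Set.Finite.pi' fun _ => hA
    let Φ : EMat (n + 1) → Eis × (Fin n → Eis) × EMat n :=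
      fun H => (H 0 0, fun i => H i.succ 0, schur H)
    refine ⟨{H : EMat (n + 1) | Hᴴ = H ∧ H 0 0 ≠ 0} ∩ Φ ⁻¹' ({z : Eis | (eNorm z : ℝ) ≤ B ^ 2} ×ˢ
      {z : Fin n → Eis | ∀ i, z i ∈ {z : Eis | (eNorm z : ℝ) ≤ B ^ 2}} ×ˢ T'), ?_, ?_⟩
    · refine Set.Finite.of_finite_image (f := Φ)
        ((hA.prod (hb.prod hT')).subset (Set.image_subset_iff.mpr Set.inter_subset_right)) ?_
      rintro H ⟨⟨hH, hH0⟩, -⟩ K ⟨⟨hK, -⟩, -⟩ e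
      simp only [Φ, Prod.mk.injEq] at e
      exact schur_ext hH hK hH0 e.1 (congrFun e.2.1) e.2.2
    · intro H h hd
      obtain ⟨U, hU, -, hmin⟩ := h.exists_reduced
      obtain ⟨K, hK⟩ : ∃ K, K = Uᴴ * H * U := ⟨_, rfl⟩
      have hKd : K.det = H.det := by rw [hK, det_congr hU]
      rw [← hK] at hmin
      have hKP : PD K := by rw [hK]; exact h.congr hU.ne_zero
      have hher := hermite n K hKP hmin
      have ha := hKP.corner.1
      have haB : (K 0 0).re ≤ (B : ℤ) := by
        have h1 : ((K 0 0).re : ℝ) ^ (n + 1) ≤ B := by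
          refine le_trans ?_ hB
          rw [le_div_iff₀ (by positivity), mul_comm]
          refine hher.trans ?_
          rw [hKd]
          exact_mod_cast hd
        have h2 : (K 0 0).re ^ (n + 1) ≤ (B : ℤ) := by exact_mod_cast h1
        exact le_trans (le_self_pow₀ ha (by omega)) h2
      have hsd : (schur K).det.re ≤ ((B ^ n * d : ℕ) : ℤ) := by
        have h2 : (K 0 0).re ^ n * K.det.re = (K 0 0).re * (schur K).det.re := by
          have := schur_det K
          rw [← hKP.corner.2, ← intCast_re_of_star hKP.det_star,
            ← intCast_re_of_star hKP.schur.det_star] at this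
          exact_mod_cast this
        have h3 : (K 0 0).re ^ n * K.det.re ≤ (B : ℤ) ^ n * d := by
          rw [hKd]
          have := h.det_pos
          gcongr
        have h4 := hKP.schur.det_pos
        push_cast
        nlinarith
      obtain ⟨V, hV, hVT⟩ := hT _ hKP.schur hsd
      have hsm : ∀ j : Fin n, ∃ x : Eis, 3 * eNorm (K 0 0 * x + ∑ k, K 0 (Fin.succ k) * V k j) ≤
          (K 0 0).re ^ 2 := fun j => by
        have := exists_small _ ha (∑ k, K 0 (Fin.succ k) * V k j)
        rwa [hKP.corner.2] at this
      choose t ht using hsm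
      have hW : IsUnit (blk t V).det := by rwa [blk_det]
      have hP2 := hKP.congr hW.ne_zero
      have h00 : ((blk t V)ᴴ * K * blk t V) 0 0 = K 0 0 := by
        rw [mul_blk_zero, blk_conj_mul_zero]
      have haB2 : ((K 0 0).re : ℝ) ^ 2 ≤ B ^ 2 := by
        have : ((K 0 0).re : ℝ) ≤ B := by exact_mod_cast haB
        have : (0 : ℝ) ≤ (K 0 0).re := by exact_mod_cast ha.le
        gcongr
      refine ⟨U * blk t V, by rw [det_mul]; exact hU.mul hW, ?_⟩
      rw [conj_mul_assoc, ← hK]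
      refine ⟨⟨hP2.herm, hP2.corner_ne⟩, ?_, fun j => ?_, ?_⟩
      · change (eNorm (((blk t V)ᴴ * K * blk t V) 0 0) : ℝ) ≤ B ^ 2
        rw [h00, ← hKP.corner.2]
        refine le_trans (le_of_eq ?_) haB2
        simp [eNorm]
      · change (eNorm (((blk t V)ᴴ * K * blk t V) j.succ 0) : ℝ) ≤ B ^ 2
        have e1 : ((blk t V)ᴴ * K * blk t V) j.succ 0 =
            star (((blk t V)ᴴ * K * blk t V) 0 j.succ) :=
          (congrFun (congrFun hP2.herm j.succ) 0).symm
        have e2 : ∀ z, eNorm (star z) = eNorm z := fun z => by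
          simp [eNorm]; ring
        rw [e1, e2, mul_assoc, blk_conj_mul_zero, mul_blk_succ]
        have h5 : (3 * eNorm (K 0 0 * t j + ∑ k, K 0 (Fin.succ k) * V k j) : ℝ) ≤
          ((K 0 0).re : ℝ) ^ 2 := by exact_mod_cast ht j
        have h6 : (0 : ℝ) ≤ eNorm (K 0 0 * t j + ∑ k, K 0 (Fin.succ k) * V k j) := by
          exact_mod_cast eNorm_nonneg _
        linarith
      · change schur ((blk t V)ᴴ * K * blk t V) ∈ T'
        rw [schur_blk]; exact hVT

end EisensteinMass

namespace EisensteinMass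

variable {n m : ℕ}

/-- Unimodular Hermitian lattices of rank `n`. -/
abbrev ULat (n : ℕ) := {H : EMat n // PD H ∧ H.det = 1}

/-- Isometries between two lattices. -/
abbrev Iso (H K : ULat n) := {C : EMat n // Cᴴ * H.1 * C = K.1}

instance (H K : ULat n) : Finite (Iso H K) := (H.2.1.finite_sim K.1).to_subtype

lemma Iso.isUnit {H K : ULat n} (C : Iso H K) : IsUnit C.1.det := by
  have := congrArg Matrix.det C.2
  rw [det_mul, det_mul, H.2.2, K.2.2, mul_one] at this
  exact IsUnit.of_mul_eq_one_right _ this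

lemma inv_conj {C H K : EMat n} (hC : IsUnit C.det) (h : Cᴴ * H * C = K) :
    C⁻¹ᴴ * K * C⁻¹ = H := by
  have h1 : C⁻¹ᴴ * Cᴴ = 1 := by
    rw [← conjTranspose_mul, Matrix.mul_nonsing_inv C hC, conjTranspose_one]
  rw [← h, Matrix.mul_assoc, Matrix.mul_assoc (Cᴴ * H), Matrix.mul_nonsing_inv C hC, Matrix.mul_one,
    ← Matrix.mul_assoc, h1, Matrix.one_mul]

def Iso.refl (H : ULat n) : Iso H H := ⟨1, by simp⟩

def Iso.symm {H K : ULat n} (C : Iso H K) : Iso K H := ⟨C.1⁻¹, inv_conj C.isUnit C.2⟩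

def Iso.trans {H K L : ULat n} (C : Iso H K) (D : Iso K L) : Iso H L :=
  ⟨C.1 * D.1, by rw [conj_mul_assoc, C.2, D.2]⟩

instance isoSetoid (n : ℕ) : Setoid (ULat n) where
  r H K := Nonempty (Iso H K)
  iseqv := ⟨fun H => ⟨Iso.refl H⟩, fun ⟨C⟩ => ⟨C.symm⟩, fun ⟨C⟩ ⟨D⟩ => ⟨C.trans D⟩⟩

/-- Isometry classes of unimodular lattices. -/
abbrev Cls (n : ℕ) := Quotient (isoSetoid n)

instance : Finite (Cls n) := by
  obtain ⟨T, hT, h⟩ := finite_classes n 1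
  have : Finite T := hT.to_subtype
  have key : ∀ c : Cls n, ∃ t : T, ∃ H : ULat n, ⟦H⟧ = c ∧ H.1 = t.1 := by
    intro c
    obtain ⟨H, rfl⟩ := Quotient.exists_rep c
    obtain ⟨U, hU, hUT⟩ := h H.1 H.2.1 (by rw [H.2.2]; simp [QuadraticAlgebra.re_one])
    refine ⟨⟨_, hUT⟩, ⟨Uᴴ * H.1 * U, H.2.1.congr hU.ne_zero, by rw [det_congr hU, H.2.2]⟩, ?_, rfl⟩
    exact Quotient.sound ⟨Iso.symm ⟨U, rfl⟩⟩
  choose f K hK hf using key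
  refine Finite.of_injective f fun c d hcd => ?_
  rw [← hK c, ← hK d]
  congr 1
  exact Subtype.ext (by rw [hf, hf, hcd])

instance : Fintype (Cls n) := Fintype.ofFinite _

/-- The order of the automorphism group. -/
def aut (H : ULat n) : ℕ := Nat.card (Iso H H)

lemma aut_ne_zero (H : ULat n) : (aut H : ℝ) ≠ 0 := by
  have : Nonempty (Iso H H) := ⟨Iso.refl H⟩
  exact_mod_cast (Nat.card_pos (α := Iso H H)).ne'

lemma iso_mul_cancel {H K : ULat n} (C : Iso H K) (A : EMat n) : C.1⁻¹ * (C.1 * A) = A := by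
  rw [← Matrix.mul_assoc, Matrix.nonsing_inv_mul _ C.isUnit, Matrix.one_mul]

def Iso.congrLeft {H K : ULat n} (C : Iso H K) (L : ULat n) : Iso K L ≃ Iso H L where
  toFun D := C.trans D
  invFun D := C.symm.trans D
  left_inv D := Subtype.ext (iso_mul_cancel C _)
  right_inv D := Subtype.ext (by
    change C.1 * (C.1⁻¹ * D.1) = D.1
    rw [← Matrix.mul_assoc, Matrix.mul_nonsing_inv _ C.isUnit, Matrix.one_mul])

lemma card_iso_symm (H K : ULat n) : Nat.card (Iso H K) = Nat.card (Iso K H) :=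
  Nat.card_congr ⟨Iso.symm, Iso.symm,
    fun C => Subtype.ext (Matrix.nonsing_inv_nonsing_inv _ C.isUnit),
    fun C => Subtype.ext (Matrix.nonsing_inv_nonsing_inv _ C.isUnit)⟩

lemma sum_iso (N : ULat n) (g : Cls n → ℝ) :
    ∑ c : Cls n, g c / aut c.out * Nat.card (Iso N c.out) = g ⟦N⟧ := by
  rw [Finset.sum_eq_single ⟦N⟧]
  · obtain ⟨C⟩ : Nonempty (Iso N (Quotient.out (⟦N⟧ : Cls n))) :=
      Setoid.symm (Quotient.exact (Quotient.out_eq (⟦N⟧ : Cls n)))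
    rw [← Nat.card_congr (C.congrLeft _)]
    exact div_mul_cancel₀ _ (aut_ne_zero _)
  · intro c _ hc
    have : IsEmpty (Iso N c.out) := ⟨fun C => hc (by
      rw [← Quotient.out_eq c]; exact Quotient.sound ⟨C.symm⟩)⟩
    simp
  · simp

/-- The weighted sum of a function over the isometry classes. -/
def W (n : ℕ) (f : ULat n → ℝ) : ℝ := ∑ c : Cls n, f c.out / aut c.out

lemma sum_iso_right (N : ULat n) : W n (fun H => Nat.card (Iso H N)) = 1 := by
  rw [← sum_iso N fun _ => 1, W]
  refine Finset.sum_congr rfl fun c _ => ?_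
  rw [card_iso_symm]; ring

/-- Double counting of a correspondence between lattices. -/
lemma W_corr (X : ULat n → Type) [∀ H, Fintype (X H)] (S : ULat n → ULat m → ℕ)
    (N : ∀ H, X H → ULat m) (hS : ∀ H L, S H L = ∑ x : X H, Nat.card (Iso (N H x) L))
    (g : Cls m → ℝ) :
    W n (fun H => ∑ x : X H, g ⟦N H x⟧) =
      ∑ d : Cls m, g d / aut d.out * W n (fun H => S H d.out) := by
  have h1 : ∀ H, ∑ x : X H, g ⟦N H x⟧ = ∑ d : Cls m, g d / aut d.out * S H d.out := by
    intro H
    simp_rw [← sum_iso (N H _) g, hS]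
    rw [Finset.sum_comm]
    refine Finset.sum_congr rfl fun d _ => ?_
    rw [← Finset.mul_sum]; push_cast; rfl
  simp_rw [W, h1, Finset.sum_div, Finset.mul_sum]
  rw [Finset.sum_comm]
  refine Finset.sum_congr rfl fun d _ => Finset.sum_congr rfl fun c _ => by ring

lemma card_fiber {α X : Type} [Fintype X] (p : α → X) [Finite α] :
    Nat.card α = ∑ x : X, Nat.card {a : α // p a = x} := by
  rw [← Nat.card_sigma, Nat.card_congr (Equiv.sigmaFiberEquiv p)]

/-- Representation numbers. -/
def rep (H : EMat n) (k : ℤ) : ℕ := Nat.card {x // nrm H x = k}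

lemma rep_iso {H K : ULat n} (C : Iso H K) (k : ℤ) : rep H.1 k = rep K.1 k := by
  refine (Nat.card_congr (Equiv.mk
    (fun x : {x // nrm K.1 x = k} => (⟨C.1 *ᵥ x.1, ?_⟩ : {x // nrm H.1 x = k}))
    (fun x => ⟨C.1⁻¹ *ᵥ x.1, ?_⟩) (fun x => Subtype.ext ?_) (fun x => Subtype.ext ?_))).symm
  · rw [nrm_mulVec, C.2, x.2]
  · rw [nrm_mulVec, inv_conj C.isUnit C.2, x.2]
  · simp [mulVec_mulVec, Matrix.nonsing_inv_mul _ C.isUnit]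
  · simp [mulVec_mulVec, Matrix.mul_nonsing_inv _ C.isUnit]

lemma rep_out (H : ULat n) (k : ℤ) : rep (Quotient.out (⟦H⟧ : Cls n)).1 k = rep H.1 k := by
  obtain ⟨C⟩ : Nonempty (Iso (Quotient.out (⟦H⟧ : Cls n)) H) :=
    Quotient.exact (Quotient.out_eq (⟦H⟧ : Cls n))
  exact rep_iso C k

end EisensteinMass

namespace EisensteinMass

variable {n m : ℕ}

lemma blk_conj_blk (N D : EMat n) (i j : Fin n) :
    ((blk 0 D)ᴴ * blk 0 N * blk 0 D) i.succ j.succ = (Dᴴ * N * D) i j := by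
  rw [mul_blk_succ, Matrix.mul_apply]
  simp [Matrix.mul_apply, Fin.sum_univ_succ]

lemma blk_conj (N D : EMat n) : (blk 0 D)ᴴ * blk 0 N * blk 0 D = blk 0 (Dᴴ * N * D) := by
  ext1 i j
  refine Fin.cases ?_ (fun i => ?_) i
  · rw [mul_assoc, blk_conj_mul_zero]
    refine Fin.cases ?_ (fun j => ?_) j
    · rw [mul_blk_zero]; rfl
    · rw [mul_blk_succ]; simp
  · refine Fin.cases ?_ (fun j => ?_) j
    · rw [mul_blk_zero, blk_conj_mul_succ]; simp
    · exact blk_conj_blk N D i j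

lemma blk_injective : Function.Injective (blk (0 : Fin n → Eis)) := fun A B h => by
  ext1 i j
  exact congrFun (congrFun h i.succ) j.succ

lemma nrm_blk (N : EMat n) (a : Eis) (y : Fin n → Eis) :
    nrm (blk 0 N) (Fin.cons a y) = eNorm a + nrm N y := by
  have h1 : star (Fin.cons a y : Fin (n + 1) → Eis) ⬝ᵥ blk 0 N *ᵥ (Fin.cons a y) =
      star a * a + star y ⬝ᵥ N *ᵥ y := by
    simp [dotProduct, mulVec, Fin.sum_univ_succ]
  rw [nrm, h1, star_mul_self_eq]
  simp [nrm]

lemma exists_split {H : EMat (n + 1)} (h : PD H) {x : Fin (n + 1) → Eis} (hx : nrm H x = 1) :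
    ∃ (B : EMat (n + 1)) (N : EMat n), IsUnit B.det ∧ B.col 0 = x ∧ Bᴴ * H * B = blk 0 N ∧ PD N := by
  have hx0 : x ≠ 0 := by rintro rfl; rw [nrm_zero] at hx; exact zero_ne_one hx
  obtain ⟨U, hU, hUx⟩ := exists_completion x hx0 fun a y hay => by
    have h1 : eNorm a * nrm H y = 1 := by rw [← nrm_smul h.herm, ← hay, hx]
    have := eNorm_nonneg a
    refine isUnit_of_eNorm ?_
    rcases Int.isUnit_iff.mp (IsUnit.of_mul_eq_one _ h1) with h | h <;> omega
  obtain ⟨K, hK⟩ : ∃ K, K = Uᴴ * H * U := ⟨_, rfl⟩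
  have hKP : PD K := by rw [hK]; exact h.congr hU.ne_zero
  have hK0 : K 0 0 = 1 := by
    rw [← hKP.corner.2, hK, ← nrm_col, hUx, hx, Int.cast_one]
  obtain ⟨V, hV⟩ : ∃ V, V = blk (fun j => -K 0 j.succ) (1 : EMat n) := ⟨_, rfl⟩
  have hVd : V.det = 1 := by rw [hV, blk_det, det_one]
  have hP : PD (Vᴴ * K * V) := hKP.congr (by rw [hVd]; exact one_ne_zero)
  have h0 : ∀ j : Fin n, (Vᴴ * K * V) 0 j.succ = 0 := fun j => by
    rw [mul_assoc, hV, blk_conj_mul_zero, mul_blk_succ, hK0]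
    simp [Matrix.one_apply]
  refine ⟨U * V, (Vᴴ * K * V).submatrix Fin.succ Fin.succ, ?_, ?_, ?_, ?_⟩
  · rw [det_mul, hVd, mul_one]; exact hU
  · ext1 i
    rw [← hUx, Matrix.col_apply, Matrix.col_apply, hV, mul_blk_zero]
  · rw [conj_mul_assoc, ← hK]
    ext1 i j
    refine Fin.cases (Fin.cases ?_ (fun j => ?_) j) (fun i => Fin.cases ?_ (fun j => ?_) j) i
    · rw [mul_assoc, hV, blk_conj_mul_zero, mul_blk_zero, hK0]; rfl
    · rw [h0]; rfl
    · have := congrFun (congrFun hP.herm i.succ) 0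
      rw [conjTranspose_apply, h0, star_zero] at this
      rw [← this]; rfl
    · rfl
  · exact Matrix.PosDef.submatrix hP (Fin.succ_injective n)

lemma pd_blk {N : EMat n} (h : PD N) : PD (blk 0 N) := by
  have hh := h.herm
  refine Matrix.PosDef.of_dotProduct_mulVec_pos ?_ fun x hx => ?_
  · rw [Matrix.IsHermitian, ← map_conj]
    congr 1
    ext1 i j
    refine Fin.cases (Fin.cases ?_ (fun j => ?_) j) (fun i => Fin.cases ?_ (fun j => ?_) j) i <;>
      simp
    exact congrFun (congrFun hh i) j
  · have h1 : star x ⬝ᵥ (blk 0 N).map toC *ᵥ x = star (x 0) * x 0 +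
        star (fun i : Fin n => x i.succ) ⬝ᵥ N.map toC *ᵥ (fun i : Fin n => x i.succ) := by
      simp [dotProduct, mulVec, Fin.sum_univ_succ]
    rw [h1]
    by_cases h2 : (fun i : Fin n => x i.succ) = 0
    · have h3 : x 0 ≠ 0 := fun h0 => hx (by
        ext1 i; exact Fin.cases h0 (fun i => congrFun h2 i) i)
      rw [h2]
      have h4 : star (x 0) * x 0 = (normSq (x 0) : ℂ) := (normSq_eq_conj_mul_self).symm
      rw [h4]
      simpa using normSq_pos.mpr h3
    · exact add_pos_of_nonneg_of_pos (star_mul_self_nonneg _)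
        (Matrix.PosDef.dotProduct_mulVec_pos h h2)

/-- The orthogonal sum of the rank one lattice and a lattice. -/
def oneSum (N : ULat n) : ULat (n + 1) := ⟨blk 0 N.1, pd_blk N.2.1, by rw [blk_det, N.2.2]⟩

lemma exists_split' (H : ULat (n + 1)) (x : {x // nrm H.1 x = 1}) :
    ∃ (N : ULat n) (B : Iso H (oneSum N)), B.1.col 0 = x.1 := by
  obtain ⟨B, N, hB, hx, hN, hP⟩ := exists_split H.2.1 x.2
  have : N.det = 1 := by rw [← blk_det 0, ← hN, det_congr hB, H.2.2]
  exact ⟨⟨N, hP, this⟩, ⟨B, hN⟩, hx⟩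

def splitN (H : ULat (n + 1)) (x : {x // nrm H.1 x = 1}) : ULat n := (exists_split' H x).choose

def splitB (H : ULat (n + 1)) (x : {x // nrm H.1 x = 1}) : Iso H (oneSum (splitN H x)) :=
  (exists_split' H x).choose_spec.choose

lemma splitB_col (H : ULat (n + 1)) (x : {x // nrm H.1 x = 1}) : (splitB H x).1.col 0 = x.1 :=
  (exists_split' H x).choose_spec.choose_spec

lemma blk_of_iso {N L : ULat n} (E : Iso (oneSum N) (oneSum L)) (h : E.1.col 0 = Pi.single 0 1) :
    ∃ D : Iso N L, E.1 = blk 0 D.1 := by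
  obtain ⟨E, hE⟩ := E
  have e0 : ∀ i, E i 0 = (Pi.single 0 1 : Fin (n + 1) → Eis) i := fun i => congrFun h i
  have h1 : E = blk (fun j => E 0 j.succ) (E.submatrix Fin.succ Fin.succ) := by
    ext1 i j
    refine Fin.cases (Fin.cases ?_ (fun j => ?_) j) (fun i => Fin.cases ?_ (fun j => ?_) j) i
    · rw [e0]; simp
    · rfl
    · rw [e0]; simp
    · rfl
  have h2 : (fun j : Fin n => E 0 j.succ) = 0 := by
    ext1 j
    have := congrFun (congrFun hE 0) j.succ
    rw [h1, mul_assoc, blk_conj_mul_zero, mul_blk_succ] at this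
    simpa [oneSum] using this
  rw [h2] at h1
  refine ⟨⟨E.submatrix Fin.succ Fin.succ, ?_⟩, h1⟩
  change Eᴴ * blk 0 N.1 * E = blk 0 L.1 at hE
  rw [h1, blk_conj] at hE
  exact blk_injective hE

instance (H : ULat n) (k : ℤ) : Fintype {x // nrm H.1 x = k} :=
  (H.2.1.finite_eq k).fintype

lemma card_split (H : ULat (n + 1)) (L : ULat n) :
    Nat.card (Iso H (oneSum L)) = ∑ x : {x // nrm H.1 x = 1}, Nat.card (Iso (splitN H x) L) := by
  rw [card_fiber (X := {x // nrm H.1 x = 1}) (fun C => ⟨C.1.col 0, by rw [nrm_col, C.2]; rfl⟩)]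
  refine Finset.sum_congr rfl fun x _ => ?_
  have mem (D : Iso (splitN H x) L) :
      (blk 0 D.1)ᴴ * (oneSum (splitN H x)).1 * blk 0 D.1 = (oneSum L).1 := by
    change _ * blk 0 _ * _ = _
    rw [blk_conj, D.2]; rfl
  refine (Nat.card_congr (Equiv.ofBijective (fun D : Iso (splitN H x) L =>
    ⟨(splitB H x).trans (⟨blk 0 D.1, mem D⟩ : Iso (oneSum (splitN H x)) (oneSum L)),
      Subtype.ext ?_⟩) ⟨?_, ?_⟩)).symm
  pick_goal 3
  · rw [← splitB_col H x]
    ext1 i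
    exact mul_blk_zero _ _ _ _
  · intro D D' h
    have h1 : (splitB H x).1 * blk 0 D.1 = (splitB H x).1 * blk 0 D'.1 :=
      congrArg (fun z => z.1.1) h
    have h2 := congrArg (fun z => (splitB H x).1⁻¹ * z) h1
    simp only [iso_mul_cancel] at h2
    exact Subtype.ext (blk_injective h2)
  · rintro ⟨C, hC⟩
    have hC' : C.1.col 0 = x.1 := congrArg Subtype.val hC
    obtain ⟨D, hD⟩ := blk_of_iso ((splitB H x).symm.trans C) (by
      change ((splitB H x).1⁻¹ * C.1).col 0 = _
      have e1 : ((splitB H x).1⁻¹ * C.1).col 0 = (splitB H x).1⁻¹ *ᵥ C.1.col 0 := rfl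
      rw [e1, hC', ← splitB_col H x]
      have e2 : (splitB H x).1⁻¹ *ᵥ (splitB H x).1.col 0 =
        ((splitB H x).1⁻¹ * (splitB H x).1).col 0 := rfl
      rw [e2, Matrix.nonsing_inv_mul _ (splitB H x).isUnit]
      ext1 i
      simp [Matrix.one_apply, Pi.single_apply])
    refine ⟨D, Subtype.ext (Subtype.ext ?_)⟩
    change (splitB H x).1 * blk 0 D.1 = C.1
    rw [← hD]
    change (splitB H x).1 * ((splitB H x).1⁻¹ * C.1) = C.1
    rw [← Matrix.mul_assoc, Matrix.mul_nonsing_inv _ (splitB H x).isUnit, Matrix.one_mul]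

lemma card_units : Nat.card {a : Eis // eNorm a = 1} = 6 := by
  have : {a : Eis | eNorm a = 1} = (({⟨1, 0⟩, ⟨-1, 0⟩, ⟨0, 1⟩, ⟨0, -1⟩, ⟨1, 1⟩, ⟨-1, -1⟩} :
      Finset Eis) : Set Eis) := by
    ext ⟨a, b⟩
    simp only [Set.mem_ofPred_eq, Finset.coe_insert, Finset.coe_singleton, Set.mem_insert_iff,
      Set.mem_singleton_iff, QuadraticAlgebra.mk.injEq, eNorm]
    constructor
    · intro h
      have ha : a ≤ 1 := by nlinarith [sq_nonneg (a - 2 * b)]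
      have ha' : -1 ≤ a := by nlinarith [sq_nonneg (a - 2 * b)]
      have hb : b ≤ 1 := by nlinarith [sq_nonneg (b - 2 * a)]
      have hb' : -1 ≤ b := by nlinarith [sq_nonneg (b - 2 * a)]
      interval_cases a <;> interval_cases b <;> simp_all
    · rintro (⟨rfl, rfl⟩ | ⟨rfl, rfl⟩ | ⟨rfl, rfl⟩ | ⟨rfl, rfl⟩ | ⟨rfl, rfl⟩ | ⟨rfl, rfl⟩) <;>
        norm_num
  change Nat.card ({a : Eis | eNorm a = 1} : Set Eis) = 6
  rw [this, Nat.card_coe_set_eq, Set.ncard_coe_finset]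
  rfl

lemma rep_oneSum (N : ULat n) : rep (oneSum N).1 1 = 6 + rep N.1 1 := by
  have : Finite {a : Eis // eNorm a = 1} := Nat.finite_of_card_ne_zero (by rw [card_units]; simp)
  rw [← card_units, rep, rep, ← Nat.card_sum]
  refine (Nat.card_congr (Equiv.ofBijective (Sum.elim
    (fun a => ⟨Fin.cons a.1 0, ?_⟩) (fun y => ⟨Fin.cons 0 y.1, ?_⟩)) ⟨?_, ?_⟩)).symm
  pick_goal 3
  · change nrm (blk 0 N.1) _ = 1
    rw [nrm_blk, a.2, nrm_zero, add_zero]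
  pick_goal 3
  · change nrm (blk 0 N.1) _ = 1
    rw [nrm_blk, y.2]; simp [eNorm]
  · rintro (⟨a, ha⟩ | ⟨y, hy⟩) (⟨b, hb⟩ | ⟨z, hz⟩) h
    · simpa using h
    · simp at h
      rw [h.1] at ha; simp [eNorm] at ha
    · simp at h
      rw [← h.1] at hb; simp [eNorm] at hb
    · simpa using h
  · rintro ⟨x, hx⟩
    obtain ⟨a, y, rfl⟩ : ∃ a y, x = Fin.cons a y := ⟨x 0, Fin.tail x, (Fin.cons_self_tail x).symm⟩
    have h1 : eNorm a + nrm N.1 y = 1 := by rw [← nrm_blk]; exact hx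
    have h2 := eNorm_nonneg a
    have h3 := N.2.1.nrm_nonneg y
    by_cases h4 : eNorm a = 0
    · refine ⟨Sum.inr ⟨y, by omega⟩, ?_⟩
      simp [eNorm_eq_zero.mp h4]
    · refine ⟨Sum.inl ⟨a, by omega⟩, ?_⟩
      have : y = 0 := by
        by_contra hy
        have := N.2.1.nrm_pos hy
        omega
      simp [this]

lemma rep_splitN (H : ULat (n + 1)) (x) : rep H.1 1 = 6 + rep (splitN H x).1 1 := by
  rw [← rep_oneSum, rep_iso (splitB H x)]

/-- Splitting off norm one vectors. -/
lemma W_split (F : ℕ → ℝ) : W (n + 1) (fun H => rep H.1 1 * F (rep H.1 1)) =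
    W n (fun N => F (6 + rep N.1 1)) := by
  have h := W_corr (n := n + 1) (m := n) (fun H => {x // nrm H.1 x = 1})
    (fun H L => Nat.card (Iso H (oneSum L))) splitN card_split
    (fun d => F (6 + rep d.out.1 1))
  simp only [rep_out, ← rep_splitN, Finset.sum_const, Finset.card_univ, nsmul_eq_mul,
    sum_iso_right, mul_one] at h
  simp only [← Nat.card_eq_fintype_card] at h
  exact h

end EisensteinMass

namespace EisensteinMass

variable {n m : ℕ}

lemma W_add (f g : ULat n → ℝ) : W n (fun H => f H + g H) = W n f + W n g := by
  simp [W, add_div, Finset.sum_add_distrib]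

lemma W_mul (a : ℝ) (f : ULat n → ℝ) : W n (fun H => a * f H) = a * W n f := by
  simp [W, mul_div_assoc, Finset.mul_sum]

lemma W_sum {ι : Type*} (s : Finset ι) (f : ι → ULat n → ℝ) :
    W n (fun H => ∑ i ∈ s, f i H) = ∑ i ∈ s, W n (f i) := by
  simp only [W, Finset.sum_div]
  rw [Finset.sum_comm]

/-- The mass of unimodular lattices of rank `n`. -/
def mass (n : ℕ) : ℝ := W n fun _ => 1

/-- The mass of unimodular lattices of rank `n` without vectors of norm one. -/
def massNoOne (n : ℕ) : ℝ := W n fun H => if rep H.1 1 = 0 then 1 else 0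

lemma exists_rep_one (H : ULat n) : ∃ s ≤ n, rep H.1 1 = 6 * s := by
  induction n with
  | zero =>
    refine ⟨0, le_rfl, ?_⟩
    have : IsEmpty {x // nrm H.1 x = 1} := ⟨fun x => by
      have := x.2
      rw [Subsingleton.elim x.1 0, nrm_zero] at this
      exact zero_ne_one this⟩
    exact Nat.card_of_isEmpty
  | succ n ih =>
    rcases isEmpty_or_nonempty {x // nrm H.1 x = 1} with h | ⟨⟨x⟩⟩
    · exact ⟨0, Nat.zero_le _, Nat.card_of_isEmpty⟩
    · obtain ⟨s, hs, h⟩ := ih (splitN H x)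
      exact ⟨s + 1, by omega, by rw [rep_splitN H x, h]; ring⟩

lemma W_fallingFactorial (n k : ℕ) :
    W (n + k) (fun H => ∏ i ∈ Finset.range k, ((rep H.1 1 : ℝ) - 6 * i)) = mass n := by
  induction k with
  | zero => simp [mass]
  | succ k ih =>
    rw [← ih]
    have := W_split (n := n + k) (fun r => ∏ i ∈ Finset.range k, ((r : ℝ) - 6 - 6 * i))
    simp only [Nat.cast_add, Nat.cast_ofNat, add_sub_cancel_left] at this
    rw [← this]
    congr 1
    ext H
    rw [Finset.prod_range_succ', mul_comm]
    congr 1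
    · simp
    · exact Finset.prod_congr rfl fun i _ => by push_cast; ring

lemma W_rep_one (n : ℕ) : W (n + 1) (fun H => rep H.1 1) = mass n := by
  rw [← W_fallingFactorial n 1]; simp

lemma prod_six_sub (s k : ℕ) :
    ∏ i ∈ Finset.range k, (((6 * s : ℕ) : ℝ) - 6 * i) = 6 ^ k * k.factorial * s.choose k := by
  have h : ∀ i : ℕ, (((6 * s : ℕ) : ℝ) - 6 * i) = 6 * ((s : ℝ) - i) := fun i => by push_cast; ring
  simp_rw [h]
  rw [Finset.prod_mul_distrib, Finset.prod_const, Finset.card_range, mul_assoc,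
    ← Nat.cast_mul, ← Nat.descFactorial_eq_factorial_mul_choose,
    ← descPochhammer_eval_eq_descFactorial ℝ, descPochhammer_eval_eq_prod_range]

/-- Inclusion-exclusion for lattices without vectors of norm one. -/
lemma massNoOne_eq (n : ℕ) : massNoOne n =
    ∑ k ∈ Finset.range (n + 1), (-1) ^ k / (6 ^ k * k.factorial) * mass (n - k) := by
  have h : ∀ H : ULat n, (if rep H.1 1 = 0 then (1 : ℝ) else 0) =
      ∑ k ∈ Finset.range (n + 1), (-1) ^ k / (6 ^ k * k.factorial) *
        ∏ i ∈ Finset.range k, ((rep H.1 1 : ℝ) - 6 * i) := by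
    intro H
    obtain ⟨s, hs, h⟩ := exists_rep_one H
    simp only [h, prod_six_sub]
    have h1 : ∀ k : ℕ, (-1 : ℝ) ^ k / (6 ^ k * k.factorial) * (6 ^ k * k.factorial * s.choose k) =
        ((((-1) ^ k * s.choose k : ℤ)) : ℝ) := fun k => by
      have : (k.factorial : ℝ) ≠ 0 := by positivity
      push_cast; field_simp
    simp only [h1]
    rw [← Int.cast_sum, ← Finset.sum_subset (Finset.range_mono (show s + 1 ≤ n + 1 by omega)),
      Int.alternating_sum_range_choose]
    · by_cases h0 : s = 0 <;> simp [h0]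
    · intro k _ hk
      rw [Nat.choose_eq_zero_of_lt (by simpa using hk)]; simp
  rw [massNoOne]
  simp only [h]
  rw [W_sum]
  refine Finset.sum_congr rfl fun k hk => ?_
  rw [W_mul]
  congr 1
  obtain ⟨j, rfl⟩ : ∃ j, n = j + k := ⟨n - k, by have := Finset.mem_range.mp hk; omega⟩
  rw [W_fallingFactorial, Nat.add_sub_cancel]

lemma mass_zero : mass 0 = 1 := by
  have : Subsingleton (ULat 0) := ⟨fun a b => Subtype.ext (Matrix.ext fun i => i.elim0)⟩
  let H0 : ULat 0 := ⟨1, by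
    refine Matrix.PosDef.of_dotProduct_mulVec_pos (by ext i; exact i.elim0) fun x hx => ?_
    exact (hx (Subsingleton.elim _ _)).elim, by simp⟩
  refine Eq.trans ?_ (sum_iso_right H0)
  rw [mass]
  congr 1
  ext H
  rw [Subsingleton.elim H H0]
  have : Unique (Iso H0 H0) := ⟨⟨Iso.refl _⟩, fun a => Subtype.ext (Matrix.ext fun i => i.elim0)⟩
  rw [Nat.card_unique, Nat.cast_one]

lemma exists_nrm_one (hn : n < 2) (H : ULat (n + 1)) : ∃ x, nrm H.1 x = 1 := by
  obtain ⟨U, hU, ⟨x, hx, hxa⟩, hmin⟩ := H.2.1.exists_reduced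
  have hP := H.2.1.congr hU.ne_zero
  have h1 := hermite n _ hP hmin
  rw [det_congr hU, H.2.2] at h1
  have h0 := hP.corner.1
  refine ⟨x, ?_⟩
  rw [← hxa]
  generalize ((Uᴴ * H.1 * U) 0 0).re = a at *
  have h2 : (2 / 3 : ℝ) ^ (n * (n + 1) / 2) * a ^ (n + 1) ≤ 1 := by
    simpa [QuadraticAlgebra.re_one] using h1
  by_contra ha
  have h3 : (2 : ℝ) ≤ a := by exact_mod_cast (show 2 ≤ a by omega)
  interval_cases n <;> norm_num at h2 <;> nlinarith

lemma massNoOne_small (hn : n < 2) : massNoOne (n + 1) = 0 := by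
  rw [massNoOne, W]
  refine Finset.sum_eq_zero fun c _ => ?_
  obtain ⟨x, hx⟩ := exists_nrm_one hn c.out
  have : Nonempty {x // nrm c.out.1 x = 1} := ⟨⟨x, hx⟩⟩
  have h0 : rep c.out.1 1 ≠ 0 := (Nat.card_pos (α := {x // nrm c.out.1 x = 1})).ne'
  rw [if_neg h0, zero_div]

lemma mass_one : mass 1 = 1 / 6 := by
  have h := massNoOne_small (n := 0) (by norm_num)
  rw [massNoOne_eq] at h
  simp [Finset.sum_range_succ, mass_zero] at h
  linarith

lemma mass_two : mass 2 = 1 / 72 := by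
  have h := massNoOne_small (n := 1) (by norm_num)
  rw [massNoOne_eq] at h
  simp [Finset.sum_range_succ, mass_zero, mass_one, Nat.factorial] at h
  linarith

end EisensteinMass

namespace EisensteinMass

variable {n m : ℕ}

lemma exists_basis_matrix (S : Submodule Eis (Fin n → Eis)) {d : Eis} (hd : d ≠ 0)
    (h : ∀ x, d • x ∈ S) :
    ∃ B A : EMat n, B * A = d • 1 ∧ A * B = d • 1 ∧ ∀ x, x ∈ S ↔ ∃ y, B *ᵥ y = x := by
  obtain ⟨k, b⟩ := S.basisOfPid (Pi.basisFun Eis (Fin n))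
  have hk : k = n := by
    have h1 : Module.finrank Eis S = k := by simpa using Module.finrank_eq_card_basis b
    have h2 : Module.finrank Eis S ≤ n := by simpa using S.finrank_le
    let f : (Fin n → Eis) →ₗ[Eis] S := LinearMap.codRestrict S (d • LinearMap.id) h
    have hf : Function.Injective f := fun x y hxy => by
      have : d • x = d • y := congrArg Subtype.val hxy
      exact smul_right_injective _ hd this
    have : Module.Finite Eis S := Module.Finite.of_basis b
    have h3 := LinearMap.finrank_le_finrank_of_injective hf
    simp at h3
    omega
  subst hk
  have key : ∀ x, x ∈ S ↔ ∃ y, (Matrix.of fun i j => (b j).1 i) *ᵥ y = x := by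
    have h1 : ∀ y : Fin k → Eis, (Matrix.of fun i j => (b j).1 i) *ᵥ y = (∑ j, y j • b j : S).1 := by
      intro y
      ext1 i
      simp [mulVec, dotProduct, mul_comm]
    refine fun x => ⟨fun hx => ⟨b.equivFun ⟨x, hx⟩, ?_⟩, ?_⟩
    · rw [h1, b.sum_equivFun]
    · rintro ⟨y, rfl⟩
      rw [h1]
      exact (∑ j, y j • b j : S).2
  choose f hf using fun j : Fin k => (key (d • Pi.single j 1)).mp (h _)
  have hBA : (Matrix.of fun i j => (b j).1 i) * (Matrix.of fun i j => f j i) = d • (1 : EMat k) := by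
    ext1 i j
    have := congrFun (hf j) i
    rw [Matrix.mul_apply']
    refine this.trans ?_
    simp [Matrix.one_apply, Pi.single_apply]
  refine ⟨_, _, hBA, ?_, key⟩
  have hdet : (Matrix.of fun i j => (b j).1 i).det ≠ 0 := by
    intro h0
    have := congrArg Matrix.det hBA
    rw [det_mul, h0, zero_mul, det_smul, det_one, mul_one] at this
    exact pow_ne_zero _ hd this.symm
  have h2 := congrArg (fun z => z * (Matrix.of fun i j => (b j).1 i)) hBA
  simp only [mul_assoc, smul_mul_assoc, one_mul] at h2
  have h3 : (Matrix.of fun i j => (b j).1 i) *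
      ((Matrix.of fun i j => f j i) * (Matrix.of fun i j => (b j).1 i) - d • 1) = 0 := by
    rw [mul_sub, h2]; simp
  have h4 := congrArg (fun z => adjugate (Matrix.of fun i j => (b j).1 i) * z) h3
  simp only [← mul_assoc, adjugate_mul, smul_mul_assoc, one_mul, mul_zero] at h4
  exact sub_eq_zero.mp ((smul_eq_zero.mp h4).resolve_left hdet)

/-- The residue field at a prime above `7`. -/
abbrev F7 := ZMod 7

instance : Fact (Nat.Prime 7) := ⟨by norm_num⟩

/-- Two conjugate reduction maps modulo the primes above `7`. -/
structure SplitPair (ψ ψ' : Eis →+* F7) : Prop where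
  map_star : ∀ z, ψ (star z) = ψ' z
  map_star' : ∀ z, ψ' (star z) = ψ z
  crt : ∀ a b, ∃ z, ψ z = a ∧ ψ' z = b
  ker : ∀ z, ψ z = 0 → ψ' z = 0 → ∃ w, z = 7 * w

lemma SplitPair.swap {ψ ψ' : Eis →+* F7} (h : SplitPair ψ ψ') : SplitPair ψ' ψ :=
  ⟨h.map_star', h.map_star, fun a b => (h.crt b a).imp fun _ h => h.symm, fun z a b => h.ker z b a⟩

lemma map_seven (ψ : Eis →+* F7) : ψ 7 = 0 := by
  rw [map_ofNat]; decide

lemma exists_smul_of_orthogonal {a b : Fin n → F7} (ha : a ≠ 0) (h : ∀ u, u ⬝ᵥ a = 0 → u ⬝ᵥ b = 0) :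
    ∃ c : F7, b = c • a := by
  obtain ⟨i, hi⟩ := Function.ne_iff.mp ha
  refine ⟨b i / a i, funext fun j => ?_⟩
  have := h (Pi.single j (a i) - Pi.single i (a j)) (by
    simp [sub_dotProduct, mul_comm])
  simp only [sub_dotProduct, single_dotProduct] at this
  have hi' : a i ≠ 0 := hi
  rw [Pi.smul_apply, smul_eq_mul, div_mul_eq_mul_div, eq_div_iff hi']
  linear_combination this

variable {ψ ψ' : Eis →+* F7}

lemma SplitPair.crt_vec (hp : SplitPair ψ ψ') (a b : Fin n → F7) :
    ∃ x : Fin n → Eis, ψ ∘ x = a ∧ ψ' ∘ x = b := by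
  choose x hx hx' using fun i => hp.crt (a i) (b i)
  exact ⟨x, funext hx, funext hx'⟩

lemma SplitPair.map_conj (hp : SplitPair ψ ψ') (A : EMat n) : Aᴴ.map ψ = (A.map ψ')ᵀ := by
  ext1 i j
  exact hp.map_star _

lemma SplitPair.map_form (hp : SplitPair ψ ψ') (x y : Fin n → Eis)
    (H : EMat n) :
    ψ (star x ⬝ᵥ H *ᵥ y) = (ψ' ∘ x) ⬝ᵥ (ψ ∘ (H *ᵥ y)) := by
  simp [dotProduct, hp.map_star]

variable (hp : SplitPair ψ ψ')

/-- The sublattice of vectors whose reduction lies on the line spanned by `v` and whose conjugate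
reduction is orthogonal to `v`. -/
def neighbor (_ : SplitPair ψ ψ') (H : EMat n) (v : Fin n → F7) : Submodule Eis (Fin n → Eis) where
  carrier := {x | (∃ c : F7, ψ ∘ x = c • v) ∧ v ⬝ᵥ (ψ' ∘ (H *ᵥ x)) = 0}
  zero_mem' := ⟨⟨0, by ext; simp⟩, by simp [dotProduct]⟩
  add_mem' := by
    rintro x y ⟨⟨c, hc⟩, hx⟩ ⟨⟨d, hd⟩, hy⟩
    refine ⟨⟨c + d, ?_⟩, ?_⟩
    · rw [add_smul, ← hc, ← hd]; ext; simp
    · have : ψ' ∘ (H *ᵥ (x + y)) = ψ' ∘ (H *ᵥ x) + ψ' ∘ (H *ᵥ y) := by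
        ext; simp [mulVec_add]
      rw [this, dotProduct_add, hx, hy, add_zero]
  smul_mem' := by
    rintro a x ⟨⟨c, hc⟩, hx⟩
    refine ⟨⟨ψ a * c, ?_⟩, ?_⟩
    · rw [mul_smul, ← hc]; ext; simp
    · have : ψ' ∘ (H *ᵥ (a • x)) = ψ' a • (ψ' ∘ (H *ᵥ x)) := by
        ext; simp [mulVec_smul]
      rw [this, dotProduct_smul, hx, smul_zero]

lemma seven_smul_mem (H : EMat n) (v : Fin n → F7) (x) : (7 : Eis) • x ∈ neighbor hp H v := by
  have h1 : ψ ∘ ((7 : Eis) • x) = 0 := by ext i; simp [map_seven]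
  have h2 : ψ' ∘ (H *ᵥ ((7 : Eis) • x)) = 0 := by ext i; simp [map_seven, mulVec_smul]
  exact ⟨⟨0, by rw [h1, zero_smul]⟩, by rw [h2, dotProduct_zero]⟩

lemma neighbor_form {H : EMat n} (hH : Hᴴ = H) {v : Fin n → F7} {x y : Fin n → Eis}
    (hx : x ∈ neighbor hp H v) (hy : y ∈ neighbor hp H v) : ∃ w, star x ⬝ᵥ H *ᵥ y = 7 * w := by
  have key : ∀ x y, x ∈ neighbor hp H v → y ∈ neighbor hp H v → ψ' (star x ⬝ᵥ H *ᵥ y) = 0 := by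
    rintro x y ⟨⟨c, hc⟩, -⟩ ⟨-, hy⟩
    rw [hp.swap.map_form, hc, smul_dotProduct, hy, smul_zero]
  refine hp.ker _ ?_ (key x y hx hy)
  rw [← star_herm hH, hp.map_star, key y x hy hx]

lemma neighbor_dual (H : ULat n) {v : Fin n → F7} (hv : v ≠ 0) {y : Fin n → Eis}
    (h : ∀ x ∈ neighbor hp H.1 v, ∃ w, star x ⬝ᵥ H.1 *ᵥ y = 7 * w) : y ∈ neighbor hp H.1 v := by
  have hinj : ∀ z : Fin n → F7, (H.1⁻¹).map ψ *ᵥ (H.1.map ψ *ᵥ z) = z := fun z => by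
    rw [mulVec_mulVec, ← Matrix.map_mul, Matrix.nonsing_inv_mul _ (by rw [H.2.2]; exact isUnit_one)]
    simp
  constructor
  · have hne : H.1.map ψ *ᵥ v ≠ 0 := fun h0 => hv (by rw [← hinj v, h0, mulVec_zero])
    obtain ⟨c, hc⟩ := exists_smul_of_orthogonal (b := H.1.map ψ *ᵥ (ψ ∘ y)) hne fun u hu => by
      obtain ⟨x, hx, hx'⟩ := hp.crt_vec 0 u
      obtain ⟨w, hw⟩ := h x ⟨⟨0, by rw [hx, zero_smul]⟩, by
        have : ψ' ∘ (H.1 *ᵥ x) = H.1.map ψ' *ᵥ u := by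
          rw [← hx']; ext i; exact RingHom.map_mulVec _ _ _ _
        rw [this, ← hu, dotProduct_mulVec, dotProduct_comm]
        congr 1
        rw [← mulVec_transpose, ← hp.map_conj, H.2.1.herm]⟩
      have h2 := congrArg ψ hw
      rw [hp.map_form, hx', map_mul, map_seven, zero_mul] at h2
      rw [← h2]
      congr 1
      ext i; exact (RingHom.map_mulVec _ _ _ _).symm
    refine ⟨c, ?_⟩
    rw [← hinj (ψ ∘ y), hc, mulVec_smul, hinj]
  · obtain ⟨x, hx, hx'⟩ := hp.crt_vec v 0
    obtain ⟨w, hw⟩ := h x ⟨⟨1, by rw [hx, one_smul]⟩, by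
      have : ψ' ∘ (H.1 *ᵥ x) = H.1.map ψ' *ᵥ (ψ' ∘ x) := by
        ext i; exact RingHom.map_mulVec _ _ _ _
      rw [this, hx', mulVec_zero, dotProduct_zero]⟩
    have h2 := congrArg ψ' hw
    rwa [hp.swap.map_form, hx, map_mul, map_seven, zero_mul] at h2

lemma exists_neighbor (hp : SplitPair ψ ψ') (H : ULat n) {v : Fin n → F7} (hv : v ≠ 0) :
    ∃ (B : EMat n) (N : ULat n), B.det ≠ 0 ∧ Bᴴ * H.1 * B = (7 : Eis) • N.1 ∧
      ∀ x, x ∈ neighbor hp H.1 v ↔ ∃ y, B *ᵥ y = x := by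
  have h7 : (7 : Eis) ≠ 0 := by
    intro h; have := congrArg QuadraticAlgebra.re h; revert this; decide
  obtain ⟨B, A, hBA, hAB, hS⟩ := exists_basis_matrix (neighbor hp H.1 v) h7
    (seven_smul_mem hp H.1 v)
  have hdet : B.det ≠ 0 := by
    intro h0
    have := congrArg Matrix.det hBA
    rw [det_mul, h0, zero_mul, det_smul, det_one, mul_one] at this
    exact pow_ne_zero _ h7 this.symm
  have hcol : ∀ j, B *ᵥ Pi.single j 1 ∈ neighbor hp H.1 v := fun j => (hS _).mpr ⟨_, rfl⟩
  choose N hN using fun i j => neighbor_form hp H.2.1.herm (hcol i) (hcol j)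
  have hN' : Bᴴ * H.1 * B = (7 : Eis) • Matrix.of N := by
    ext1 i j
    rw [Matrix.smul_apply, of_apply, smul_eq_mul, ← hN, form_mulVec, Pi.star_single]
    simp
  have hPD : PD (Matrix.of N) := by
    have h1 := H.2.1.congr hdet
    rw [hN'] at h1
    exact (pd_smul_iff (a := 7) (by norm_num)).mp (by exact_mod_cast h1)
  have hHu : IsUnit H.1.det := by rw [H.2.2]; exact isUnit_one
  have hX : ∀ j, ∃ z, B *ᵥ z = (H.1⁻¹ * Aᴴ) *ᵥ Pi.single j 1 := fun j => by
    refine (hS _).mp (neighbor_dual hp H hv fun x hx => ?_)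
    obtain ⟨y, rfl⟩ := (hS x).mp hx
    rw [mulVec_mulVec, ← mul_assoc, Matrix.mul_nonsing_inv _ hHu, one_mul]
    refine ⟨star (y j), ?_⟩
    rw [star_mulVec, ← dotProduct_mulVec, mulVec_mulVec, ← conjTranspose_mul, hAB,
      conjTranspose_smul, conjTranspose_one, smul_mulVec, one_mulVec]
    simp
  choose X hX using hX
  have hX' : B * (Matrix.of X)ᵀ = H.1⁻¹ * Aᴴ := by
    ext1 i j
    have := congrFun (hX j) i
    rw [mulVec_single_one] at this
    exact this
  have h1 : Matrix.of N * (Matrix.of X)ᵀ = 1 := by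
    have h2 : (7 : Eis) • (Matrix.of N * (Matrix.of X)ᵀ) = (7 : Eis) • (1 : EMat n) := by
      rw [← smul_mul_assoc, ← hN', mul_assoc, hX', mul_assoc, ← mul_assoc H.1,
        Matrix.mul_nonsing_inv _ hHu, one_mul, ← conjTranspose_mul, hAB]
      simp [conjTranspose_smul]
    exact smul_right_injective _ h7 h2
  have hu : IsUnit (Matrix.of N).det := by
    refine IsUnit.of_mul_eq_one (Matrix.of X)ᵀ.det ?_
    rw [← det_mul, h1, det_one]
  exact ⟨B, ⟨Matrix.of N, hPD, hPD.det_eq_one hu⟩, hdet, hN', hS⟩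

end EisensteinMass

namespace EisensteinMass

variable {n m : ℕ} {ψ ψ' : Eis →+* F7} (hp : SplitPair ψ ψ')

abbrev Line (n : ℕ) := {v : Fin n → F7 // v ≠ 0}

def nbB (H : ULat n) (v : Line n) : EMat n := (exists_neighbor hp H v.2).choose

def nbN (H : ULat n) (v : Line n) : ULat n := (exists_neighbor hp H v.2).choose_spec.choose

lemma nbB_spec (H : ULat n) (v : Line n) : (nbB hp H v).det ≠ 0 ∧
    (nbB hp H v)ᴴ * H.1 * nbB hp H v = (7 : Eis) • (nbN hp H v).1 ∧
      ∀ x, x ∈ neighbor hp H.1 v.1 ↔ ∃ y, nbB hp H v *ᵥ y = x :=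
  (exists_neighbor hp H v.2).choose_spec.choose_spec

/-- Rank one similitudes of norm `7`. -/
abbrev Sim (_ : SplitPair ψ ψ') (H L : ULat n) :=
  {p : EMat n × (Fin n → F7) × (Fin n → F7) // p.1ᴴ * H.1 * p.1 = (7 : Eis) • L.1 ∧
    p.1.map ψ = vecMulVec p.2.1 p.2.2 ∧ p.2.1 ≠ 0 ∧ p.2.2 ≠ 0}

instance (H L : ULat n) : Finite (Sim hp H L) := by
  have := (H.2.1.finite_sim ((7 : Eis) • L.1)).to_subtype
  exact Finite.of_injective
    (fun p : Sim hp H L => ((⟨p.1.1, p.2.1⟩ :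
      {C : EMat n | Cᴴ * H.1 * C = (7 : Eis) • L.1}), p.1.2)) fun p q h => by
    simp only [Prod.mk.injEq, Subtype.mk.injEq] at h
    exact Subtype.ext (Prod.ext h.1 h.2)

lemma seven_ne_zero : (7 : Eis) ≠ 0 := by
  intro h; have := congrArg QuadraticAlgebra.re h; revert this; decide

lemma mul_left_cancel_of_det {B X Y : EMat n} (hB : B.det ≠ 0) (h : B * X = B * Y) : X = Y := by
  have h4 := congrArg (fun z => adjugate B * z) h
  simp only [← mul_assoc, adjugate_mul, smul_mul_assoc, one_mul] at h4
  exact smul_right_injective _ hB h4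

lemma vecMulVec_left_cancel {v w w' : Fin n → F7} (hv : v ≠ 0)
    (h : vecMulVec v w = vecMulVec v w') : w = w' := by
  obtain ⟨i, hi⟩ := Function.ne_iff.mp hv
  ext1 j
  exact mul_left_cancel₀ hi (congrFun (congrFun h i) j)

lemma map_unit_mulVec (H : ULat n) (ψ : Eis →+* F7) (z : Fin n → F7) :
    (H.1⁻¹).map ψ *ᵥ (H.1.map ψ *ᵥ z) = z ∧ H.1.map ψ *ᵥ ((H.1⁻¹).map ψ *ᵥ z) = z := by
  have hu : IsUnit H.1.det := by rw [H.2.2]; exact isUnit_one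
  rw [mulVec_mulVec, ← Matrix.map_mul, Matrix.nonsing_inv_mul _ hu, mulVec_mulVec,
    ← Matrix.map_mul, Matrix.mul_nonsing_inv _ hu]
  simp

lemma nbB_map (H : ULat n) (v : Line n) :
    ∃ w, w ≠ 0 ∧ (nbB hp H v).map ψ = vecMulVec v.1 w := by
  obtain ⟨hB, hN, hS⟩ := nbB_spec hp H v
  have hcol : ∀ j, nbB hp H v *ᵥ Pi.single j 1 ∈ neighbor hp H.1 v.1 := fun j => (hS _).mpr ⟨_, rfl⟩
  choose w hw using fun j => (hcol j).1
  have h1 : (nbB hp H v).map ψ = vecMulVec v.1 w := by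
    ext1 i j
    have := congrFun (hw j) i
    rw [mulVec_single_one] at this
    rw [vecMulVec_apply, mul_comm]
    exact this
  refine ⟨w, ?_, h1⟩
  rintro rfl
  obtain ⟨x, hx, hx'⟩ := hp.crt_vec v.1 0
  obtain ⟨y, rfl⟩ := (hS x).mp ⟨⟨1, by rw [hx, one_smul]⟩, by
    have : ψ' ∘ (H.1 *ᵥ x) = H.1.map ψ' *ᵥ (ψ' ∘ x) := by
      ext i; exact RingHom.map_mulVec _ _ _ _
    rw [this, hx', mulVec_zero, dotProduct_zero]⟩
  refine v.2 ?_
  rw [← hx]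
  ext1 i
  rw [Function.comp_apply, RingHom.map_mulVec, h1]
  simp [mulVec, vecMulVec, dotProduct]

lemma sim_col_mem {H L : ULat n} (p : Sim hp H L) (j) : p.1.1.col j ∈ neighbor hp H.1 p.1.2.1 := by
  obtain ⟨⟨C, v, w⟩, h1, h2, hv, hw⟩ := p
  refine ⟨⟨w j, ?_⟩, ?_⟩
  · ext1 i
    have := congrFun (congrFun h2 i) j
    rw [vecMulVec_apply, mul_comm] at this
    exact this
  · obtain ⟨i, hi⟩ := Function.ne_iff.mp hw
    have h3 := congrArg ψ' (congrFun (congrFun h1 i) j)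
    rw [Matrix.smul_apply, smul_eq_mul, map_mul, map_seven, zero_mul] at h3
    have h4 : (Cᴴ * H.1 * C) i j = star (C.col i) ⬝ᵥ H.1 *ᵥ C.col j := by
      rw [mul_assoc, Matrix.mul_apply']; rfl
    have h5 : ψ ∘ C.col i = w i • v := by
      ext1 k
      have := congrFun (congrFun h2 k) i
      rw [vecMulVec_apply, mul_comm] at this
      exact this
    rw [h4, hp.swap.map_form, h5, smul_dotProduct] at h3
    exact (smul_eq_zero.mp h3).resolve_left hi

lemma card_sim (H L : ULat n) :
    Nat.card (Sim hp H L) = ∑ v : Line n, Nat.card (Iso (nbN hp H v) L) := by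
  rw [card_fiber (X := Line n) (fun p => ⟨p.1.2.1, p.2.2.2.1⟩)]
  refine Finset.sum_congr rfl fun v _ => ?_
  obtain ⟨hB, hN, hS⟩ := nbB_spec hp H v
  obtain ⟨w, hw0, hw⟩ := nbB_map hp H v
  have mem (D : Iso (nbN hp H v) L) : (nbB hp H v * D.1)ᴴ * H.1 * (nbB hp H v * D.1) =
      (7 : Eis) • L.1 ∧ (nbB hp H v * D.1).map ψ = vecMulVec v.1 (w ᵥ* D.1.map ψ) ∧
        v.1 ≠ 0 ∧ w ᵥ* D.1.map ψ ≠ 0 := by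
    refine ⟨?_, ?_, v.2, fun h => hw0 ?_⟩
    · rw [conj_mul_assoc, hN, mul_smul_comm, smul_mul_assoc, D.2]
    · rw [Matrix.map_mul, hw, vecMulVec_mul]
    · have := congrArg (fun z => z ᵥ* (D.1⁻¹).map ψ) h
      simpa [vecMul_vecMul, ← Matrix.map_mul, Matrix.mul_nonsing_inv _ D.isUnit] using this
  refine (Nat.card_congr (Equiv.ofBijective (fun D : Iso (nbN hp H v) L =>
    (⟨⟨⟨nbB hp H v * D.1, v.1, w ᵥ* D.1.map ψ⟩, mem D⟩, Subtype.ext rfl⟩ :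
      {p : Sim hp H L // (⟨p.1.2.1, p.2.2.2.1⟩ : Line n) = v})) ⟨?_, ?_⟩)).symm
  · intro D D' h
    have h1 : nbB hp H v * D.1 = nbB hp H v * D'.1 := congrArg (fun z => z.1.1.1) h
    exact Subtype.ext (mul_left_cancel_of_det hB h1)
  · rintro ⟨p, hpv⟩
    have hpv' : p.1.2.1 = v.1 := congrArg Subtype.val hpv
    choose f hf using fun j => (hS _).mp (by rw [← hpv']; exact sim_col_mem hp p j)
    have hD : nbB hp H v * (Matrix.of f)ᵀ = p.1.1 := by
      ext1 i j
      exact congrFun (hf j) i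
    have hDL : (Matrix.of f)ᵀᴴ * (nbN hp H v).1 * (Matrix.of f)ᵀ = L.1 := by
      have h1 := p.2.1
      rw [← hD, conj_mul_assoc, hN] at h1
      simp only [mul_smul_comm, smul_mul_assoc] at h1
      exact smul_right_injective _ seven_ne_zero h1
    refine ⟨⟨_, hDL⟩, Subtype.ext (Subtype.ext (Prod.ext hD (Prod.ext hpv'.symm ?_)))⟩
    refine vecMulVec_left_cancel v.2 ?_
    rw [← (mem ⟨_, hDL⟩).2.1, hD, ← hpv']
    exact p.2.2.1

lemma sim_mul {H L : ULat n} {C : EMat n} (h : Cᴴ * H.1 * C = (7 : Eis) • L.1) :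
    C * (L.1⁻¹ * Cᴴ * H.1) = (7 : Eis) • 1 := by
  have hu : IsUnit L.1.det := by rw [L.2.2]; exact isUnit_one
  have h1 : (L.1⁻¹ * Cᴴ * H.1) * C = (7 : Eis) • 1 := by
    rw [mul_assoc, mul_assoc, ← mul_assoc Cᴴ, h]
    simp [Matrix.nonsing_inv_mul _ hu]
  have hC : C.det ≠ 0 := by
    intro h0
    have := congrArg Matrix.det h1
    rw [det_mul, h0, mul_zero, det_smul, det_one, mul_one] at this
    exact pow_ne_zero _ seven_ne_zero this.symm
  refine mul_left_cancel_of_det (B := L.1⁻¹ * Cᴴ * H.1) ?_ ?_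
  · intro h0
    have := congrArg Matrix.det h1
    rw [det_mul, h0, zero_mul, det_smul, det_one, mul_one] at this
    exact pow_ne_zero _ seven_ne_zero this.symm
  · rw [← mul_assoc, h1]; simp

lemma herm_inv (L : ULat n) : L.1⁻¹ᴴ = L.1⁻¹ := by
  rw [conjTranspose_nonsing_inv, L.2.1.herm]

def simInv {H L : ULat n} (p : Sim hp H L) : Sim hp.swap L H :=
  ⟨⟨L.1⁻¹ * p.1.1ᴴ * H.1, L.1⁻¹.map ψ' *ᵥ p.1.2.2, p.1.2.1 ᵥ* H.1.map ψ'⟩, by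
    obtain ⟨⟨C, v, w⟩, h1, h2, hv, hw⟩ := p
    have hu : IsUnit L.1.det := by rw [L.2.2]; exact isUnit_one
    refine ⟨?_, ?_, ?_, ?_⟩
    · change (L.1⁻¹ * Cᴴ * H.1)ᴴ * L.1 * (L.1⁻¹ * Cᴴ * H.1) = _
      rw [conjTranspose_mul, conjTranspose_mul, conjTranspose_conjTranspose, H.2.1.herm, herm_inv]
      have : H.1 * (C * L.1⁻¹) * L.1 * (L.1⁻¹ * Cᴴ * H.1) = H.1 * (C * (L.1⁻¹ * Cᴴ * H.1)) := by
        rw [mul_assoc H.1, mul_assoc C, Matrix.nonsing_inv_mul _ hu, mul_one, mul_assoc]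
      rw [this, sim_mul h1]; simp
    · change (L.1⁻¹ * Cᴴ * H.1).map ψ' = vecMulVec (L.1⁻¹.map ψ' *ᵥ w) (v ᵥ* H.1.map ψ')
      rw [Matrix.map_mul, Matrix.map_mul, hp.swap.map_conj, h2, ← vecMulVec_mul, ← mul_vecMulVec,
        transpose_vecMulVec]
    · intro h0
      refine hw ?_
      rw [← (map_unit_mulVec L ψ' w).2]
      exact (congrArg _ h0).trans (mulVec_zero _)
    · intro h0
      refine hv ?_
      have h3 : v ᵥ* H.1.map ψ' = H.1.map ψ *ᵥ v := by
        rw [← mulVec_transpose, ← hp.map_conj, H.2.1.herm]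
      rw [← (map_unit_mulVec H ψ v).1, ← h3]
      exact (congrArg _ h0).trans (mulVec_zero _)⟩

lemma simInv_simInv {H L : ULat n} (p : Sim hp H L) : simInv hp.swap (simInv hp p) = p := by
  obtain ⟨⟨C, v, w⟩, h1, h2, hv, hw⟩ := p
  have hu : IsUnit L.1.det := by rw [L.2.2]; exact isUnit_one
  have hu' : IsUnit H.1.det := by rw [H.2.2]; exact isUnit_one
  have hv3 : ∀ (K : ULat n) (ψ ψ' : Eis →+* F7) (_ : SplitPair ψ ψ') (v : Fin n → F7),
      v ᵥ* K.1.map ψ' = K.1.map ψ *ᵥ v := fun K ψ ψ' hp v => by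
    rw [← mulVec_transpose, ← hp.map_conj, K.2.1.herm]
  refine Subtype.ext (Prod.ext ?_ (Prod.ext ?_ ?_))
  · change H.1⁻¹ * (L.1⁻¹ * Cᴴ * H.1)ᴴ * L.1 = C
    rw [conjTranspose_mul, conjTranspose_mul, conjTranspose_conjTranspose, H.2.1.herm, herm_inv,
      ← mul_assoc, Matrix.nonsing_inv_mul _ hu', one_mul, mul_assoc, Matrix.nonsing_inv_mul _ hu,
      mul_one]
  · change H.1⁻¹.map ψ *ᵥ (v ᵥ* H.1.map ψ') = v
    rw [hv3 H ψ ψ' hp, (map_unit_mulVec H ψ v).1]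
  · change (L.1⁻¹.map ψ' *ᵥ w) ᵥ* L.1.map ψ = w
    rw [hv3 L ψ' ψ hp.swap, (map_unit_mulVec L ψ' w).2]

lemma card_sim_symm (H L : ULat n) : Nat.card (Sim hp H L) = Nat.card (Sim hp.swap L H) :=
  Nat.card_congr ⟨simInv hp, simInv hp.swap, simInv_simInv hp, simInv_simInv hp.swap⟩

lemma card_line (n : ℕ) : Fintype.card (Line n) = 7 ^ n - 1 := by
  simp [Line, Fintype.card_subtype_compl]

lemma W_sim (L : ULat n) : W n (fun H => Nat.card (Sim hp H L)) = 7 ^ n - 1 := by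
  have h1 : ∀ v : Line n, W n (fun H => Nat.card (Iso (nbN hp.swap L v) H)) = 1 := fun v => by
    simp_rw [card_iso_symm (nbN hp.swap L v)]
    exact sum_iso_right _
  simp_rw [card_sim_symm hp, card_sim]
  push_cast
  rw [W_sum]
  simp only [h1, Finset.sum_const, Finset.card_univ, card_line]
  have : 1 ≤ 7 ^ n := Nat.one_le_pow _ _ (by norm_num)
  simp [Nat.cast_sub this]

lemma W_neighbor (k : ℤ) : W n (fun H => ∑ v : Line n, (rep (nbN hp H v).1 k : ℝ)) =
    (7 ^ n - 1) * W n (fun H => rep H.1 k) := by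
  have h := W_corr (n := n) (m := n) (fun _ => Line n) (fun H L => Nat.card (Sim hp H L))
    (nbN hp) (card_sim hp) (fun d => rep d.out.1 k)
  simp only [rep_out, W_sim] at h
  rw [h, ← Finset.sum_mul, mul_comm]
  rfl

end EisensteinMass

namespace EisensteinMass

variable {n m : ℕ} {ψ ψ' : Eis →+* F7} (hp : SplitPair ψ ψ')

lemma rep_nbN (H : ULat n) (v : Line n) (k : ℤ) : rep (nbN hp H v).1 k =
    Nat.card {x : {x // nrm H.1 x = 7 * k} // x.1 ∈ neighbor hp H.1 v.1} := by
  obtain ⟨hB, hN, hS⟩ := nbB_spec hp H v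
  have hnrm : ∀ y, nrm H.1 (nbB hp H v *ᵥ y) = 7 * nrm (nbN hp H v).1 y := fun y => by
    rw [nrm_mulVec, hN]
    exact_mod_cast nrm_form_smul 7 _ y
  refine Nat.card_congr (Equiv.ofBijective (fun y : {y // nrm (nbN hp H v).1 y = k} =>
    (⟨⟨nbB hp H v *ᵥ y.1, by rw [hnrm, y.2]⟩, (hS _).mpr ⟨_, rfl⟩⟩ :
      {x : {x // nrm H.1 x = 7 * k} // x.1 ∈ neighbor hp H.1 v.1})) ⟨?_, ?_⟩)
  · intro y z h
    have h1 : nbB hp H v *ᵥ y.1 = nbB hp H v *ᵥ z.1 := congrArg (fun z => z.1.1) h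
    have h2 := congrArg (fun z => adjugate (nbB hp H v) *ᵥ z) h1
    simp only [mulVec_mulVec, adjugate_mul, smul_mulVec, one_mulVec] at h2
    exact Subtype.ext (smul_right_injective _ hB h2)
  · rintro ⟨⟨x, hx⟩, hx'⟩
    obtain ⟨y, rfl⟩ := (hS x).mp hx'
    exact ⟨⟨y, by have := hnrm y; omega⟩, rfl⟩

lemma card_orthogonal {a : Fin (n + 1) → F7} (ha : a ≠ 0) :
    Nat.card {v : Fin (n + 1) → F7 // v ⬝ᵥ a = 0} = 7 ^ n := by
  let f : Module.Dual F7 (Fin (n + 1) → F7) := dotProductBilin F7 F7 a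
  have hf : f ≠ 0 := fun h => ha (funext fun i => by
    have := LinearMap.congr_fun h (Pi.single i 1)
    simpa [f] using this)
  have h1 := Module.Dual.finrank_ker_add_one_of_ne_zero hf
  have h2 := Module.natCard_eq_pow_finrank (K := F7) (V := LinearMap.ker f)
  simp at h1
  rw [h1, Nat.card_zmod] at h2
  rw [← h2]
  refine Nat.card_congr (Equiv.subtypeEquivRight fun v => ?_)
  simp [f, dotProduct_comm]

lemma card_line_filter (P : (Fin n → F7) → Prop) (h0 : P 0) :
    (Nat.card {v : Line n // P v.1} : ℝ) = Nat.card {v // P v} - 1 := by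
  classical
  have h1 : Nat.card {v // P v} = Nat.card ({v : Line n // P v.1} ⊕ Unit) := by
    refine Nat.card_congr (Equiv.symm (Equiv.ofBijective
      (Sum.elim (fun v => ⟨v.1.1, v.2⟩) fun _ => ⟨0, h0⟩) ⟨?_, ?_⟩))
    · rintro (⟨⟨v, hv⟩, hv'⟩ | _) (⟨⟨w, hw⟩, hw'⟩ | _) h
      · simpa using h
      · exact (hv (by simpa using h)).elim
      · exact (hw (by simpa using h.symm)).elim
      · rfl
    · rintro ⟨v, hv⟩
      by_cases h : v = 0
      · exact ⟨Sum.inr (), by simp [h]⟩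
      · exact ⟨Sum.inl ⟨⟨v, h⟩, hv⟩, rfl⟩
  rw [h1, Nat.card_sum]
  simp

open Classical in
lemma card_neighbor (H : ULat (n + 1)) {k : ℤ} {x : Fin (n + 1) → Eis} (hx : nrm H.1 x = 7 * k) :
    (Nat.card {v : Line (n + 1) // x ∈ neighbor hp H.1 v.1} : ℝ) =
      6 + (7 ^ n - 7) * (if ψ ∘ x = 0 then 1 else 0) +
        (7 ^ (n + 1) - 7 ^ n) * (if ψ ∘ x = 0 ∧ ψ' ∘ x = 0 then 1 else 0) := by
  have hHx : ψ' ∘ (H.1 *ᵥ x) = H.1.map ψ' *ᵥ (ψ' ∘ x) := by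
    ext i; exact RingHom.map_mulVec _ _ _ _
  by_cases h1 : ψ ∘ x = 0
  · have h2 : ∀ v : Fin (n + 1) → F7, x ∈ neighbor hp H.1 v ↔ v ⬝ᵥ (ψ' ∘ (H.1 *ᵥ x)) = 0 :=
      fun v => ⟨fun h => h.2, fun h => ⟨⟨0, by rw [h1, zero_smul]⟩, h⟩⟩
    simp_rw [h2]
    rw [card_line_filter (fun v => v ⬝ᵥ (ψ' ∘ (H.1 *ᵥ x)) = 0) (zero_dotProduct _)]
    by_cases h3 : ψ' ∘ x = 0
    · simp only [h1, h3, hHx, mulVec_zero, dotProduct_zero]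
      rw [Nat.card_congr (Equiv.subtypeUnivEquiv fun _ => trivial)]
      simp; ring
    · have h4 : ψ' ∘ (H.1 *ᵥ x) ≠ 0 := fun h0 => h3 (by
        rw [← (map_unit_mulVec H ψ' (ψ' ∘ x)).1, ← hHx, h0, mulVec_zero])
      rw [card_orthogonal h4]
      simp [h1, h3]; ring
  · have h2 : (ψ ∘ x) ⬝ᵥ (ψ' ∘ (H.1 *ᵥ x)) = 0 := by
      rw [← hp.swap.map_form, ← nrm_cast H.2.1.herm, hx]
      push_cast
      rw [map_mul, map_seven, zero_mul]
    have h3 : Nat.card {v : Line (n + 1) // x ∈ neighbor hp H.1 v.1} = Nat.card {c : F7 // c ≠ 0} := by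
      refine (Nat.card_congr (Equiv.ofBijective (fun c : {c : F7 // c ≠ 0} =>
        (⟨⟨c.1 • (ψ ∘ x), smul_ne_zero c.2 h1⟩, ⟨c.1⁻¹, by rw [inv_smul_smul₀ c.2]⟩, by
          change (c.1 • (ψ ∘ x)) ⬝ᵥ (ψ' ∘ (H.1 *ᵥ x)) = 0
          rw [smul_dotProduct, h2, smul_zero]⟩ :
          {v : Line (n + 1) // x ∈ neighbor hp H.1 v.1})) ⟨?_, ?_⟩)).symm
      · intro c d h
        exact Subtype.ext (smul_left_injective _ h1 (congrArg (fun z => z.1.1) h))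
      · rintro ⟨⟨v, hv⟩, ⟨c, hc⟩, hv'⟩
        change ψ ∘ x = c • v at hc
        have hc0 : c ≠ 0 := by rintro rfl; exact h1 (by rw [hc, zero_smul])
        refine ⟨⟨c⁻¹, inv_ne_zero hc0⟩, Subtype.ext (Subtype.ext ?_)⟩
        change c⁻¹ • (ψ ∘ x) = v
        rw [hc, inv_smul_smul₀ hc0]
    have h4 : Nat.card {c : F7 // c ≠ 0} = 6 := by
      rw [Nat.card_eq_fintype_card]; rfl
    rw [h3, h4]
    simp [h1]

lemma natCard_subtype_sum {X : Type} [Fintype X] (P : X → Prop) [DecidablePred P] :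
    (Nat.card {x // P x} : ℝ) = ∑ x, if P x then 1 else 0 := by
  rw [Nat.card_eq_fintype_card, Fintype.card_subtype]
  simp

lemma card_prime_multiple {π : Eis} (hπ : ∀ z, ψ z = 0 ↔ ∃ w, z = π * w) (h7 : eNorm π = 7)
    (H : ULat n) (k : ℤ) :
    Nat.card {x : {x // nrm H.1 x = 7 * k} // ψ ∘ x.1 = 0} = rep H.1 k := by
  have h0 : π ≠ 0 := by rintro rfl; simp [eNorm] at h7
  refine (Nat.card_congr (Equiv.ofBijective (fun y : {y // nrm H.1 y = k} =>
    (⟨⟨π • y.1, by rw [nrm_smul H.2.1.herm, h7, y.2]⟩, by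
      ext1 i; exact (hπ _).mpr ⟨_, rfl⟩⟩ :
      {x : {x // nrm H.1 x = 7 * k} // ψ ∘ x.1 = 0})) ⟨?_, ?_⟩)).symm
  · intro y z h
    exact Subtype.ext (smul_right_injective _ h0 (congrArg (fun z => z.1.1) h))
  · rintro ⟨⟨x, hx⟩, hx'⟩
    choose y hy using fun i => (hπ _).mp (congrFun hx' i)
    obtain rfl : x = π • y := funext hy
    rw [nrm_smul H.2.1.herm, h7] at hx
    exact ⟨⟨y, by omega⟩, rfl⟩

lemma card_seven_multiple (hp : SplitPair ψ ψ') (H : ULat n) (k : ℤ) :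
    Nat.card {x : {x // nrm H.1 x = 7 * k} // ψ ∘ x.1 = 0 ∧ ψ' ∘ x.1 = 0} =
      Nat.card {y // 7 * nrm H.1 y = k} := by
  have e7 : eNorm 7 = 49 := by decide
  refine (Nat.card_congr (Equiv.ofBijective (fun y : {y // 7 * nrm H.1 y = k} =>
    (⟨⟨(7 : Eis) • y.1, by
      rw [nrm_smul H.2.1.herm, e7]; have := y.2; omega⟩, by
      constructor <;> ext1 i <;> simp [map_seven]⟩ :
      {x : {x // nrm H.1 x = 7 * k} // ψ ∘ x.1 = 0 ∧ ψ' ∘ x.1 = 0})) ⟨?_, ?_⟩)).symm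
  · intro y z h
    exact Subtype.ext (smul_right_injective _ seven_ne_zero (congrArg (fun z => z.1.1) h))
  · rintro ⟨⟨x, hx⟩, hx'⟩
    choose y hy using fun i => hp.ker _ (congrFun hx'.1 i) (congrFun hx'.2 i)
    obtain rfl : x = (7 : Eis) • y := funext hy
    rw [nrm_smul H.2.1.herm, e7] at hx
    exact ⟨⟨y, by omega⟩, rfl⟩

/-- Counting over all neighbors of a lattice. -/
lemma sum_rep_nbN {π : Eis} (hπ : ∀ z, ψ z = 0 ↔ ∃ w, z = π * w) (h7 : eNorm π = 7)
    (H : ULat (n + 1)) (k : ℤ) : ∑ v : Line (n + 1), (rep (nbN hp H v).1 k : ℝ) =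
      6 * rep H.1 (7 * k) + (7 ^ n - 7) * rep H.1 k +
        (7 ^ (n + 1) - 7 ^ n) * Nat.card {y // 7 * nrm H.1 y = k} := by
  classical
  simp_rw [rep_nbN, natCard_subtype_sum]
  rw [Finset.sum_comm]
  have h1 : ∀ x : {x // nrm H.1 x = 7 * k},
      (∑ v : Line (n + 1), if x.1 ∈ neighbor hp H.1 v.1 then (1 : ℝ) else 0) = _ :=
    fun x => (natCard_subtype_sum _).symm.trans (card_neighbor hp H x.2)
  simp_rw [h1]
  rw [Finset.sum_add_distrib, Finset.sum_add_distrib, ← Finset.mul_sum, ← Finset.mul_sum,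
    ← natCard_subtype_sum fun x : {x // nrm H.1 x = 7 * k} => ψ ∘ x.1 = 0,
    ← natCard_subtype_sum fun x : {x // nrm H.1 x = 7 * k} => ψ ∘ x.1 = 0 ∧ ψ' ∘ x.1 = 0,
    card_prime_multiple hπ h7, card_seven_multiple hp]
  simp only [Finset.sum_const, Finset.card_univ, nsmul_eq_mul, rep, Nat.card_eq_fintype_card]
  ring

/-- Evaluation of Eisenstein integers modulo a root of `X² + X + 1` in the field with seven
elements. -/
def evalF7 (r : F7) (hr : r * r = -1 - r) : Eis →+* F7 where
  toFun z := z.re + r * z.im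
  map_zero' := by simp
  map_one' := by simp [QuadraticAlgebra.re_one, QuadraticAlgebra.im_one]
  map_add' a b := by simp; ring
  map_mul' a b := by
    simp only [QuadraticAlgebra.re_mul, QuadraticAlgebra.im_mul]
    push_cast
    linear_combination (-(a.im : F7) * b.im) * hr

lemma splitPair_seven : SplitPair (evalF7 2 (by decide)) (evalF7 4 (by decide)) := by
  have c7 : (7 : F7) = 0 := by decide
  refine ⟨fun z => ?_, fun z => ?_, fun a b => ?_, fun z h1 h2 => ?_⟩
  · simp [evalF7]
    linear_combination (-(z.im : F7)) * c7
  · simp [evalF7]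
    linear_combination (-(z.im : F7)) * c7
  · obtain ⟨u, hu⟩ := ZMod.intCast_surjective (2 * a - b)
    obtain ⟨v, hv⟩ := ZMod.intCast_surjective (4 * (b - a))
    refine ⟨⟨u, v⟩, ?_, ?_⟩ <;>
      simp only [evalF7, RingHom.coe_mk, MonoidHom.coe_mk, OneHom.coe_mk, hu, hv]
    · linear_combination (b - a) * c7
    · linear_combination (-2 * a + 2 * b) * c7
  · simp only [evalF7, RingHom.coe_mk, MonoidHom.coe_mk, OneHom.coe_mk] at h1 h2
    have h1' : (((z.re + 2 * z.im : ℤ)) : F7) = 0 := by push_cast; exact h1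
    have h2' : (((z.re + 4 * z.im : ℤ)) : F7) = 0 := by push_cast; exact h2
    rw [ZMod.intCast_zmod_eq_zero_iff_dvd] at h1' h2'
    obtain ⟨a, ha⟩ : (7 : ℤ) ∣ z.re := by push_cast at h1' h2'; omega
    obtain ⟨b, hb⟩ : (7 : ℤ) ∣ z.im := by push_cast at h1' h2'; omega
    refine ⟨⟨a, b⟩, ?_⟩
    have : (7 : Eis) = ((7 : ℤ) : Eis) := by norm_num
    rw [this]
    ext <;> simp only [QuadraticAlgebra.re_mul, QuadraticAlgebra.im_mul,
      QuadraticAlgebra.re_intCast, QuadraticAlgebra.im_intCast, ha, hb, Int.cast_id] <;> ring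

lemma evalF7_ker (z : Eis) : evalF7 2 (by decide) z = 0 ↔ ∃ w, z = (⟨-2, 1⟩ : Eis) * w := by
  have e : evalF7 2 (by decide) z = ((z.re + 2 * z.im : ℤ) : F7) := by simp [evalF7]
  rw [e, ZMod.intCast_zmod_eq_zero_iff_dvd]
  constructor
  · rintro ⟨a, ha⟩
    push_cast at ha
    refine ⟨⟨-3 * a + z.im, -a⟩, ?_⟩
    ext <;> simp <;> linarith
  · rintro ⟨w, rfl⟩
    simp
    refine ⟨-w.im, by ring⟩

/-- The Hecke relation at `7` for averaged representation numbers. -/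
lemma hecke (k : ℤ) : (7 ^ n + 1) * W (n + 1) (fun H => rep H.1 k) =
    W (n + 1) (fun H => rep H.1 (7 * k)) +
      7 ^ n * W (n + 1) (fun H => Nat.card {y // 7 * nrm H.1 y = k}) := by
  have h1 := W_neighbor (n := n + 1) splitPair_seven k
  simp_rw [sum_rep_nbN splitPair_seven evalF7_ker (show eNorm ⟨-2, 1⟩ = 7 by decide)] at h1
  rw [W_add, W_add, W_mul, W_mul, W_mul] at h1
  rw [pow_succ] at h1
  linarith

/-- Averaged representation numbers of powers of `7`. -/
lemma W_rep_pow (n : ℕ) (k : ℕ) : W (n + 1) (fun H => rep H.1 (7 ^ k)) =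
    (∑ j ∈ Finset.range (k + 1), (7 ^ n : ℝ) ^ j) * W (n + 1) (fun H => rep H.1 1) := by
  induction k using Nat.strong_induction_on with
  | _ k ih =>
    match k with
    | 0 => simp
    | 1 =>
      have h := hecke (n := n) 1
      have h0 : ∀ H : ULat (n + 1), Nat.card {y // 7 * nrm H.1 y = 1} = 0 := fun H => by
        have : IsEmpty {y // 7 * nrm H.1 y = 1} := ⟨fun y => by have := y.2; omega⟩
        exact Nat.card_of_isEmpty
      simp only [h0, Nat.cast_zero] at h
      have h2 : W (n + 1) (fun _ => (0 : ℝ)) = 0 := by simp [W]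
      rw [h2, mul_zero, add_zero, mul_one] at h
      rw [pow_one, ← h]
      rw [Finset.sum_range_succ, Finset.sum_range_one, pow_zero, pow_one, add_comm]
    | k + 2 =>
      have h := hecke (n := n) (7 ^ (k + 1))
      have h0 : ∀ H : ULat (n + 1), Nat.card {y // 7 * nrm H.1 y = 7 ^ (k + 1)} = rep H.1 (7 ^ k) :=
        fun H => Nat.card_congr (Equiv.subtypeEquivRight fun y => by
          rw [pow_succ']; constructor <;> intro h <;> omega)
      simp only [h0] at h
      rw [ih k (by omega), ih (k + 1) (by omega), ← pow_succ'] at h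
      rw [Finset.sum_range_succ _ (k + 1 + 1)]
      rw [Finset.sum_range_succ _ (k + 1)] at h ⊢
      have e1 : (7 ^ n : ℝ) ^ (k + 1 + 1) = 7 ^ n * (7 ^ n) ^ (k + 1) := pow_succ' _ _
      rw [e1]
      linear_combination -h

end EisensteinMass

namespace EisensteinMass
open MeasureTheory UnitAddTorus

section Poisson

variable {ι : Type*} [Fintype ι]

lemma summable_exp_neg_int_sq {a : ℝ} (ha : 0 < a) :
    Summable fun k : ℤ => Real.exp (-a * (k : ℝ) ^ 2) := by
  have := summable_pow_mul_jacobiTheta₂_term_bound 0 (T := a / Real.pi) (by positivity) 0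
  refine this.congr fun k => ?_
  simp only [pow_zero, one_mul]
  congr 1
  field_simp
  simp

lemma summable_pi_prod {f : ℤ → ℝ} (h0 : ∀ k, 0 ≤ f k) (hf : Summable f) :
    Summable fun k : ι → ℤ => ∏ i, f (k i) := by
  classical
  refine summable_of_sum_le (c := ∏ _i : ι, ∑' k, f k)
    (fun k => Finset.prod_nonneg fun i _ => h0 _) fun s => ?_
  calc ∑ k ∈ s, ∏ i, f (k i)
      ≤ ∑ k ∈ Fintype.piFinset fun i => s.image (· i), ∏ i, f (k i) :=
        Finset.sum_le_sum_of_subset_of_nonneg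
          (fun k hk => Fintype.mem_piFinset.2 fun i => Finset.mem_image_of_mem _ hk)
          fun k _ _ => Finset.prod_nonneg fun i _ => h0 _
    _ = ∏ i, ∑ k ∈ s.image (· i), f k := (Finset.prod_univ_sum _ _).symm
    _ ≤ _ := Finset.prod_le_prod (fun i _ => Finset.sum_nonneg fun k _ => h0 k)
        fun i _ => hf.sum_le_tsum _ fun k _ => h0 k

lemma summable_exp_neg_norm_sq {a : ℝ} (ha : 0 < a) :
    Summable fun k : ι → ℤ => Real.exp (-a * ‖fun i => (k i : ℝ)‖ ^ 2) := by
  refine .of_nonneg_of_le (fun k => (Real.exp_pos _).le) (fun k => ?_)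
    (summable_pi_prod (fun k => (Real.exp_pos _).le)
      (summable_exp_neg_int_sq (a := a / (Fintype.card ι + 1)) (by positivity)))
  rw [← Real.exp_sum]
  refine Real.exp_le_exp.2 ?_
  rw [← Finset.mul_sum]
  have h : ∑ i, (k i : ℝ) ^ 2 ≤ (Fintype.card ι + 1) * ‖fun i => (k i : ℝ)‖ ^ 2 := by
    calc ∑ i, (k i : ℝ) ^ 2 ≤ ∑ _i : ι, ‖fun i => (k i : ℝ)‖ ^ 2 :=
          Finset.sum_le_sum fun i _ => by
            rw [← sq_abs]
            exact pow_le_pow_left₀ (abs_nonneg _) (norm_le_pi_norm (fun i => (k i : ℝ)) i) 2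
      _ ≤ _ := by simp; nlinarith [sq_nonneg ‖fun i => (k i : ℝ)‖]
  have := mul_le_mul_of_nonneg_left h (show 0 ≤ a / (Fintype.card ι + 1) by positivity)
  have e : a / (Fintype.card ι + 1) * ((Fintype.card ι + 1) * ‖fun i => (k i : ℝ)‖ ^ 2)
      = a * ‖fun i => (k i : ℝ)‖ ^ 2 := by field_simp
  rw [e] at this
  linarith

/-- Unit box with lower corner at an integer point. -/
def box (k : ι → ℤ) : Set (ι → ℝ) := {x | ∀ i, x i ∈ Set.Ioc (k i : ℝ) (k i + 1)}

lemma measurableSet_box (k : ι → ℤ) : MeasurableSet (box k) := by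
  have : box k = Set.univ.pi fun i => Set.Ioc (k i : ℝ) (k i + 1) := by
    ext; simp [box]
  rw [this]
  exact MeasurableSet.univ_pi fun i => measurableSet_Ioc

lemma mem_box {ι : Type*} {k : ι → ℤ} {x : ι → ℝ} : x ∈ box k ↔ ∀ i, ⌈x i⌉ = k i + 1 := by
  simp [box, Int.ceil_eq_iff]

lemma iUnion_box {ι : Type*} : ⋃ k : ι → ℤ, box k = Set.univ := by
  ext x
  simp only [Set.mem_iUnion, mem_box, Set.mem_univ, iff_true]
  exact ⟨fun i => ⌈x i⌉ - 1, fun i => by ring⟩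

lemma disjoint_box {ι : Type*} : Pairwise (Function.onFun Disjoint (box : (ι → ℤ) → Set (ι → ℝ))) := by
  intro k l hkl
  refine Set.disjoint_left.2 fun x hk hl => hkl (funext fun i => ?_)
  have := (mem_box.1 hk i).symm.trans (mem_box.1 hl i)
  omega

lemma setIntegral_box {E : Type*} [NormedAddCommGroup E] [NormedSpace ℝ E] (f : (ι → ℝ) → E)
    (k : ι → ℤ) :
    ∫ x in box k, f x = ∫ x in box (0 : ι → ℤ), f (x + fun i => (k i : ℝ)) := by
  have h := (measurePreserving_add_right (volume : Measure (ι → ℝ))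
    (fun i => (k i : ℝ))).setIntegral_preimage_emb
    (measurableEmbedding_addRight _) f (box k)
  rw [← h]
  congr 2
  ext x
  simp only [box, Set.mem_preimage, Set.mem_ofPred_eq, Set.mem_Ioc, Pi.add_apply, Pi.zero_apply]
  refine forall_congr' fun i => ?_
  constructor <;> rintro ⟨h1, h2⟩ <;> constructor <;> push_cast at * <;> linarith

lemma hasSum_box {E : Type*} [NormedAddCommGroup E] [NormedSpace ℝ E] {f : (ι → ℝ) → E}
    (hf : Integrable f) :
    HasSum (fun k : ι → ℤ => ∫ x in box (0 : ι → ℤ), f (x + fun i => (k i : ℝ))) (∫ x, f x) := by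
  have := hasSum_integral_iUnion (f := f) (μ := volume) (fun k : ι → ℤ => measurableSet_box k)
    disjoint_box (by simpa [iUnion_box] using hf)
  rw [iUnion_box, Measure.restrict_univ] at this
  simpa only [setIntegral_box f] using this

lemma integral_box_tsum {f : (ι → ℝ) → ℂ} (hf : Integrable f) :
    ∫ x in box (0 : ι → ℤ), ∑' k : ι → ℤ, f (x + fun i => (k i : ℝ)) = ∫ x, f x := by
  have h1 := hasSum_box hf
  have h2 := hasSum_box hf.norm
  have h3 := hasSum_integral_of_summable_integral_norm
    (μ := volume.restrict (box (0 : ι → ℤ)))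
    (F := fun (k : ι → ℤ) x => f (x + fun i => (k i : ℝ)))
    (fun k => (hf.comp_add_right _).integrableOn) h2.summable
  exact h3.unique h1

/-- The projection to the torus. -/
def torusMk (ι : Type*) : C(ι → ℝ, UnitAddTorus ι) where
  toFun x i := (x i : UnitAddCircle)
  continuous_toFun := continuous_pi fun i => continuous_quotient_mk'.comp (continuous_apply i)

lemma isOpenQuotientMap_torusMk {ι : Type*} : IsOpenQuotientMap (torusMk ι) :=
  IsOpenQuotientMap.piMap fun _ => QuotientAddGroup.isOpenQuotientMap_mk

lemma mFourier_coe (m : ι → ℤ) (x : ι → ℝ) :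
    mFourier m (torusMk ι x) = cexp (2 * Real.pi * I * ∑ i, (m i : ℂ) * x i) := by
  simp only [mFourier, ContinuousMap.coe_mk, torusMk, fourier_coe_apply]
  rw [← Complex.exp_sum, Finset.mul_sum]
  congr 1
  refine Finset.sum_congr rfl fun i _ => ?_
  push_cast
  ring

theorem poisson {f : (ι → ℝ) → ℂ} (hi : Integrable f)
    (hc : Continuous fun x => ∑' k : ι → ℤ, f (x + fun i => (k i : ℝ)))
    (hs : Summable fun m : ι → ℤ => ∫ x, cexp (-(2 * Real.pi * I * ∑ i, (m i : ℂ) * x i)) * f x) :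
    HasSum (fun m : ι → ℤ => ∫ x, cexp (-(2 * Real.pi * I * ∑ i, (m i : ℂ) * x i)) * f x)
      (∑' k : ι → ℤ, f (fun i => (k i : ℝ))) := by
  set P : (ι → ℝ) → ℂ := fun x => ∑' k : ι → ℤ, f (x + fun i => (k i : ℝ)) with hP
  have hfac : Function.FactorsThrough P (torusMk ι) := by
    intro x y hxy
    have h : ∀ i, ∃ k : ℤ, x i = y i + k := fun i => by
      have : (x i : UnitAddCircle) = (y i : UnitAddCircle) := congrFun hxy i
      rw [QuotientAddGroup.eq_iff_sub_mem, AddSubgroup.mem_zmultiples_iff] at this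
      obtain ⟨k, hk⟩ := this
      exact ⟨k, by simp at hk; linarith⟩
    choose l hl using h
    have hx : x = y + fun i => (l i : ℝ) := funext hl
    simp only [hP, hx]
    rw [← (Equiv.addLeft l).tsum_eq (fun k : ι → ℤ => f (y + fun i => (k i : ℝ)))]
    refine tsum_congr fun k => congrArg f ?_
    ext i
    simp [add_assoc]
  let Q : C(UnitAddTorus ι, ℂ) := isOpenQuotientMap_torusMk.isQuotientMap.lift ⟨P, hc⟩ hfac
  have hQ : ∀ x : ι → ℝ, Q (torusMk ι x) = P x := fun x =>
    congrArg (fun g : C(ι → ℝ, ℂ) => g x)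
      (isOpenQuotientMap_torusMk.isQuotientMap.lift_comp ⟨P, hc⟩ hfac)
  have hcoeff : ∀ m : ι → ℤ, mFourierCoeff Q m =
      ∫ x, cexp (-(2 * Real.pi * I * ∑ i, (m i : ℂ) * x i)) * f x := by
    intro m
    have hper : ∀ (x : ι → ℝ) (k : ι → ℤ), cexp (-(2 * Real.pi * I * ∑ i, (m i : ℂ) * x i)) =
        cexp (-(2 * Real.pi * I * ∑ i, (m i : ℂ) * ((x + fun i => (k i : ℝ)) i : ℝ))) := by
      intro x k
      refine (Complex.exp_eq_exp_iff_exists_int.2 ⟨∑ i, m i * k i, ?_⟩)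
      simp only [Pi.add_apply]
      push_cast
      simp only [mul_add, Finset.sum_add_distrib]
      ring
    have hfI : Integrable fun x : ι → ℝ =>
        cexp (-(2 * Real.pi * I * ∑ i, (m i : ℂ) * x i)) * f x := by
      refine hi.bdd_mul (c := 1)
        (Continuous.aestronglyMeasurable (by fun_prop)) (.of_forall fun x => ?_)
      rw [Complex.norm_exp]
      have : (-(2 * Real.pi * I * ∑ i, (m i : ℂ) * x i)).re = 0 := by
        have : (∑ i, (m i : ℂ) * x i) = ((∑ i, (m i : ℝ) * x i : ℝ) : ℂ) := by push_cast; rfl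
        rw [this]
        simp [-ofReal_sum]
      simp [this]
    rw [← integral_box_tsum hfI, mFourierCoeff_eq_integral _ _ 0]
    have hb : {x : ι → ℝ | ∀ i, x i ∈ Set.Ioc ((0 : ι → ℝ) i) ((0 : ι → ℝ) i + 1)} =
        box (0 : ι → ℤ) := by simp [box]
    rw [hb]
    refine integral_congr_ae (.of_forall fun x => ?_)
    change mFourier (-m) (torusMk ι x) • Q (torusMk ι x) = _
    rw [hQ, mFourier_coe, smul_eq_mul, hP, ← tsum_mul_left]
    refine tsum_congr fun k => ?_
    rw [← hper x k]
    congr 2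
    simp
  have := hasSum_mFourier_series_apply_of_summable (f := Q) (by simpa only [funext hcoeff] using hs)
    (torusMk ι 0)
  rw [hQ] at this
  simp only [hcoeff, mFourier_coe] at this
  simpa [hP] using this

end Poisson
end EisensteinMass

namespace EisensteinMass
open MeasureTheory UnitAddTorus

section GaussianPoisson

variable {ι : Type*} [Fintype ι]

lemma exists_lower_bound (T : (ι → ℝ) ≃L[ℝ] EuclideanSpace ℝ ι) :
    ∃ κ : ℝ, 0 < κ ∧ ∀ x, κ * ‖x‖ ^ 2 ≤ ‖T x‖ ^ 2 := by
  set C := ‖(T.symm : EuclideanSpace ℝ ι →L[ℝ] (ι → ℝ))‖ + 1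
  have hC : 0 < C := by positivity
  refine ⟨1 / C ^ 2, by positivity, fun x => ?_⟩
  have h : ‖x‖ ≤ C * ‖T x‖ := by
    have := (T.symm : EuclideanSpace ℝ ι →L[ℝ] (ι → ℝ)).le_opNorm (T x)
    simp only [ContinuousLinearEquiv.coe_coe, ContinuousLinearEquiv.symm_apply_apply] at this
    nlinarith [norm_nonneg (T x)]
  rw [one_div, inv_mul_le_iff₀ (by positivity), ← mul_pow]
  exact pow_le_pow_left₀ (norm_nonneg _) h 2

lemma norm_gaussian (b : ℂ) (r : ℝ) : ‖cexp (-b * (r : ℂ) ^ 2)‖ = Real.exp (-b.re * r ^ 2) := by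
  rw [Complex.norm_exp]
  congr 1
  rw [← ofReal_pow]
  simp [-ofReal_pow]

theorem gaussian_poisson (T : (ι → ℝ) ≃L[ℝ] EuclideanSpace ℝ ι)
    (S : (ι → ℤ) → EuclideanSpace ℝ ι)
    (hS : ∀ m x, inner ℝ (S m) (T x) = ∑ i, (m i : ℝ) * x i) :
    ∃ c : ℂ, ∀ b : ℂ, 0 < b.re →
      (Summable fun k : ι → ℤ => cexp (-b * (‖T fun i => (k i : ℝ)‖ : ℂ) ^ 2)) ∧
      ∑' k : ι → ℤ, cexp (-b * (‖T fun i => (k i : ℝ)‖ : ℂ) ^ 2) =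
        c * (Real.pi / b) ^ (Fintype.card ι / 2 : ℂ) *
          ∑' m, cexp (-(Real.pi ^ 2 / b) * (‖S m‖ : ℂ) ^ 2) := by
  classical
  obtain ⟨κ, hκ, hT⟩ := exists_lower_bound T
  have hSm : ∀ m : ι → ℤ, ‖fun i => (m i : ℝ)‖ ≤
      ‖(T : (ι → ℝ) →L[ℝ] EuclideanSpace ℝ ι)‖ * ‖S m‖ := by
    intro m
    refine (pi_norm_le_iff_of_nonneg (by positivity)).2 fun i => ?_
    have h1 := hS m (Pi.single i 1)
    simp only [Pi.single_apply, mul_ite, mul_one, mul_zero, Finset.sum_ite_eq',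
      Finset.mem_univ, if_true] at h1
    rw [← h1]
    refine (norm_inner_le_norm _ _).trans ?_
    rw [mul_comm]
    refine mul_le_mul_of_nonneg_right ?_ (norm_nonneg _)
    have := (T : (ι → ℝ) →L[ℝ] EuclideanSpace ℝ ι).le_opNorm (Pi.single i 1)
    rwa [Pi.norm_single, norm_one, mul_one] at this
  obtain ⟨c, hc⟩ : ∃ c : NNReal, (volume : Measure (ι → ℝ)).map T =
      c • (volume : Measure (EuclideanSpace ℝ ι)) := by
    have := T.isAddHaarMeasure_map (volume : Measure (ι → ℝ))
    exact ⟨_, Measure.isAddLeftInvariant_eq_smul _ _⟩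
  refine ⟨(c : ℂ), fun b hb => ?_⟩
  set f : (ι → ℝ) → ℂ := fun x => cexp (-b * (‖T x‖ : ℂ) ^ 2) with hf
  have hfc : Continuous f := by fun_prop
  have hbound : ∀ x, ‖f x‖ ≤ Real.exp (-(b.re * κ) * ‖x‖ ^ 2) := fun x => by
    rw [hf]
    simp only
    rw [norm_gaussian]
    refine Real.exp_le_exp.2 ?_
    have := mul_le_mul_of_nonneg_left (hT x) hb.le
    linarith
  have hsum : ∀ R : ℝ, ∃ u : (ι → ℤ) → ℝ, Summable u ∧ ∀ k x, x ∈ Metric.ball (0 : ι → ℝ) R →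
      ‖f (x + fun i => (k i : ℝ))‖ ≤ u k := by
    intro R
    have ha : 0 < b.re * κ := by positivity
    refine ⟨fun k => Real.exp (b.re * κ * R ^ 2) *
      Real.exp (-(b.re * κ / 2) * ‖fun i => (k i : ℝ)‖ ^ 2),
      (summable_exp_neg_norm_sq (by positivity)).mul_left _, fun k x hx => ?_⟩
    refine (hbound _).trans ?_
    simp only
    rw [← Real.exp_add]
    refine Real.exp_le_exp.2 ?_
    have h1 : ‖fun i => (k i : ℝ)‖ ≤ ‖x + fun i => (k i : ℝ)‖ + ‖x‖ := by
      have := norm_sub_le (x + fun i => (k i : ℝ)) x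
      simpa using this
    have h2 : ‖x‖ < R := by simpa using hx
    have h3 : ‖fun i => (k i : ℝ)‖ ^ 2 ≤ 2 * ‖x + fun i => (k i : ℝ)‖ ^ 2 + 2 * R ^ 2 := by
      have h4 := pow_le_pow_left₀ (norm_nonneg _) h1 2
      have h5 := pow_le_pow_left₀ (norm_nonneg _) h2.le 2
      nlinarith [sq_nonneg (‖x + fun i => (k i : ℝ)‖ - ‖x‖)]
    nlinarith
  have hsum0 : Summable fun k : ι → ℤ => f fun i => (k i : ℝ) := by
    obtain ⟨u, hu, h⟩ := hsum 1
    exact .of_norm_bounded hu fun k => by simpa using h k 0 (by simp)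
  refine ⟨hsum0, ?_⟩
  have hcont : Continuous fun x => ∑' k : ι → ℤ, f (x + fun i => (k i : ℝ)) := by
    refine continuous_iff_continuousAt.2 fun x => ?_
    obtain ⟨u, hu, h⟩ := hsum (‖x‖ + 1)
    have := continuousOn_tsum (s := Metric.ball (0 : ι → ℝ) (‖x‖ + 1))
      (f := fun (k : ι → ℤ) x => f (x + fun i => (k i : ℝ)))
      (fun k => (hfc.comp (continuous_id.add continuous_const)).continuousOn) hu h
    exact this.continuousAt (Metric.isOpen_ball.mem_nhds (by simp))
  have hval : ∀ w : EuclideanSpace ℝ ι, ∀ z : ℂ, ∫ x, cexp (-b * (‖T x‖ : ℂ) ^ 2 + z * inner ℝ w (T x)) =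
      c * ((Real.pi / b) ^ (Fintype.card ι / 2 : ℂ) * cexp (z ^ 2 * ‖w‖ ^ 2 / (4 * b))) := by
    intro w z
    rw [← GaussianFourier.integral_cexp_neg_mul_sq_norm_add_of_euclideanSpace hb]
    have h := T.toHomeomorph.measurableEmbedding.integral_map (μ := (volume : Measure (ι → ℝ)))
      (fun v : EuclideanSpace ℝ ι => cexp (-b * (‖v‖ : ℂ) ^ 2 + z * inner ℝ w v))
    refine h.symm.trans ?_
    change ∫ y, _ ∂((volume : Measure (ι → ℝ)).map T) = _
    rw [hc, integral_smul_nnreal_measure]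
    rfl
  have hfI : Integrable f := by
    have h0 : Integrable (fun v : EuclideanSpace ℝ ι => cexp (-b * (‖v‖ : ℂ) ^ 2)) := by
      have := GaussianFourier.integrable_cexp_neg_mul_sq_norm_add (V := EuclideanSpace ℝ ι)
        hb 0 0
      simpa using this
    have h1 : Integrable (fun v : EuclideanSpace ℝ ι => cexp (-b * (‖v‖ : ℂ) ^ 2))
        ((volume : Measure (ι → ℝ)).map T) := by
      rw [hc]
      exact h0.smul_measure_nnreal
    exact (T.toHomeomorph.measurableEmbedding.integrable_map_iff).1 h1
  have hcoef : ∀ m : ι → ℤ, ∫ x, cexp (-(2 * Real.pi * I * ∑ i, (m i : ℂ) * x i)) * f x =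
      c * (Real.pi / b) ^ (Fintype.card ι / 2 : ℂ) *
        cexp (-(Real.pi ^ 2 / b) * (‖S m‖ : ℂ) ^ 2) := by
    intro m
    have hb0 : b ≠ 0 := by rintro rfl; simp at hb
    calc _ = ∫ x, cexp (-b * (‖T x‖ : ℂ) ^ 2 + (-(2 * Real.pi * I)) * inner ℝ (S m) (T x)) := by
          refine integral_congr_ae (.of_forall fun x => ?_)
          simp only [hf]
          rw [← Complex.exp_add, hS]
          congr 1
          push_cast
          ring
      _ = _ := by
          have e : (-(2 * Real.pi * I)) ^ 2 * (‖S m‖ : ℂ) ^ 2 / (4 * b) =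
              -(Real.pi ^ 2 / b) * (‖S m‖ : ℂ) ^ 2 := by
            rw [neg_sq, mul_pow, mul_pow, I_sq]
            field_simp
            ring
          rw [hval, e]
          ring
  have hsumS : Summable fun m => cexp (-(Real.pi ^ 2 / b) * (‖S m‖ : ℂ) ^ 2) := by
    set K := ‖(T : (ι → ℝ) →L[ℝ] EuclideanSpace ℝ ι)‖ + 1
    have hre : 0 < (Real.pi ^ 2 / b : ℂ).re := by
      rw [← ofReal_pow, Complex.div_re]
      have hb0 : b ≠ 0 := by rintro rfl; simp at hb
      have := Complex.normSq_pos.2 hb0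
      simp only [ofReal_re, ofReal_im, zero_mul, zero_div, add_zero]
      positivity
    refine .of_norm_bounded (summable_exp_neg_norm_sq (ι := ι)
      (a := (Real.pi ^ 2 / b : ℂ).re / K ^ 2) (by positivity)) fun m => ?_
    rw [norm_gaussian]
    refine Real.exp_le_exp.2 ?_
    have h1 : ‖fun i => (m i : ℝ)‖ ≤ K * ‖S m‖ := (hSm m).trans
      (mul_le_mul_of_nonneg_right (by simp [K]) (norm_nonneg _))
    have h2 := pow_le_pow_left₀ (norm_nonneg _) h1 2
    rw [neg_mul, neg_mul, neg_le_neg_iff, div_mul_eq_mul_div, div_le_iff₀ (by positivity)]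
    have h3 := mul_le_mul_of_nonneg_left h2 hre.le
    linarith
  have := poisson hfI hcont (by simpa only [hcoef] using hsumS.mul_left _)
  simp only [hcoef] at this
  rw [← this.tsum_eq, tsum_mul_left]

end GaussianPoisson
end EisensteinMass

namespace EisensteinMass

section Theta
variable {n : ℕ}

/-- Real and imaginary parts of a complex vector. -/
def realify (w : Fin n → ℂ) : EuclideanSpace ℝ (Fin n × Fin 2) :=
  WithLp.toLp 2 fun p => ![(w p.1).re, (w p.1).im] p.2

lemma inner_realify (u w : Fin n → ℂ) : inner ℝ (realify u) (realify w) = (star u ⬝ᵥ w).re := by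
  simp [PiLp.inner_apply, realify, Fintype.sum_prod_type, dotProduct]
  exact Finset.sum_congr rfl fun i _ => by ring

lemma norm_realify_sq (w : Fin n → ℂ) :
    ‖realify w‖ ^ 2 = ∑ i, Complex.normSq (w i) := by
  rw [← real_inner_self_eq_norm_sq, inner_realify, star_dot_self, ofReal_re]

/-- Complex vector with given coordinates in the real basis `1, ω`. -/
def complexify (v : Fin n × Fin 2 → ℝ) : Fin n → ℂ := fun i => v (i, 0) + v (i, 1) * ω

/-- The real coordinate map attached to a complex matrix. -/
def coordMap (A : Matrix (Fin n) (Fin n) ℂ) :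
    (Fin n × Fin 2 → ℝ) →ₗ[ℝ] EuclideanSpace ℝ (Fin n × Fin 2) where
  toFun v := realify (A *ᵥ complexify v)
  map_add' u v := by
    have : complexify (u + v) = complexify u + complexify v := by
      ext i; simp [complexify]; ring
    rw [this, mulVec_add]
    ext ⟨i, j⟩
    fin_cases j <;> simp [realify]
  map_smul' r v := by
    have : complexify (r • v) = (r : ℂ) • complexify v := by
      ext i; simp [complexify]; ring
    rw [this, mulVec_smul]
    ext ⟨i, j⟩
    fin_cases j <;> simp [realify]

lemma realify_eq_zero {w : Fin n → ℂ} (h : realify w = 0) : w = 0 := by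
  ext i
  have h0 := congrArg (fun v : EuclideanSpace ℝ (Fin n × Fin 2) => v (i, 0)) h
  have h1 := congrArg (fun v : EuclideanSpace ℝ (Fin n × Fin 2) => v (i, 1)) h
  exact Complex.ext (by simpa [realify] using h0) (by simpa [realify] using h1)

lemma complexify_eq_zero {v : Fin n × Fin 2 → ℝ} (h : complexify v = 0) : v = 0 := by
  ext ⟨i, j⟩
  have h0 := congrFun h i
  have hi : v (i, 1) = 0 := by
    have := congrArg Complex.im h0
    simpa [complexify, ω] using this
  have hr : v (i, 0) = 0 := by
    have := congrArg Complex.re h0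
    simpa [complexify, ω, hi] using this
  fin_cases j
  · exact hr
  · exact hi

lemma coordMap_injective {A : Matrix (Fin n) (Fin n) ℂ} (hA : IsUnit A) :
    Function.Injective (coordMap A) := by
  refine (injective_iff_map_eq_zero _).2 fun v hv => complexify_eq_zero ?_
  obtain ⟨B, hB⟩ := hA.exists_left_inv
  have := realify_eq_zero (w := A *ᵥ complexify v) hv
  rw [← one_mulVec (complexify v), ← hB, ← mulVec_mulVec, this, mulVec_zero]

/-- `coordMap` as a continuous equivalence. -/
def coordEquiv {A : Matrix (Fin n) (Fin n) ℂ} (hA : IsUnit A) :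
    (Fin n × Fin 2 → ℝ) ≃L[ℝ] EuclideanSpace ℝ (Fin n × Fin 2) :=
  (LinearMap.linearEquivOfInjective (coordMap A) (coordMap_injective hA)
    (by simp)).toContinuousLinearEquiv

lemma coordEquiv_apply {A : Matrix (Fin n) (Fin n) ℂ} (hA : IsUnit A) (v : Fin n × Fin 2 → ℝ) :
    coordEquiv hA v = realify (A *ᵥ complexify v) := rfl

/-- Integer coordinates of Eisenstein vectors. -/
def eisCoord (n : ℕ) : (Fin n × Fin 2 → ℤ) ≃ (Fin n → Eis) where
  toFun k i := ⟨k (i, 0), k (i, 1)⟩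
  invFun x p := ![(x p.1).re, (x p.1).im] p.2
  left_inv k := by ext ⟨i, j⟩; fin_cases j <;> rfl
  right_inv x := rfl

/-- Integer coordinates of Eisenstein vectors, dual to `eisCoord` for the trace pairing. -/
def eisDual (n : ℕ) : (Fin n × Fin 2 → ℤ) ≃ (Fin n → Eis) where
  toFun k i := ⟨-k (i, 1), k (i, 0)⟩
  invFun x p := ![(x p.1).im, -(x p.1).re] p.2
  left_inv k := by ext ⟨i, j⟩; fin_cases j <;> simp
  right_inv x := by simp

lemma complexify_intCast (k : Fin n × Fin 2 → ℤ) :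
    complexify (fun p => (k p : ℝ)) = toC ∘ eisCoord n k := by
  ext i; simp only [complexify, Function.comp_apply, toC_apply, ofReal_intCast]; rfl

lemma trace_pairing (m : Fin n × Fin 2 → ℤ) (v : Fin n × Fin 2 → ℝ) :
    ((2 * I / √3 : ℂ) * (star (toC ∘ eisDual n m) ⬝ᵥ complexify v)).re = ∑ p, (m p : ℝ) * v p := by
  have h3 : (√3 : ℝ) * √3 = 3 := Real.mul_self_sqrt (by norm_num)
  have h0 : (√3 : ℝ) ≠ 0 := by positivity
  rw [Fintype.sum_prod_type, dotProduct, Finset.mul_sum, Complex.re_sum]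
  refine Finset.sum_congr rfl fun i _ => ?_
  have e : (2 * I / √3 : ℂ) = ((2 / √3 : ℝ) : ℂ) * I := by push_cast; ring
  rw [e, mul_assoc, re_ofReal_mul]
  simp only [Fin.sum_univ_two, eisDual, complexify, Equiv.coe_fn_mk, Function.comp_apply,
    Pi.star_apply, Complex.mul_re, Complex.mul_im, I_re, I_im, RCLike.star_def, conj_re, conj_im,
    toC_re, toC_im, Complex.add_re, Complex.add_im, ω, ofReal_re, ofReal_im]
  push_cast
  field_simp
  simp
  ring_nf

/-- The equivalence of Eisenstein vectors given by a unimodular matrix. -/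
def mulVecEquiv {H : EMat n} (h : H.det = 1) : (Fin n → Eis) ≃ (Fin n → Eis) where
  toFun z := H⁻¹ *ᵥ z
  invFun z := H *ᵥ z
  left_inv z := by
    simp only
    rw [mulVec_mulVec, mul_nonsing_inv _ (by simp [h]), one_mulVec]
  right_inv z := by
    simp only
    rw [mulVec_mulVec, nonsing_inv_mul _ (by simp [h]), one_mulVec]

/-- The theta series of a Hermitian lattice. -/
def theta (H : EMat n) (τ : ℂ) : ℂ := ∑' x : Fin n → Eis, cexp (2 * Real.pi * I * τ * nrm H x)

theorem theta_main {H : EMat n} (hp : PD H) (hd : H.det = 1) :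
    (∀ τ : ℂ, 0 < τ.im → Summable fun x : Fin n → Eis => cexp (2 * Real.pi * I * τ * nrm H x)) ∧
    ∃ c : ℂ, ∀ τ : ℂ, 0 < τ.im → theta H τ = c * (I / (2 * τ)) ^ n * theta H (-1 / (3 * τ)) := by
  obtain ⟨A, hA, hHA⟩ := hp.factor
  have h3 : (√3 : ℂ) * √3 = 3 := by
    rw [← ofReal_mul, Real.mul_self_sqrt (by norm_num)]; norm_num
  have h0 : (√3 : ℂ) ≠ 0 := fun h => by rw [h] at h3; norm_num at h3
  obtain ⟨c, hc⟩ := gaussian_poisson (coordEquiv hA)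
    (fun m => realify (A *ᵥ ((-2 * I / √3 : ℂ) • (toC ∘ mulVecEquiv hd (eisDual n m))))) (by
      intro m x
      rw [coordEquiv_apply, inner_realify, ← trace_pairing, star_mulVec, ← dotProduct_mulVec,
        mulVec_mulVec, ← hHA]
      congr 1
      rw [star_smul, smul_dotProduct, smul_eq_mul]
      congr 1
      · simp
      · set z := eisDual n m
        have : z = H *ᵥ (mulVecEquiv hd z) := ((mulVecEquiv hd).symm_apply_apply z).symm
        conv_rhs => rw [this, map_mulVec, star_mulVec, ← dotProduct_mulVec]
        rw [← map_conj, hp.herm])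
  have hT : ∀ k : Fin n × Fin 2 → ℤ, ((‖coordEquiv hA fun i => (k i : ℝ)‖ : ℂ)) ^ 2 =
      nrm H (eisCoord n k) := by
    intro k
    rw [coordEquiv_apply, ← ofReal_pow, norm_realify_sq, complexify_intCast, ← nrm_factor hp hHA]
    simp
  have hS : ∀ m : Fin n × Fin 2 → ℤ, ((‖realify (A *ᵥ ((-2 * I / √3 : ℂ) •
      (toC ∘ mulVecEquiv hd (eisDual n m))))‖ : ℂ)) ^ 2 =
      4 / 3 * nrm H (mulVecEquiv hd (eisDual n m)) := by
    intro m
    have e : Complex.normSq (-2 * I / √3) = 4 / 3 := by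
      simp only [map_div₀, map_mul, normSq_neg, normSq_I, normSq_ofReal]
      rw [Real.mul_self_sqrt (by norm_num)]
      norm_num [normSq]
    rw [← ofReal_pow, norm_realify_sq, mulVec_smul]
    simp only [Pi.smul_apply, smul_eq_mul, map_mul]
    rw [← Finset.mul_sum, ← nrm_factor hp hHA, e]
    push_cast
    rfl
  simp only [hT, hS] at hc
  have hre : ∀ τ : ℂ, 0 < τ.im → 0 < (-2 * Real.pi * I * τ).re := by
    intro τ hτ
    simp
    positivity
  have hexp : ∀ τ : ℂ, ∀ x : Fin n → Eis, cexp (-(-2 * Real.pi * I * τ) * nrm H x) =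
      cexp (2 * Real.pi * I * τ * nrm H x) := fun τ x => by ring_nf
  refine ⟨fun τ hτ => ?_, c, fun τ hτ => ?_⟩
  · have := (hc _ (hre τ hτ)).1
    simp only [hexp] at this
    exact (eisCoord n).summable_iff.1 this
  · have := (hc _ (hre τ hτ)).2
    simp only [hexp] at this
    have hτ0 : τ ≠ 0 := by rintro rfl; simp at hτ
    have hpi : (Real.pi : ℂ) ≠ 0 := by simp
    rw [theta, ← (eisCoord n).tsum_eq, this]
    congr 1
    · congr 1
      have : ((Fintype.card (Fin n × Fin 2) : ℕ) : ℂ) / 2 = (n : ℂ) := by simp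
      rw [this, cpow_natCast]
      congr 1
      field_simp
      rw [I_sq]
    · rw [theta, ← ((eisDual n).trans (mulVecEquiv hd)).tsum_eq]
      refine tsum_congr fun m => ?_
      congr 1
      simp only [Equiv.trans_apply]
      field_simp
      rw [I_sq]
      ring

theorem theta_summable {H : EMat n} (hp : PD H) (hd : H.det = 1) {τ : ℂ} (hτ : 0 < τ.im) :
    Summable fun x : Fin n → Eis => cexp (2 * Real.pi * I * τ * nrm H x) :=
  (theta_main hp hd).1 τ hτ

theorem theta_inv {H : EMat n} (hp : PD H) (hd : H.det = 1) {τ : ℂ} (hτ : 0 < τ.im) :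
    theta H (-1 / (3 * τ)) = (-I * √3 * τ) ^ n * theta H τ := by
  have h3 : (√3 : ℂ) * √3 = 3 := by
    rw [← ofReal_mul, Real.mul_self_sqrt (by norm_num)]; norm_num
  have h0 : (√3 : ℂ) ≠ 0 := fun h => by rw [h] at h3; norm_num at h3
  obtain ⟨c, hc⟩ := (theta_main hp hd).2
  have him : 0 < (I / √3 : ℂ).im := by
    rw [div_ofReal_im, I_im]; positivity
  have hfix : -1 / (3 * (I / √3 : ℂ)) = I / √3 := by
    field_simp
    rw [I_sq, pow_two, h3]
    ring
  have hne : theta H (I / √3) ≠ 0 := by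
    have e : ∀ x, cexp (2 * Real.pi * I * (I / √3) * nrm H x) =
        (Real.exp (-(2 * Real.pi / √3) * nrm H x) : ℂ) := by
      intro x
      push_cast
      congr 1
      field_simp
      rw [I_sq, neg_one_mul]
    have hs := theta_summable hp hd him
    simp only [theta, e] at hs ⊢
    rw [← Complex.ofReal_tsum, ofReal_ne_zero]
    exact (Summable.tsum_pos (Complex.summable_ofReal.1 hs) (fun x => (Real.exp_pos _).le) 0
      (Real.exp_pos _)).ne'
  have h1 := hc _ him
  rw [hfix] at h1
  have hcv : c * (√3 / 2) ^ n = 1 := by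
    have e : I / (2 * (I / √3)) = (√3 / 2 : ℂ) := by field_simp
    rw [e] at h1
    exact mul_right_cancel₀ hne (by rw [← h1, one_mul])
  have hτ0 : τ ≠ 0 := by rintro rfl; simp at hτ
  have h2 := hc τ hτ
  have e : (-I * √3 * τ) ^ n * (I / (2 * τ)) ^ n = (√3 / 2) ^ n := by
    rw [← mul_pow]
    congr 1
    field_simp
    rw [I_sq]
    ring
  calc _ = c * (√3 / 2) ^ n * theta H (-1 / (3 * τ)) := by rw [hcv, one_mul]
    _ = (-I * √3 * τ) ^ n * (c * (I / (2 * τ)) ^ n * theta H (-1 / (3 * τ))) := by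
      rw [← e]; ring
    _ = _ := by rw [← h2]

end Theta
end EisensteinMass

namespace EisensteinMass

section QExpansions

/-- The function `F` on the upper half plane is given by an absolutely convergent `q`-series. -/
def QExp (F : ℂ → ℂ) (a : ℕ → ℂ) : Prop :=
  ∀ τ : ℂ, 0 < τ.im → HasSum (fun N : ℕ => a N * cexp (2 * Real.pi * I * τ * N)) (F τ)

lemma QExp.of_fibers {J : Type*} {F : ℂ → ℂ} {α : J → ℂ} {ν : J → ℕ}
    (h : ∀ τ : ℂ, 0 < τ.im → HasSum (fun j => α j * cexp (2 * Real.pi * I * τ * ν j)) (F τ)) :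
    QExp F fun N => ∑' j : ν ⁻¹' {N}, α j := by
  intro τ hτ
  refine ((h τ hτ).tsum_fiberwise ν).congr_fun fun N => ?_
  rw [← tsum_mul_right]
  refine tsum_congr fun j => ?_
  rw [show ν j = N from j.2]

lemma QExp.add {F G : ℂ → ℂ} {a b : ℕ → ℂ} (hF : QExp F a) (hG : QExp G b) :
    QExp (fun τ => F τ + G τ) fun N => a N + b N := fun τ hτ => by
  simpa only [add_mul] using (hF τ hτ).add (hG τ hτ)

lemma QExp.mul_left {F : ℂ → ℂ} {a : ℕ → ℂ} (c : ℂ) (hF : QExp F a) :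
    QExp (fun τ => c * F τ) fun N => c * a N := fun τ hτ => by
  simpa only [mul_assoc] using (hF τ hτ).mul_left c

lemma QExp.sum {ι : Type*} (s : Finset ι) {F : ι → ℂ → ℂ} {a : ι → ℕ → ℂ}
    (h : ∀ i ∈ s, QExp (F i) (a i)) :
    QExp (fun τ => ∑ i ∈ s, F i τ) fun N => ∑ i ∈ s, a i N := fun τ hτ => by
  simpa only [Finset.sum_mul] using hasSum_sum fun i hi => h i hi τ hτ

lemma QExp.const (c : ℂ) : QExp (fun _ => c) fun N => if N = 0 then c else 0 := fun τ _ => by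
  refine (hasSum_ite_eq 0 c).congr_fun fun N => ?_
  by_cases h : N = 0 <;> simp [h]

lemma QExp.congr {F G : ℂ → ℂ} {a : ℕ → ℂ} (h : QExp F a)
    (hFG : ∀ τ : ℂ, 0 < τ.im → F τ = G τ) : QExp G a := fun τ hτ => hFG τ hτ ▸ h τ hτ

lemma QExp.periodic {F : ℂ → ℂ} {a : ℕ → ℂ} (h : QExp F a) {τ : ℂ} (hτ : 0 < τ.im) (k : ℤ) :
    F (τ + k) = F τ := by
  refine (h _ (by simpa using hτ)).unique ((h _ hτ).congr_fun fun N => ?_)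
  congr 1
  refine Complex.exp_eq_exp_iff_exists_int.2 ⟨k * N, ?_⟩
  push_cast
  ring

/-- A vanishing constant term forces exponential decay. -/
lemma QExp.decay {F : ℂ → ℂ} {a : ℕ → ℂ} (h : QExp F a) (h0 : a 0 = 0) {y₀ : ℝ} (hy : 0 < y₀) :
    ∃ B : ℝ, 0 ≤ B ∧ ∀ τ : ℂ, y₀ ≤ τ.im → ‖F τ‖ ≤ B * Real.exp (-2 * Real.pi * τ.im) := by
  have hs := (h (y₀ * I) (by simpa using hy)).summable.norm
  refine ⟨Real.exp (2 * Real.pi * y₀) * ∑' N : ℕ, ‖a N * cexp (2 * Real.pi * I * (y₀ * I) * N)‖,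
    mul_nonneg (Real.exp_pos _).le (tsum_nonneg fun _ => norm_nonneg _), fun τ hτ => ?_⟩
  have hτ' := h τ (hy.trans_le hτ)
  rw [← hτ'.tsum_eq]
  have hexp : ∀ (z : ℂ) (N : ℕ), ‖cexp (2 * Real.pi * I * z * N)‖ =
      Real.exp (-2 * Real.pi * z.im * N) := by
    intro z N
    rw [Complex.norm_exp]
    congr 1
    have : 2 * (Real.pi : ℂ) * I * z * N = ((2 * Real.pi * N : ℝ) : ℂ) * (I * z) := by
      push_cast; ring
    rw [this, re_ofReal_mul]
    simp
    ring
  have key : ∀ N : ℕ, ‖a N * cexp (2 * Real.pi * I * τ * N)‖ ≤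
      Real.exp (2 * Real.pi * y₀) * Real.exp (-2 * Real.pi * τ.im) *
        ‖a N * cexp (2 * Real.pi * I * (y₀ * I) * N)‖ := by
    intro N
    rcases Nat.eq_zero_or_pos N with rfl | hN
    · simp [h0]
    · rw [norm_mul, norm_mul, hexp, hexp, mul_left_comm, ← Real.exp_add, ← Real.exp_add]
      refine mul_le_mul_of_nonneg_left (Real.exp_le_exp.2 ?_) (norm_nonneg _)
      have hN' : (1 : ℝ) ≤ N := by exact_mod_cast hN
      have : (y₀ * I : ℂ).im = y₀ := by simp
      rw [this]
      have := Real.pi_pos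
      nlinarith [mul_nonneg this.le (mul_nonneg (sub_nonneg.2 hN') (sub_nonneg.2 hτ))]
  calc _ ≤ ∑' N : ℕ, ‖a N * cexp (2 * Real.pi * I * τ * N)‖ :=
        norm_tsum_le_tsum_norm hτ'.summable.norm
    _ ≤ ∑' N : ℕ, Real.exp (2 * Real.pi * y₀) * Real.exp (-2 * Real.pi * τ.im) *
        ‖a N * cexp (2 * Real.pi * I * (y₀ * I) * N)‖ :=
        hτ'.summable.norm.tsum_le_tsum key (hs.mul_left _)
    _ = _ := by rw [tsum_mul_left]; ring

lemma QExp.coeff_eq {F : ℂ → ℂ} {a : ℕ → ℂ} (h : QExp F a) {y : ℝ} (hy : 0 < y) (M : ℕ) :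
    a M * cexp (2 * Real.pi * I * (y * I) * M) =
      ∫ x in (0 : ℝ)..1, F (x + y * I) * cexp (-(2 * Real.pi * I * x * M)) := by
  have hs := (h (y * I) (by simpa using hy)).summable.norm
  have hterm : ∀ N : ℕ, ∀ x : ℝ, a N * cexp (2 * Real.pi * I * (x + y * I) * N) *
      cexp (-(2 * Real.pi * I * x * M)) =
      a N * cexp (2 * Real.pi * I * (y * I) * N) * cexp (2 * Real.pi * I * ((N - M : ℤ)) * x) := by
    intro N x
    rw [mul_assoc (a N), mul_assoc (a N), ← Complex.exp_add, ← Complex.exp_add]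
    congr 2
    push_cast
    ring
  have hfI := intervalIntegral.hasSum_integral_of_dominated_convergence (μ := MeasureTheory.volume)
    (a := 0) (b := 1)
    (F := fun (N : ℕ) (x : ℝ) => a N * cexp (2 * Real.pi * I * (x + y * I) * N) *
      cexp (-(2 * Real.pi * I * x * M)))
    (f := fun x : ℝ => F (x + y * I) * cexp (-(2 * Real.pi * I * x * M)))
    (fun N _ => ‖a N * cexp (2 * Real.pi * I * (y * I) * N)‖)
    (fun N => (Continuous.aestronglyMeasurable (by fun_prop)))
    (fun N => .of_forall fun x _ => by
      rw [hterm, norm_mul]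
      have : ‖cexp (2 * Real.pi * I * ((N - M : ℤ)) * x)‖ = 1 := by
        rw [show 2 * (Real.pi : ℂ) * I * ((N - M : ℤ)) * x =
          ((2 * Real.pi * ((N - M : ℤ)) * x : ℝ) : ℂ) * I by push_cast; ring]
        exact Complex.norm_exp_ofReal_mul_I _
      rw [this, mul_one])
    (.of_forall fun x _ => hs)
    intervalIntegrable_const
    (.of_forall fun x _ => (h (x + y * I) (by simpa using hy)).mul_right _)
  rw [← hfI.tsum_eq, tsum_eq_single M]
  · simp only [hterm]
    simp
  · intro N hN
    simp only [hterm]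
    rw [intervalIntegral.integral_const_mul]
    have hne : (2 * Real.pi * I * ((N - M : ℤ)) : ℂ) ≠ 0 := by
      have : ((N - M : ℤ) : ℂ) ≠ 0 := by
        rw [Int.cast_ne_zero]; omega
      exact mul_ne_zero Complex.two_pi_I_ne_zero this
    rw [integral_exp_mul_complex hne]
    have : cexp (2 * Real.pi * I * ((N - M : ℤ)) * (1 : ℝ)) = 1 := by
      rw [Complex.exp_eq_one_iff]
      exact ⟨N - M, by push_cast; ring⟩
    rw [this]
    simp

theorem theta_qExp {n : ℕ} {H : EMat n} (hp : PD H) (hd : H.det = 1) :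
    QExp (theta H) fun N : ℕ => (rep H N : ℂ) := by
  have hν : ∀ x, ((nrm H x).toNat : ℤ) = nrm H x := fun x => Int.toNat_of_nonneg (hp.nrm_nonneg x)
  have h : ∀ τ : ℂ, 0 < τ.im → HasSum
      (fun x : Fin n → Eis => (1 : ℂ) * cexp (2 * Real.pi * I * τ * (nrm H x).toNat))
      (theta H τ) := by
    intro τ hτ
    refine (theta_summable hp hd hτ).hasSum.congr_fun fun x => ?_
    rw [one_mul]
    congr 2
    exact_mod_cast (hν x)
  have := QExp.of_fibers h
  have e : (fun N : ℕ => ∑' _x : (fun x => (nrm H x).toNat) ⁻¹' {N}, (1 : ℂ)) =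
      fun N : ℕ => (rep H N : ℂ) := by
    ext N
    have hset : (fun x => (nrm H x).toNat) ⁻¹' {N} = {x | nrm H x = N} := by
      ext x
      have := hν x
      simp only [Set.mem_preimage, Set.mem_singleton_iff, Set.mem_ofPred_eq]
      omega
    rw [hset]
    have hfin : Fintype {x | nrm H x = N} := (hp.finite_eq N).fintype
    rw [tsum_fintype]
    simp [rep]
    rfl
  rwa [e] at this

end QExpansions
end EisensteinMass

namespace EisensteinMass

section EisensteinSeries

/-- The `n`-th power of the quadratic character modulo `3`. -/
def psi (n : ℕ) (d : ℤ) : ℂ := if d % 3 = 0 then 0 else if d % 3 = 1 then 1 else (-1) ^ n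

lemma psi_neg (n : ℕ) (d : ℤ) : psi n (-d) = (-1) ^ n * psi n d := by
  have h : d % 3 = 0 ∨ d % 3 = 1 ∨ d % 3 = 2 := by omega
  have h2 : ((-1 : ℂ) ^ n) * (-1) ^ n = 1 := by rw [← mul_pow]; simp
  rcases h with h | h | h
  · simp [psi, h, show -d % 3 = 0 by omega]
  · simp [psi, h, show -d % 3 = 2 by omega]
  · simp [psi, h, show -d % 3 = 1 by omega, h2]

lemma norm_psi_le (n : ℕ) (d : ℤ) : ‖psi n d‖ ≤ 1 := by
  unfold psi
  split_ifs <;> simp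

/-- The constant in the Lipschitz formula. -/
def lipC (n : ℕ) : ℂ := (-2 * Real.pi * I) ^ n / (n - 1).factorial

lemma summable_pnat_pow_mul_cexp (k : ℕ) {z : ℂ} (hz : 0 < z.im) :
    Summable fun m : ℕ+ => (m : ℂ) ^ k * cexp (2 * Real.pi * I * z * m) := by
  have := (summable_pow_mul_cexp k 1 ⟨z, hz⟩).comp_injective PNat.coe_injective
  refine this.congr fun m => ?_
  simp only [Function.comp, ← Complex.exp_nat_mul]
  congr 2
  simp
  ring

lemma tsum_inv_pow {n : ℕ} (hn : 2 ≤ n) {z : ℂ} (hz : 0 < z.im) :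
    ∑' d : ℤ, ((z + d) ^ n)⁻¹ =
      lipC n * ∑' m : ℕ+, (m : ℂ) ^ (n - 1) * cexp (2 * Real.pi * I * z * m) := by
  obtain ⟨k, rfl⟩ : ∃ k, n = k + 1 := ⟨n - 1, by omega⟩
  have := EisensteinSeries.qExpansion_identity_pnat (k := k) (by omega) ⟨z, hz⟩
  simp only [one_div] at this
  rw [this]
  simp only [lipC, Nat.add_sub_cancel]
  congr 1
  refine tsum_congr fun m => ?_
  rw [← Complex.exp_nat_mul]
  congr 2
  ring

lemma summable_inv_pow {n : ℕ} (hn : 2 ≤ n) (z : ℂ) : Summable fun d : ℤ => ((z + d) ^ n)⁻¹ := by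
  have := EisensteinSeries.linear_right_summable z 1 (k := n) (by exact_mod_cast hn)
  simpa using this

lemma tsum_int_mod_three {f : ℤ → ℂ} (hf : Summable f) :
    ∑' d, f d = (∑' e, f (3 * e)) + (∑' e, f (3 * e + 1)) + ∑' e, f (3 * e + 2) := by
  let eq := (Equiv.prodComm (Fin 3) ℤ).trans (Int.divModEquiv 3).symm
  have heq : ∀ r e, eq (r, e) = 3 * e + (r : ℕ) := fun r e => by
    simp [eq, Int.divModEquiv, mul_comm]
  have hs : Summable fun x => f (eq x) := eq.summable_iff.2 hf
  rw [← eq.tsum_eq, hs.tsum_prod, tsum_fintype, Fin.sum_univ_three]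
  simp [heq]

/-- The Gauss sum attached to `psi`. -/
def gaussPsi (n m : ℕ) : ℂ :=
  cexp (2 * Real.pi * I * m / 3) + (-1) ^ n * cexp (2 * Real.pi * I * (2 * m) / 3)

lemma tsum_psi_inv_pow {n : ℕ} (hn : 2 ≤ n) {z : ℂ} (hz : 0 < z.im) :
    ∑' d : ℤ, psi n d * ((3 * z + d) ^ n)⁻¹ = lipC n * (3 ^ n)⁻¹ *
      ∑' m : ℕ+, (m : ℂ) ^ (n - 1) * gaussPsi n m * cexp (2 * Real.pi * I * z * m) := by
  have hs : Summable fun d : ℤ => psi n d * ((3 * z + d) ^ n)⁻¹ :=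
    .of_norm_bounded (summable_inv_pow hn (3 * z)).norm fun d => by
      rw [norm_mul]
      exact mul_le_of_le_one_left (norm_nonneg _) (norm_psi_le n d)
  have hterm : ∀ (e : ℤ) (r : ℂ), ((3 * z + (3 * e + r)) ^ n)⁻¹ =
      (3 ^ n)⁻¹ * ((z + r / 3 + e) ^ n)⁻¹ := by
    intro e r
    rw [← mul_inv, ← mul_pow]
    congr 2
    ring
  have hr : ∀ r : ℝ, 0 < (z + (r : ℂ) / 3).im := fun r => by
    rw [show (r : ℂ) / 3 = ((r / 3 : ℝ) : ℂ) by push_cast; rfl]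
    simpa using hz
  have h1 := tsum_inv_pow hn (hr 1)
  have h2 := tsum_inv_pow hn (hr 2)
  have s1 := summable_pnat_pow_mul_cexp (n - 1) (hr 1)
  have s2 := summable_pnat_pow_mul_cexp (n - 1) (hr 2)
  rw [tsum_int_mod_three hs]
  have e0 : ∑' e : ℤ, psi n (3 * e) * ((3 * z + (3 * e : ℤ)) ^ n)⁻¹ = 0 := by
    simp [psi]
  have e1 : ∑' e : ℤ, psi n (3 * e + 1) * ((3 * z + (3 * e + 1 : ℤ)) ^ n)⁻¹ =
      (3 ^ n)⁻¹ * ∑' d : ℤ, ((z + (1 : ℝ) / 3 + d) ^ n)⁻¹ := by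
    rw [← tsum_mul_left]
    refine tsum_congr fun e => ?_
    rw [← hterm e (1 : ℝ)]
    simp [psi, show (3 * e + 1) % 3 = 1 by omega]
  have e2 : ∑' e : ℤ, psi n (3 * e + 2) * ((3 * z + (3 * e + 2 : ℤ)) ^ n)⁻¹ =
      (-1) ^ n * ((3 ^ n)⁻¹ * ∑' d : ℤ, ((z + (2 : ℝ) / 3 + d) ^ n)⁻¹) := by
    rw [← tsum_mul_left, ← tsum_mul_left]
    refine tsum_congr fun e => ?_
    rw [← hterm e (2 : ℝ)]
    simp [psi, show (3 * e + 2) % 3 = 2 by omega]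
  rw [e0, e1, e2, h1, h2, zero_add]
  have hsum : ∑' m : ℕ+, (m : ℂ) ^ (n - 1) * gaussPsi n m * cexp (2 * Real.pi * I * z * m) =
      (∑' m : ℕ+, (m : ℂ) ^ (n - 1) * cexp (2 * Real.pi * I * (z + (1 : ℝ) / 3) * m)) +
      (-1) ^ n * ∑' m : ℕ+, (m : ℂ) ^ (n - 1) * cexp (2 * Real.pi * I * (z + (2 : ℝ) / 3) * m) := by
    rw [← tsum_mul_left, ← s1.tsum_add (s2.mul_left _)]
    refine tsum_congr fun m => ?_
    have (r : ℝ) : cexp (2 * Real.pi * I * (z + r / 3) * m) =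
        cexp (2 * Real.pi * I * (r * m) / 3) * cexp (2 * Real.pi * I * z * m) := by
      rw [← Complex.exp_add]
      congr 1
      ring
    rw [this, this, gaussPsi]
    push_cast
    rw [one_mul]
    ring
  rw [hsum]
  ring

end EisensteinSeries
end EisensteinMass

namespace EisensteinMass

section EisensteinSeries

/-- The Eisenstein series with character at the cusp `∞`. -/
def eisG (n : ℕ) (τ : ℂ) : ℂ := ∑' p : ℤ × ℤ, psi n p.2 * ((3 * p.1 * τ + p.2) ^ n)⁻¹

/-- The Eisenstein series with character at the cusp `0`. -/
def eisH (n : ℕ) (τ : ℂ) : ℂ := ∑' p : ℤ × ℤ, psi n p.1 * ((p.1 * τ + p.2) ^ n)⁻¹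

/-- Rotation of the lattice `ℤ × ℤ`. -/
def quarterTurn : ℤ × ℤ ≃ ℤ × ℤ where
  toFun p := (-p.2, p.1)
  invFun p := (p.2, -p.1)
  left_inv p := by simp
  right_inv p := by simp

lemma psi_zero (n : ℕ) : psi n 0 = 0 := by simp [psi]

lemma eisG_inv (n : ℕ) {τ : ℂ} (hτ : 0 < τ.im) :
    eisG n (-1 / (3 * τ)) = τ ^ n * eisH n τ := by
  have h0 : τ ≠ 0 := fun h => by simp [h] at hτ
  rw [eisG, eisH, ← tsum_mul_left,
    ← quarterTurn.tsum_eq]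
  refine tsum_congr fun p => ?_
  simp only [quarterTurn, Equiv.coe_fn_mk, Int.cast_neg]
  rw [show 3 * -(p.2 : ℂ) * (-1 / (3 * τ)) + p.1 = (p.1 * τ + p.2) / τ by field_simp; ring, div_pow,
    inv_div]
  ring

lemma eisH_inv (n : ℕ) {τ : ℂ} (hτ : 0 < τ.im) :
    eisH n (-1 / (3 * τ)) = (-3 * τ) ^ n * eisG n τ := by
  have h0 : τ ≠ 0 := fun h => by simp [h] at hτ
  rw [eisG, eisH, ← tsum_mul_left,
    ← quarterTurn.tsum_eq]
  refine tsum_congr fun p => ?_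
  simp only [quarterTurn, Equiv.coe_fn_mk, Int.cast_neg]
  rw [show -(p.2 : ℂ) * (-1 / (3 * τ)) + p.1 = (3 * p.1 * τ + p.2) / (3 * τ) by field_simp; ring,
    div_pow, inv_div, psi_neg, show -3 * τ = -1 * (3 * τ) by ring, mul_pow (-1) (3 * τ),
    div_eq_mul_inv]
  ring

/-- The Eisenstein series invariant under the Fricke involution. -/
def eis (n : ℕ) (τ : ℂ) : ℂ := eisG n τ + (I / √3) ^ n * eisH n τ

lemma eis_inv (n : ℕ) {τ : ℂ} (hτ : 0 < τ.im) :
    eis n (-1 / (3 * τ)) = (-I * √3 * τ) ^ n * eis n τ := by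
  have h3 : ((√3 : ℝ) : ℂ) * (√3 : ℝ) = 3 := by
    rw [← ofReal_mul, Real.mul_self_sqrt (by norm_num)]; norm_num
  have h3' : ((√3 : ℝ) : ℂ) ≠ 0 := by simp
  have e1 : (I / √3) ^ n * (-3 * τ) ^ n = (-I * √3 * τ) ^ n := by
    rw [← mul_pow, ← h3]
    congr 1
    field_simp
  have e2 : (-I * √3 * τ) ^ n * (I / √3) ^ n = τ ^ n := by
    rw [← mul_pow]
    congr 1
    field_simp
    simp
  rw [eis, eis, eisG_inv n hτ, eisH_inv n hτ, ← e1]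
  rw [← e1] at e2
  linear_combination (-eisH n τ) * e2

lemma tsum_even_prod {f : ℤ × ℤ → ℂ} (hf : Summable f) (he : ∀ p, f (-p) = f p) :
    ∑' p, f p = ∑' d, f (0, d) + 2 * ∑' c : ℕ+, ∑' d, f ((c : ℕ), d) := by
  rw [hf.tsum_prod, tsum_int_eq_zero_add_two_mul_tsum_pnat (fun c => ?_) hf.prod]
  · rw [nsmul_eq_mul]; rfl
  · rw [← (Equiv.neg ℤ).tsum_eq]
    exact tsum_congr fun d => he (c, d)

lemma summable_prod_inv_pow {n : ℕ} (hn : 3 ≤ n) {τ : ℂ} (hτ : 0 < τ.im) :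
    Summable fun p : ℤ × ℤ => ((p.1 * τ + p.2) ^ n)⁻¹ := by
  simpa [EisensteinSeries.eisSummand] using summable_prod_eisSummand hn ⟨τ, hτ⟩

lemma summable_pnat_prod (n : ℕ) {τ : ℂ} (hτ : 0 < τ.im) {b : ℕ+ × ℕ+ → ℂ} {B : ℝ}
    (hb : ∀ p, ‖b p‖ ≤ B) :
    Summable fun p : ℕ+ × ℕ+ => b p * (p.2 : ℂ) ^ n *
      cexp (2 * Real.pi * I * τ * ((p.1 : ℕ) * (p.2 : ℕ) : ℕ)) := by
  have h := (summable_prod_mul_pow n (UpperHalfPlane.norm_exp_two_pi_I_lt_one ⟨τ, hτ⟩)).norm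
  refine .of_norm_bounded (h.mul_left B) fun p => ?_
  rw [mul_assoc, norm_mul]
  refine mul_le_mul (hb p) (le_of_eq ?_) (norm_nonneg _) ((norm_nonneg _).trans (hb p))
  rw [← Complex.exp_nat_mul]
  congr 3
  simp
  ring

lemma eisH_hasSum {n : ℕ} (hn : 3 ≤ n) {τ : ℂ} (hτ : 0 < τ.im) :
    HasSum (fun p : ℕ+ × ℕ+ => 2 * lipC n * psi n (p.1 : ℕ) * (p.2 : ℂ) ^ (n - 1) *
      cexp (2 * Real.pi * I * τ * ((p.1 : ℕ) * (p.2 : ℕ) : ℕ))) (eisH n τ) := by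
  have hs := summable_pnat_prod (n - 1) hτ (b := fun p => 2 * lipC n * psi n (p.1 : ℕ))
    (B := ‖2 * lipC n‖) fun p => by
      rw [norm_mul]
      exact mul_le_of_le_one_right (norm_nonneg _) (norm_psi_le _ _)
  have hs2 : Summable fun p : ℤ × ℤ => psi n p.1 * ((p.1 * τ + p.2) ^ n)⁻¹ :=
    .of_norm_bounded (summable_prod_inv_pow hn hτ).norm fun d => by
      rw [norm_mul]
      exact mul_le_of_le_one_left (norm_nonneg _) (norm_psi_le n _)
  refine hs.hasSum_iff.2 ?_
  rw [hs.tsum_prod, eisH, tsum_even_prod hs2, ← tsum_mul_left]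
  · simp only [psi_zero, zero_mul, tsum_zero, zero_add]
    refine tsum_congr fun c => ?_
    have hc : 0 < ((c : ℂ) * τ).im := by simpa using hτ
    rw [tsum_mul_left]
    have := tsum_inv_pow (n := n) (by omega) hc
    simp only [Int.cast_natCast]
    rw [this, ← tsum_mul_left, ← tsum_mul_left, ← tsum_mul_left]
    refine tsum_congr fun m => ?_
    rw [show 2 * Real.pi * I * τ * (((c : ℕ) * (m : ℕ) : ℕ) : ℂ) =
      2 * Real.pi * I * (c * τ) * m by push_cast; ring]
    ring
  · rintro ⟨c, d⟩
    simp only [Prod.neg_mk, psi_neg, Int.cast_neg]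
    rw [show -(c : ℂ) * τ + -d = -1 * (c * τ + d) by ring, mul_pow, mul_inv]
    have h2 : ((-1 : ℂ) ^ n) * ((-1) ^ n)⁻¹ = 1 := mul_inv_cancel₀ (by simp)
    linear_combination (psi n c * ((c * τ + d) ^ n)⁻¹) * h2

lemma norm_gaussPsi_le (n m : ℕ) : ‖gaussPsi n m‖ ≤ 2 := by
  have (r : ℝ) : ‖cexp (2 * Real.pi * I * r / 3)‖ = 1 := by
    rw [show 2 * (Real.pi : ℂ) * I * r / 3 = ((2 * Real.pi * r / 3 : ℝ) : ℂ) * I by push_cast; ring,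
      Complex.norm_exp_ofReal_mul_I]
  refine (norm_add_le _ _).trans ?_
  have h1 := this m
  have h2 := this (2 * m)
  push_cast at h1 h2
  rw [norm_mul, h1, h2]
  norm_num

lemma eisG_hasSum {n : ℕ} (hn : 3 ≤ n) {τ : ℂ} (hτ : 0 < τ.im) :
    HasSum (fun p : ℕ+ × ℕ+ => 2 * lipC n * (3 ^ n)⁻¹ * gaussPsi n p.2 * (p.2 : ℂ) ^ (n - 1) *
      cexp (2 * Real.pi * I * τ * ((p.1 : ℕ) * (p.2 : ℕ) : ℕ)))
      (eisG n τ - ∑' d : ℤ, psi n d * ((d : ℂ) ^ n)⁻¹) := by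
  have hs := summable_pnat_prod (n - 1) hτ
    (b := fun p => 2 * lipC n * (3 ^ n)⁻¹ * gaussPsi n p.2)
    (B := ‖2 * lipC n * (3 ^ n)⁻¹‖ * 2) fun p => by
      rw [norm_mul]
      exact mul_le_mul_of_nonneg_left (norm_gaussPsi_le _ _) (norm_nonneg _)
  have hs2 : Summable fun p : ℤ × ℤ => psi n p.2 * ((3 * p.1 * τ + p.2) ^ n)⁻¹ := by
    have := summable_prod_inv_pow hn (τ := 3 * τ) (by simpa using hτ)
    refine .of_norm_bounded this.norm fun d => ?_
    rw [norm_mul, show 3 * (d.1 : ℂ) * τ = d.1 * (3 * τ) by ring]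
    exact mul_le_of_le_one_left (norm_nonneg _) (norm_psi_le n _)
  refine hs.hasSum_iff.2 ?_
  rw [hs.tsum_prod, eisG, tsum_even_prod hs2, ← tsum_mul_left]
  · simp only [Int.cast_zero, mul_zero, zero_mul, zero_add, add_sub_cancel_left]
    refine tsum_congr fun c => ?_
    have hc : 0 < ((c : ℂ) * τ).im := by simpa using hτ
    have := tsum_psi_inv_pow (n := n) (by omega) hc
    simp only [Int.cast_natCast, mul_assoc (3 : ℂ)]
    rw [this, ← tsum_mul_left, ← tsum_mul_left]
    refine tsum_congr fun m => ?_
    rw [show 2 * Real.pi * I * τ * (((c : ℕ) * (m : ℕ) : ℕ) : ℂ) =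
      2 * Real.pi * I * (c * τ) * m by push_cast; ring]
    ring
  · rintro ⟨c, d⟩
    simp only [Prod.neg_mk, psi_neg, Int.cast_neg]
    rw [show 3 * -(c : ℂ) * τ + -d = -1 * (3 * c * τ + d) by ring, mul_pow, mul_inv]
    have h2 : ((-1 : ℂ) ^ n) * ((-1) ^ n)⁻¹ = 1 := mul_inv_cancel₀ (by simp)
    linear_combination (psi n d * ((3 * c * τ + d) ^ n)⁻¹) * h2

end EisensteinSeries
end EisensteinMass

namespace EisensteinMass

section EisensteinCoefficients

lemma gaussPsi_three_mul_add_one (n t : ℕ) : gaussPsi n (3 * t + 1) = gaussPsi n 1 := by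
  have (s r : ℕ) : cexp (2 * Real.pi * I * (3 * s + r) / 3) = cexp (2 * Real.pi * I * r / 3) := by
    rw [Complex.exp_eq_exp_iff_exists_int]
    exact ⟨s, by push_cast; ring⟩
  have h1 := this t 1
  have h2 := this (2 * t) 2
  push_cast at h1 h2
  simp only [gaussPsi]
  push_cast
  rw [h1, show 2 * (3 * (t : ℂ) + 1) = 3 * (2 * t) + 2 by ring, h2, mul_one, mul_one]

lemma seven_pow_eq (j : ℕ) : ∃ t : ℕ, 7 ^ j = 3 * t + 1 :=
  ⟨7 ^ j / 3, by have : 7 ^ j % 3 = 1 := by simp [Nat.pow_mod]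
                 omega⟩

/-- The constant term of the Eisenstein series `eis n`. -/
def eisConst (n : ℕ) : ℂ := ∑' d : ℤ, psi n d * ((d : ℂ) ^ n)⁻¹

/-- The first coefficient of the Eisenstein series `eis n`. -/
def eisLead (n : ℕ) : ℂ := 2 * lipC n * ((3 ^ n)⁻¹ * gaussPsi n 1 + (I / √3) ^ n)

lemma fiber_seven_pow (k : ℕ) : (fun p : ℕ+ × ℕ+ => (p.1 : ℕ) * (p.2 : ℕ)) ⁻¹' {7 ^ k} =
    ((Finset.range (k + 1)).image fun j => ((7 : ℕ+) ^ (k - j), (7 : ℕ+) ^ j) : Finset (ℕ+ × ℕ+)) := by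
  ext ⟨c, m⟩
  simp only [Set.mem_preimage, Set.mem_singleton_iff, Finset.coe_image, Set.mem_image,
    Finset.coe_range, Set.mem_Iio, Prod.mk.injEq]
  constructor
  · intro h
    obtain ⟨j, hj, hm⟩ := (Nat.dvd_prime_pow (by norm_num : Nat.Prime 7)).1 (Dvd.intro_left _ h)
    refine ⟨j, by omega, ?_, ?_⟩
    · apply PNat.coe_injective
      have : 7 ^ k = 7 ^ (k - j) * 7 ^ j := by rw [← pow_add]; congr 1; omega
      rw [hm, this] at h
      simpa using (Nat.mul_right_cancel (by positivity) h).symm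
    · apply PNat.coe_injective
      simpa using hm.symm
  · rintro ⟨j, hj, rfl, rfl⟩
    simp only [PNat.pow_coe]
    rw [← pow_add]
    congr 1
    omega

/-- The `q`-expansion of the Eisenstein series. -/
theorem eis_qExp {n : ℕ} (hn : 3 ≤ n) : ∃ b : ℕ → ℂ, QExp (eis n) b ∧ b 0 = eisConst n ∧
    ∀ k, b (7 ^ k) = eisLead n * ∑ j ∈ Finset.range (k + 1), (7 ^ (n - 1) : ℂ) ^ j := by
  have h := fun τ hτ => (eisG_hasSum hn (τ := τ) hτ).add ((eisH_hasSum hn hτ).mul_left ((I / √3) ^ n))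
  have hq := (QExp.const (eisConst n)).add (QExp.of_fibers
    (α := fun p : ℕ+ × ℕ+ => 2 * lipC n * ((3 ^ n)⁻¹ * gaussPsi n p.2 +
      (I / √3) ^ n * psi n (p.1 : ℕ)) * (p.2 : ℂ) ^ (n - 1))
    (ν := fun p => (p.1 : ℕ) * (p.2 : ℕ))
    (F := fun τ => eisG n τ - eisConst n + (I / √3) ^ n * eisH n τ) fun τ hτ => by
      refine (h τ hτ).congr_fun fun p => ?_
      ring)
  refine ⟨_, hq.congr fun τ _ => by rw [eis]; ring, ?_, fun k => ?_⟩
  · have : IsEmpty ((fun p : ℕ+ × ℕ+ => (p.1 : ℕ) * (p.2 : ℕ)) ⁻¹' {0}) := by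
      constructor
      rintro ⟨⟨c, m⟩, h⟩
      exact (Nat.mul_pos c.pos m.pos).ne' h
    simp [tsum_empty]
  · rw [if_neg (by positivity), zero_add, fiber_seven_pow]
    refine (Finset.tsum_subtype' _ fun p : ℕ+ × ℕ+ => 2 * lipC n * ((3 ^ n)⁻¹ * gaussPsi n p.2 +
      (I / √3) ^ n * psi n (p.1 : ℕ)) * (p.2 : ℂ) ^ (n - 1)).trans ?_
    rw [Finset.sum_image, Finset.mul_sum]
    · refine Finset.sum_congr rfl fun j _ => ?_
      obtain ⟨t, ht⟩ := seven_pow_eq j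
      obtain ⟨s, hs⟩ := seven_pow_eq (k - j)
      have h1 : psi n ((7 ^ (k - j) : ℕ) : ℤ) = 1 := by
        rw [hs]
        simp [psi, show (3 * (s : ℤ) + 1) % 3 = 1 by omega]
      simp only [PNat.pow_coe]
      rw [show ((7 : ℕ+) : ℕ) = 7 from rfl, h1, ht, gaussPsi_three_mul_add_one, ← ht, eisLead,
        mul_one]
      push_cast
      rw [← pow_mul, ← pow_mul, mul_comm j]
    · intro a _ b _ hab
      have := congrArg (fun x : ℕ+ × ℕ+ => (x.2 : ℕ)) hab
      simp only [PNat.pow_coe] at this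
      exact Nat.pow_right_injective (le_refl _ |>.trans (by norm_num : 2 ≤ 7)) this

end EisensteinCoefficients
end EisensteinMass

namespace EisensteinMass

section CuspForms

variable {n : ℕ} {F : ℂ → ℂ} {a : ℕ → ℂ}

lemma im_fricke (τ : ℂ) : (-1 / (3 * τ)).im = τ.im / (3 * normSq τ) := by
  rw [show -1 / (3 * τ) = ((-1 / 3 : ℝ) : ℂ) * τ⁻¹ by push_cast; rw [div_mul_eq_div_div]; ring,
    im_ofReal_mul, inv_im]
  ring

lemma fricke_invariant {τ : ℂ} (hτ : 0 < τ.im)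
    (h : F (-1 / (3 * τ)) = (-I * √3 * τ) ^ n * F τ) :
    ‖F (-1 / (3 * τ))‖ ^ 2 * (-1 / (3 * τ)).im ^ n = ‖F τ‖ ^ 2 * τ.im ^ n := by
  have h0 : τ ≠ 0 := fun h => by simp [h] at hτ
  have h1 : 0 < normSq τ := normSq_pos.2 h0
  have h2 : ‖-I * √3 * τ‖ ^ 2 = 3 * normSq τ := by
    rw [norm_mul, norm_mul, norm_neg, norm_I, one_mul, mul_pow, norm_real, Real.norm_eq_abs, sq_abs,
      Real.sq_sqrt (by norm_num), Complex.normSq_eq_norm_sq]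
  rw [h, im_fricke, norm_mul, norm_pow, mul_pow, ← pow_mul, mul_comm n 2, pow_mul, h2, div_pow]
  field_simp

/-- The invariant function attached to a cusp form is bounded. -/
lemma cusp_bounded (hq : QExp F a) (h0 : a 0 = 0)
    (hinv : ∀ τ : ℂ, 0 < τ.im → F (-1 / (3 * τ)) = (-I * √3 * τ) ^ n * F τ) :
    ∃ B : ℝ, 0 ≤ B ∧ ∀ τ : ℂ, 0 < τ.im → ‖F τ‖ ^ 2 * τ.im ^ n ≤ B := by
  obtain ⟨B, hB, hF⟩ := hq.decay h0 (y₀ := 1 / 4) (by norm_num)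
  refine ⟨B ^ 2 * n.factorial, by positivity, fun τ hτ => ?_⟩
  have base : ∀ τ : ℂ, 1 / 4 ≤ τ.im → ‖F τ‖ ^ 2 * τ.im ^ n ≤ B ^ 2 * n.factorial := by
    intro τ hτ
    have hpos : 0 < τ.im := by linarith
    have h1 : τ.im ^ n ≤ n.factorial * Real.exp τ.im := by
      have := Real.pow_div_factorial_le_exp τ.im hpos.le n
      rw [div_le_iff₀ (by positivity)] at this
      linarith
    have h2 : Real.exp (-2 * Real.pi * τ.im) ^ 2 * Real.exp τ.im ≤ 1 := by
      rw [← Real.exp_nat_mul, ← Real.exp_add, Real.exp_le_one_iff]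
      have := Real.pi_gt_three
      push_cast
      nlinarith
    calc ‖F τ‖ ^ 2 * τ.im ^ n
        ≤ (B * Real.exp (-2 * Real.pi * τ.im)) ^ 2 * (n.factorial * Real.exp τ.im) := by
          gcongr
          exact hF τ hτ
      _ = B ^ 2 * n.factorial * (Real.exp (-2 * Real.pi * τ.im) ^ 2 * Real.exp τ.im) := by ring
      _ ≤ B ^ 2 * n.factorial * 1 := by gcongr
      _ = _ := mul_one _
  have step : ∀ k : ℕ, ∀ τ : ℂ, 0 < τ.im → (15 / 16) ^ k * (1 / 4) ≤ τ.im →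
      ‖F τ‖ ^ 2 * τ.im ^ n ≤ B ^ 2 * n.factorial := by
    intro k
    induction k with
    | zero => exact fun τ _ h => base τ (by simpa using h)
    | succ k ih =>
      intro τ hτ hk
      rcases le_total (1 / 4) τ.im with h4 | h4
      · exact base τ h4
      set σ : ℂ := τ + ((-round τ.re : ℤ) : ℂ) with hσ
      have him : σ.im = τ.im := by simp [hσ]
      have hre : |σ.re| ≤ 1 / 2 := by
        have := abs_sub_round τ.re
        simpa [hσ, sub_eq_add_neg] using this
      have hσp : 0 < σ.im := him ▸ hτ
      have hn : 3 * normSq σ ≤ 15 / 16 := by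
        rw [normSq_apply, him]
        have := abs_le.1 hre
        nlinarith
      have hn0 : 0 < normSq σ := normSq_pos.2 fun h => by simp [h] at hσp
      have hgrow : (15 / 16) ^ k * (1 / 4) ≤ (-1 / (3 * σ)).im := by
        rw [im_fricke, le_div_iff₀ (by positivity), him]
        refine le_trans ?_ hk
        rw [pow_succ]
        have : (0 : ℝ) ≤ (15 / 16) ^ k * (1 / 4) := by positivity
        nlinarith
      have := ih (-1 / (3 * σ)) (lt_of_lt_of_le (by positivity) hgrow) hgrow
      rwa [fricke_invariant hσp (hinv σ hσp), hσ, hq.periodic hτ, ← hσ, him] at this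
  obtain ⟨k, hk⟩ := exists_pow_lt_of_lt_one (show (0 : ℝ) < 4 * τ.im by linarith)
    (show (15 / 16 : ℝ) < 1 by norm_num)
  exact step k τ hτ (by linarith)

/-- Hecke's bound for the coefficients of cusp forms. -/
lemma cusp_coeff_bound (hq : QExp F a) (h0 : a 0 = 0)
    (hinv : ∀ τ : ℂ, 0 < τ.im → F (-1 / (3 * τ)) = (-I * √3 * τ) ^ n * F τ) :
    ∃ B : ℝ, 0 ≤ B ∧ ∀ m : ℕ, 0 < m → ‖a m‖ ^ 2 ≤ B * m ^ n := by
  obtain ⟨B, hB, hF⟩ := cusp_bounded hq h0 hinv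
  refine ⟨B * Real.exp (2 * Real.pi) ^ 2, by positivity, fun m hm => ?_⟩
  have hm' : (0 : ℝ) < m := by exact_mod_cast hm
  have key := hq.coeff_eq (y := 1 / m) (by positivity) m
  have hle : ‖a m * cexp (2 * Real.pi * I * ((1 / m : ℝ) * I) * m)‖ ≤ √(B * m ^ n) * |(1 : ℝ) - 0| := by
    rw [key]
    refine intervalIntegral.norm_integral_le_of_norm_le_const fun x _ => ?_
    have e : ‖cexp (-(2 * Real.pi * I * x * m))‖ = 1 := by
      rw [show -(2 * (Real.pi : ℂ) * I * x * m) = ((-(2 * Real.pi * x * m) : ℝ) : ℂ) * I by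
        push_cast; ring, Complex.norm_exp_ofReal_mul_I]
    rw [norm_mul, e, mul_one]
    refine Real.le_sqrt_of_sq_le ?_
    have := hF (x + (1 / m : ℝ) * I) (by simpa using hm)
    have him : ((x : ℂ) + (1 / m : ℝ) * I).im = 1 / m := by simp
    rw [him, div_pow, one_pow, mul_one_div, div_le_iff₀ (by positivity)] at this
    exact this
  have hexp : ‖cexp (2 * Real.pi * I * ((1 / m : ℝ) * I) * m)‖ = (Real.exp (2 * Real.pi))⁻¹ := by
    rw [show 2 * (Real.pi : ℂ) * I * ((1 / m : ℝ) * I) * m = ((-(2 * Real.pi) : ℝ) : ℂ) by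
      push_cast
      have : (m : ℂ) ≠ 0 := by exact_mod_cast hm.ne'
      field_simp
      rw [I_sq], Complex.norm_exp_ofReal, Real.exp_neg]
  rw [norm_mul, hexp, sub_zero, abs_one, mul_one, ← div_eq_mul_inv,
    div_le_iff₀ (Real.exp_pos _)] at hle
  calc ‖a m‖ ^ 2 ≤ (√(B * m ^ n) * Real.exp (2 * Real.pi)) ^ 2 := by gcongr
    _ = _ := by rw [mul_pow, Real.sq_sqrt (by positivity)]; ring

/-- A form whose coefficients at powers of `7` are too large is not cuspidal. -/
theorem cusp_lead_eq_zero (hn : 3 ≤ n) (hq : QExp F a) (h0 : a 0 = 0)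
    (hinv : ∀ τ : ℂ, 0 < τ.im → F (-1 / (3 * τ)) = (-I * √3 * τ) ^ n * F τ) {R : ℂ}
    (hR : ∀ k, a (7 ^ k) = R * ∑ j ∈ Finset.range (k + 1), (7 ^ (n - 1) : ℂ) ^ j) : R = 0 := by
  obtain ⟨B, hB, h⟩ := cusp_coeff_bound hq h0 hinv
  by_contra hR0
  have hRp : 0 < ‖R‖ ^ 2 := by positivity
  obtain ⟨k, hk⟩ := pow_unbounded_of_one_lt (B / ‖R‖ ^ 2) (show (1 : ℝ) < 7 by norm_num)
  have h1 := h (7 ^ k) (by positivity)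
  have hS : (7 ^ (n - 1) : ℝ) ^ k ≤ ‖∑ j ∈ Finset.range (k + 1), (7 ^ (n - 1) : ℂ) ^ j‖ := by
    have : (∑ j ∈ Finset.range (k + 1), (7 ^ (n - 1) : ℂ) ^ j) =
        ((∑ j ∈ Finset.range (k + 1), (7 ^ (n - 1) : ℝ) ^ j : ℝ) : ℂ) := by push_cast; rfl
    rw [this, norm_real, Real.norm_eq_abs]
    refine le_trans ?_ (le_abs_self _)
    exact Finset.single_le_sum (f := fun j => (7 ^ (n - 1) : ℝ) ^ j) (fun _ _ => by positivity)
      (Finset.self_mem_range_succ k)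
  rw [hR, norm_mul, mul_pow] at h1
  have h2 : ‖R‖ ^ 2 * ((7 : ℝ) ^ (n - 1)) ^ (k * 2) ≤ B * (7 ^ n) ^ k := by
    calc _ = ‖R‖ ^ 2 * ((7 ^ (n - 1) : ℝ) ^ k) ^ 2 := by rw [← pow_mul (7 ^ (n - 1) : ℝ)]
      _ ≤ _ := by gcongr
      _ ≤ _ := h1
      _ = _ := by push_cast; rw [← pow_mul, ← pow_mul, mul_comm k n]
  have h3 : ((7 : ℝ) ^ (n - 1)) ^ (k * 2) = 7 ^ (k * (n - 2)) * (7 ^ n) ^ k := by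
    rw [← pow_mul, ← pow_mul, ← pow_add]
    congr 1
    obtain ⟨t, rfl⟩ : ∃ t, n = t + 2 := ⟨n - 2, by omega⟩
    simp only [Nat.add_sub_cancel, show t + 2 - 1 = t + 1 by omega]
    ring
  rw [h3, ← mul_assoc] at h2
  have h4 := le_of_mul_le_mul_right h2 (by positivity)
  rw [div_lt_iff₀ hRp] at hk
  have h5 : (7 : ℝ) ^ k ≤ 7 ^ (k * (n - 2)) :=
    pow_le_pow_right₀ (by norm_num) (Nat.le_mul_of_pos_right _ (by omega))
  nlinarith

end CuspForms
end EisensteinMass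

namespace EisensteinMass

section SiegelWeil

lemma rep_zero {n : ℕ} {H : EMat n} (h : PD H) : rep H 0 = 1 := by
  have : Unique {x // nrm H x = 0} :=
    { default := ⟨0, nrm_zero H⟩
      uniq := fun x => Subtype.ext (by
        by_contra hx
        exact (h.nrm_pos hx).ne' x.2) }
  exact Nat.card_unique

/-- The averaged theta series is proportional to the Eisenstein series; comparing the first two
coefficients relates the masses in consecutive ranks. -/
theorem mass_mul_eisConst {n : ℕ} (hn : 2 ≤ n) (hc : eisConst (n + 1) ≠ 0) :
    (mass n : ℂ) * eisConst (n + 1) = mass (n + 1) * eisLead (n + 1) := by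
  obtain ⟨b, hb, hb0, hb7⟩ := eis_qExp (n := n + 1) (by omega)
  set r : ℂ := mass (n + 1) / eisConst (n + 1) with hr
  have hθ : QExp (fun τ => ∑ c : Cls (n + 1), ((aut c.out : ℂ)⁻¹ * theta c.out.1 τ))
      fun N : ℕ => ((W (n + 1) fun H => rep H.1 N : ℝ) : ℂ) := by
    have := QExp.sum Finset.univ fun (c : Cls (n + 1)) _ =>
      (theta_qExp c.out.2.1 c.out.2.2).mul_left (aut c.out : ℂ)⁻¹
    convert this using 2 with N
    rw [W]
    push_cast
    exact Finset.sum_congr rfl fun c _ => by rw [div_eq_inv_mul]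
  have hF := hθ.add (hb.mul_left (-r))
  have key := cusp_lead_eq_zero (n := n + 1)
    (R := (W (n + 1) (fun H => rep H.1 1) : ℝ) - r * eisLead (n + 1)) (by omega) hF ?_ ?_ ?_
  · rw [W_rep_one, hr] at key
    field_simp at key
    linear_combination key
  · rw [hb0, hr]
    have : (W (n + 1) fun H => (rep H.1 ((0 : ℕ) : ℤ) : ℝ)) = mass (n + 1) := by
      rw [mass, W, W]
      exact Finset.sum_congr rfl fun c _ => by rw [Nat.cast_zero, rep_zero c.out.2.1, Nat.cast_one]
    rw [this]
    field_simp
    ring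
  · intro τ hτ
    rw [eis_inv _ hτ, mul_add, Finset.mul_sum]
    congr 1
    · refine Finset.sum_congr rfl fun c _ => ?_
      rw [theta_inv c.out.2.1 c.out.2.2 hτ]
      ring
    · ring
  · intro k
    have := W_rep_pow n k
    push_cast
    rw [this, hb7]
    push_cast
    ring

end SiegelWeil
end EisensteinMass

namespace EisensteinMass

section SpecialValues

lemma exp_two_pi_div_three : cexp (2 * Real.pi * I / 3) = -1 / 2 + √3 / 2 * I := by
  rw [show 2 * (Real.pi : ℂ) * I / 3 = ((Real.pi - Real.pi / 3 : ℝ) : ℂ) * I by push_cast; ring,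
    Complex.exp_mul_I, ← ofReal_cos, ← ofReal_sin, Real.cos_pi_sub, Real.sin_pi_sub,
    Real.cos_pi_div_three, Real.sin_pi_div_three]
  push_cast
  ring

lemma sq_sqrt_three : ((√3 : ℝ) : ℂ) ^ 2 = 3 := by
  rw [← ofReal_pow, Real.sq_sqrt (by norm_num)]; norm_num

lemma exp_four_pi_div_three : cexp (2 * Real.pi * I * 2 / 3) = -1 / 2 - √3 / 2 * I := by
  rw [show 2 * (Real.pi : ℂ) * I * 2 / 3 = (2 : ℕ) * (2 * Real.pi * I / 3) by push_cast; ring,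
    Complex.exp_nat_mul, exp_two_pi_div_three]
  linear_combination (I ^ 2 / 4) * sq_sqrt_three + (3 / 4) * I_sq

lemma fourier_third (t r s : ℤ) :
    (fourier (3 * t + r) ((s / 3 : ℝ) : UnitAddCircle) : ℂ) = cexp (2 * Real.pi * I * (r * s) / 3) := by
  rw [fourier_coe_apply, Complex.exp_eq_exp_iff_exists_int]
  refine ⟨t * s, ?_⟩
  push_cast
  ring

lemma fourier_third_values (d : ℤ) :
    (d % 3 = 0 ∧ (fourier d ((1 / 3 : ℝ) : UnitAddCircle) : ℂ) = 1 ∧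
      (fourier d ((2 / 3 : ℝ) : UnitAddCircle) : ℂ) = 1) ∨
    (d % 3 = 1 ∧ (fourier d ((1 / 3 : ℝ) : UnitAddCircle) : ℂ) = -1 / 2 + √3 / 2 * I ∧
      (fourier d ((2 / 3 : ℝ) : UnitAddCircle) : ℂ) = -1 / 2 - √3 / 2 * I) ∨
    (d % 3 = 2 ∧ (fourier d ((1 / 3 : ℝ) : UnitAddCircle) : ℂ) = -1 / 2 - √3 / 2 * I ∧
      (fourier d ((2 / 3 : ℝ) : UnitAddCircle) : ℂ) = -1 / 2 + √3 / 2 * I) := by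
  obtain ⟨t, r, hd, hr⟩ : ∃ t r : ℤ, d = 3 * t + r ∧ (r = 0 ∨ r = 1 ∨ r = 2) :=
    ⟨d / 3, d % 3, by omega, by omega⟩
  have h1 := fourier_third t r 1
  have h2 := fourier_third t r 2
  rw [← hd] at h1 h2
  have h4 : cexp (2 * Real.pi * I * 4 / 3) = cexp (2 * Real.pi * I / 3) := by
    rw [Complex.exp_eq_exp_iff_exists_int]
    exact ⟨1, by push_cast; ring⟩
  rcases hr with rfl | rfl | rfl
  · refine .inl ⟨by omega, ?_, ?_⟩
    · simpa using h1
    · simpa using h2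
  · refine .inr (.inl ⟨by omega, ?_, ?_⟩)
    · rw [← exp_two_pi_div_three]; simpa using h1
    · rw [← exp_four_pi_div_three]; simpa using h2
  · refine .inr (.inr ⟨by omega, ?_, ?_⟩)
    · rw [← exp_four_pi_div_three]; simpa using h1
    · rw [← exp_two_pi_div_three, ← h4]
      rw [show (2 : ℂ) * Real.pi * I * 4 / 3 = 2 * Real.pi * I * ((2 : ℤ) * (2 : ℤ)) / 3 by
        push_cast; ring, ← h2]
      norm_num only

lemma psi_odd {n : ℕ} (hn : Odd n) (d : ℤ) :
    I * √3 * psi n d = fourier d ((1 / 3 : ℝ) : UnitAddCircle) -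
      fourier d ((2 / 3 : ℝ) : UnitAddCircle) := by
  rcases fourier_third_values d with ⟨h, h1, h2⟩ | ⟨h, h1, h2⟩ | ⟨h, h1, h2⟩ <;> rw [h1, h2] <;>
    simp only [psi, h, hn.neg_one_pow] <;> norm_num <;> ring

lemma psi_even {n : ℕ} (hn : Even n) (d : ℤ) :
    3 * psi n d = 2 * fourier d ((0 : ℝ) : UnitAddCircle) -
      fourier d ((1 / 3 : ℝ) : UnitAddCircle) - fourier d ((2 / 3 : ℝ) : UnitAddCircle) := by
  have h0 : (fourier d ((0 : ℝ) : UnitAddCircle) : ℂ) = 1 := by simp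
  rw [h0]
  rcases fourier_third_values d with ⟨h, h1, h2⟩ | ⟨h, h1, h2⟩ | ⟨h, h1, h2⟩ <;> rw [h1, h2] <;>
    simp only [psi, h, hn.neg_one_pow] <;> norm_num <;> ring

lemma bernoulliFun_two_thirds (n : ℕ) : bernoulliFun n (2 / 3) = (-1) ^ n * bernoulliFun n (1 / 3) := by
  rw [← bernoulliFun_eval_one_sub]
  norm_num

lemma eisConst_odd {n : ℕ} (h2 : 2 ≤ n) (hn : Odd n) : I * √3 * eisConst n =
    -(2 * Real.pi * I) ^ n / n.factorial * (2 * bernoulliFun n (1 / 3)) := by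
  have h := (hasSum_one_div_pow_mul_fourier_mul_bernoulliFun h2 (x := 1 / 3) (by norm_num)).sub
    (hasSum_one_div_pow_mul_fourier_mul_bernoulliFun h2 (x := 2 / 3) (by norm_num))
  rw [eisConst, ← tsum_mul_left]
  have e : ∀ d : ℤ, I * √3 * (psi n d * ((d : ℂ) ^ n)⁻¹) =
      1 / (d : ℂ) ^ n * fourier d ((1 / 3 : ℝ) : UnitAddCircle) -
        1 / (d : ℂ) ^ n * fourier d ((2 / 3 : ℝ) : UnitAddCircle) := fun d => by
    rw [← mul_assoc, psi_odd hn]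
    ring
  rw [tsum_congr e, h.tsum_eq, bernoulliFun_two_thirds, hn.neg_one_pow]
  push_cast
  ring

lemma eisConst_even {n : ℕ} (h2 : 2 ≤ n) (hn : Even n) : 3 * eisConst n =
    -(2 * Real.pi * I) ^ n / n.factorial * (2 * (bernoulliFun n 0 - bernoulliFun n (1 / 3))) := by
  have h := (((hasSum_one_div_pow_mul_fourier_mul_bernoulliFun h2 (x := 0) (by norm_num)).mul_left
    2).sub (hasSum_one_div_pow_mul_fourier_mul_bernoulliFun h2 (x := 1 / 3) (by norm_num))).sub
    (hasSum_one_div_pow_mul_fourier_mul_bernoulliFun h2 (x := 2 / 3) (by norm_num))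
  rw [eisConst, ← tsum_mul_left]
  have e : ∀ d : ℤ, 3 * (psi n d * ((d : ℂ) ^ n)⁻¹) =
      2 * (1 / (d : ℂ) ^ n * fourier d ((0 : ℝ) : UnitAddCircle)) -
      1 / (d : ℂ) ^ n * fourier d ((1 / 3 : ℝ) : UnitAddCircle) -
        1 / (d : ℂ) ^ n * fourier d ((2 / 3 : ℝ) : UnitAddCircle) := fun d => by
    rw [← mul_assoc, psi_even hn]
    ring
  rw [tsum_congr e, h.tsum_eq, bernoulliFun_two_thirds, hn.neg_one_pow]
  push_cast
  ring

lemma gaussPsi_one (n : ℕ) : gaussPsi n 1 =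
    -1 / 2 + √3 / 2 * I + (-1) ^ n * (-1 / 2 - √3 / 2 * I) := by
  rw [gaussPsi, ← exp_two_pi_div_three, ← exp_four_pi_div_three]
  simp

lemma I_div_sqrt_three_sq : (I / √3) ^ 2 = -1 / 3 := by
  rw [div_pow, sq_sqrt_three, I_sq]

/-- Masses of consecutive ranks, the larger rank being odd. -/
theorem mass_odd {k : ℕ} (hk : 1 ≤ k) (hb : bernoulliFun (2 * k + 1) (1 / 3) ≠ 0) :
    mass (2 * k) * bernoulliFun (2 * k + 1) (1 / 3) =
      -(2 * k + 1) * ((1 / 9) ^ k + (-1 / 3) ^ k) * mass (2 * k + 1) := by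
  have hodd : Odd (2 * k + 1) := odd_two_mul_add_one k
  have hc := eisConst_odd (n := 2 * k + 1) (by omega) hodd
  have h3 : ((√3 : ℝ) : ℂ) ≠ 0 := by simp
  have hP : (2 * (Real.pi : ℂ) * I) ^ (2 * k + 1) ≠ 0 := pow_ne_zero _ Complex.two_pi_I_ne_zero
  have hf : ((2 * k).factorial : ℂ) ≠ 0 := by exact_mod_cast Nat.factorial_ne_zero _
  have hk0 : (2 * (k : ℂ) + 1) ≠ 0 := by exact_mod_cast (by omega : 2 * k + 1 ≠ 0)
  have hfac : ((2 * k + 1).factorial : ℂ) = (2 * k + 1) * (2 * k).factorial := by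
    rw [Nat.factorial_succ]; push_cast; ring
  have hb' : (bernoulliFun (2 * k + 1) (1 / 3) : ℂ) ≠ 0 := by exact_mod_cast hb
  rw [hfac] at hc
  have hne : eisConst (2 * k + 1) ≠ 0 := fun h => by
    rw [h, mul_zero] at hc
    exact mul_ne_zero (div_ne_zero (neg_ne_zero.2 hP) (mul_ne_zero hk0 hf))
      (mul_ne_zero two_ne_zero hb') hc.symm
  have key := mass_mul_eisConst (n := 2 * k) (by omega) hne
  have hlead : I * √3 * eisLead (2 * k + 1) = 2 * ((2 * Real.pi * I) ^ (2 * k + 1) /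
      (2 * k).factorial) * ((1 / 9) ^ k + (-1 / 3) ^ k) := by
    rw [eisLead, lipC, gaussPsi_one, hodd.neg_one_pow, neg_mul, neg_mul, hodd.neg_pow,
      Nat.add_sub_cancel, pow_succ (I / √3), pow_mul (I / √3), I_div_sqrt_three_sq,
      show ((3 : ℂ) ^ (2 * k + 1))⁻¹ = (1 / 9) ^ k / 3 by
        rw [pow_succ, pow_mul, _root_.one_div_pow]; norm_num
        ring]
    have e : I * (√3 : ℂ) * ((1 / 9) ^ k / 3 * (-1 / 2 + √3 / 2 * I + -1 * (-1 / 2 - √3 / 2 * I)) +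
        (-1 / 3) ^ k * (I / √3)) = -((1 / 9) ^ k + (-1 / 3) ^ k) := by
      field_simp
      linear_combination 2 * ((1 / 9) ^ k) * I ^ 2 * sq_sqrt_three +
        (6 * (1 / 9) ^ k + 6 * (-1 / 3) ^ k) * I_sq
    linear_combination (-2 * ((2 * Real.pi * I) ^ (2 * k + 1) / (2 * k).factorial)) * e
  have h := congrArg (fun z => I * √3 * z) key
  simp only [mul_left_comm (I * (√3 : ℂ)), hc, hlead] at h
  rw [← ofReal_inj]
  push_cast
  refine mul_left_cancel₀ (div_ne_zero hP hf) ?_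
  rw [show -(2 * (Real.pi : ℂ) * I) ^ (2 * k + 1) / ((2 * (k : ℂ) + 1) * (2 * k).factorial) =
      -((2 * (Real.pi : ℂ) * I) ^ (2 * k + 1) / (2 * k).factorial * (2 * (k : ℂ) + 1)⁻¹) by field_simp] at h
  linear_combination (-(2 * (k : ℂ) + 1) / 2) * h -
    (2 * (Real.pi : ℂ) * I) ^ (2 * k + 1) / (2 * k).factorial *
    (mass (2 * k) : ℂ) * (bernoulliFun (2 * k + 1) (1 / 3) : ℂ) *
    mul_inv_cancel₀ hk0

/-- Masses of consecutive ranks, the larger rank being even. -/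
theorem mass_even {k : ℕ} (hk : 1 ≤ k)
    (hb : bernoulliFun (2 * k + 2) 0 - bernoulliFun (2 * k + 2) (1 / 3) ≠ 0) :
    mass (2 * k + 1) * (bernoulliFun (2 * k + 2) 0 - bernoulliFun (2 * k + 2) (1 / 3)) =
      -3 * (2 * k + 2) * (-(1 / 9) ^ (k + 1) + (-1 / 3) ^ (k + 1)) * mass (2 * k + 2) := by
  have heven : Even (2 * k + 2) := ⟨k + 1, by ring⟩
  have hc := eisConst_even (n := 2 * k + 2) (by omega) heven
  have hP : (2 * (Real.pi : ℂ) * I) ^ (2 * k + 2) ≠ 0 := pow_ne_zero _ Complex.two_pi_I_ne_zero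
  have hf : ((2 * k + 1).factorial : ℂ) ≠ 0 := by exact_mod_cast Nat.factorial_ne_zero _
  have hk0 : (2 * (k : ℂ) + 2) ≠ 0 := by exact_mod_cast (by omega : 2 * k + 2 ≠ 0)
  have hfac : ((2 * k + 2).factorial : ℂ) = (2 * k + 2) * (2 * k + 1).factorial := by
    rw [Nat.factorial_succ]; push_cast; ring
  have hb' : (bernoulliFun (2 * k + 2) 0 - bernoulliFun (2 * k + 2) (1 / 3) : ℂ) ≠ 0 := by
    exact_mod_cast hb
  rw [hfac] at hc
  have hne : eisConst (2 * k + 1 + 1) ≠ 0 := fun h => by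
    rw [h, mul_zero] at hc
    exact mul_ne_zero (div_ne_zero (neg_ne_zero.2 hP) (mul_ne_zero hk0 hf))
      (mul_ne_zero two_ne_zero hb') hc.symm
  have key := mass_mul_eisConst (n := 2 * k + 1) (by omega) hne
  have hlead : eisLead (2 * k + 1 + 1) = 2 * ((2 * Real.pi * I) ^ (2 * k + 2) /
      (2 * k + 1).factorial) * (-(1 / 9) ^ (k + 1) + (-1 / 3) ^ (k + 1)) := by
    rw [eisLead, lipC, gaussPsi_one, heven.neg_one_pow, neg_mul, neg_mul, heven.neg_pow,
      Nat.add_sub_cancel, show 2 * k + 1 + 1 = 2 * (k + 1) by ring, pow_mul (I / √3),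
      I_div_sqrt_three_sq,
      show ((3 : ℂ) ^ (2 * (k + 1)))⁻¹ = (1 / 9) ^ (k + 1) by
        rw [pow_mul, _root_.one_div_pow]; norm_num]
    ring
  have h := congrArg (fun z => 3 * z) key
  simp only [mul_left_comm (3 : ℂ), hc, hlead] at h
  rw [← ofReal_inj]
  push_cast
  refine mul_left_cancel₀ (div_ne_zero hP hf) ?_
  rw [show -(2 * (Real.pi : ℂ) * I) ^ (2 * k + 2) / ((2 * (k : ℂ) + 2) * (2 * k + 1).factorial) =
      -((2 * (Real.pi : ℂ) * I) ^ (2 * k + 2) / (2 * k + 1).factorial * (2 * (k : ℂ) + 2)⁻¹) by field_simp] at h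
  linear_combination (-(2 * (k : ℂ) + 2) / 2) * h -
    (2 * (Real.pi : ℂ) * I) ^ (2 * k + 2) / (2 * k + 1).factorial *
    (mass (2 * k + 1) : ℂ) * (bernoulliFun (2 * k + 2) 0 - bernoulliFun (2 * k + 2) (1 / 3) : ℂ) *
    mul_inv_cancel₀ hk0

end SpecialValues
end EisensteinMass

namespace EisensteinMass

section Values

lemma bernoulliFun_ratCast (n : ℕ) (x : ℚ) : bernoulliFun n x =
    ((∑ i ∈ Finset.range (n + 1), bernoulli i * n.choose i * x ^ (n - i) : ℚ) : ℝ) := by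
  rw [bernoulliFun, Polynomial.bernoulli, Polynomial.map_sum, Polynomial.eval_finsetSum]
  push_cast
  refine Finset.sum_congr rfl fun i _ => ?_
  simp [Polynomial.map_monomial, Polynomial.eval_monomial]

lemma bernoulli_values : bernoulli 3 = 0 ∧ bernoulli 4 = -1 / 30 ∧ bernoulli 5 = 0 ∧
    bernoulli 6 = 1 / 42 ∧ bernoulli 7 = 0 ∧ bernoulli 8 = -1 / 30 ∧ bernoulli 9 = 0 ∧
    bernoulli 10 = 5 / 66 ∧ bernoulli 11 = 0 ∧ bernoulli 12 = -691 / 2730 ∧ bernoulli 13 = 0 ∧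
    bernoulli 14 = 7 / 6 ∧ bernoulli 15 = 0 := by
  have odd : ∀ {n : ℕ}, Odd n → 1 < n → bernoulli n = 0 := fun h h' =>
    bernoulli_eq_zero_of_odd h h'
  have h3 := odd (n := 3) (by decide) (by decide)
  have h5 := odd (n := 5) (by decide) (by decide)
  have h7 := odd (n := 7) (by decide) (by decide)
  have h9 := odd (n := 9) (by decide) (by decide)
  have h11 := odd (n := 11) (by decide) (by decide)
  have h13 := odd (n := 13) (by decide) (by decide)
  have s4 := sum_bernoulli 5
  have s6 := sum_bernoulli 7
  have s8 := sum_bernoulli 9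
  have s10 := sum_bernoulli 11
  have s12 := sum_bernoulli 13
  have s14 := sum_bernoulli 15
  simp only [Finset.sum_range_succ, Finset.sum_range_zero, bernoulli_zero, bernoulli_one,
    bernoulli_two, h3, h5, h7, h9, h11, h13] at s4 s6 s8 s10 s12 s14
  norm_num [Nat.choose] at s4 s6 s8 s10 s12 s14
  have h4 : bernoulli 4 = -1 / 30 := by linarith
  have h6 : bernoulli 6 = 1 / 42 := by linarith
  have h8 : bernoulli 8 = -1 / 30 := by linarith
  have h10 : bernoulli 10 = 5 / 66 := by linarith
  have h12 : bernoulli 12 = -691 / 2730 := by linarith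
  exact ⟨h3, h4, h5, h6, h7, h8, h9, h10, h11, h12, h13, by linarith,
    odd (by decide) (by decide)⟩

lemma mass_odd_value {k : ℕ} (hk : 1 ≤ k) {b m m' : ℚ} (hm : mass (2 * k) = m)
    (hb : ∑ i ∈ Finset.range (2 * k + 1 + 1),
      bernoulli i * (2 * k + 1).choose i * (1 / 3) ^ (2 * k + 1 - i) = b)
    (hb0 : b ≠ 0) (h : m * b / (-(2 * k + 1) * ((1 / 9) ^ k + (-1 / 3) ^ k)) = m')
    (h0 : (1 / 9 : ℚ) ^ k + (-1 / 3) ^ k ≠ 0) : mass (2 * k + 1) = m' := by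
  have hB : bernoulliFun (2 * k + 1) (1 / 3) = (b : ℝ) := by
    rw [← hb, ← bernoulliFun_ratCast]
    norm_num
  have key := mass_odd hk (by rw [hB]; exact_mod_cast hb0)
  have h1 : (-(2 * k + 1) : ℝ) * ((1 / 9) ^ k + (-1 / 3) ^ k) ≠ 0 :=
    mul_ne_zero (neg_ne_zero.2 (by positivity)) (by
      have h2 := (Rat.cast_ne_zero (α := ℝ)).2 h0
      push_cast at h2
      exact h2)
  rw [hB, hm, mul_comm (_ * _) (mass _)] at key
  rw [← h, eq_comm]
  push_cast
  exact (div_eq_iff h1).2 key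

lemma mass_even_value {k : ℕ} (hk : 1 ≤ k) {b m m' : ℚ} (hm : mass (2 * k + 1) = m)
    (hb : bernoulli (2 * k + 2) - ∑ i ∈ Finset.range (2 * k + 2 + 1),
      bernoulli i * (2 * k + 2).choose i * (1 / 3) ^ (2 * k + 2 - i) = b) (hb0 : b ≠ 0)
    (h : m * b / (-3 * (2 * k + 2) * (-(1 / 9) ^ (k + 1) + (-1 / 3) ^ (k + 1))) = m')
    (h0 : -(1 / 9 : ℚ) ^ (k + 1) + (-1 / 3) ^ (k + 1) ≠ 0) : mass (2 * k + 2) = m' := by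
  have hB : bernoulliFun (2 * k + 2) 0 - bernoulliFun (2 * k + 2) (1 / 3) = (b : ℝ) := by
    rw [← hb, Rat.cast_sub, ← bernoulliFun_ratCast, bernoulliFun_eval_zero]
    norm_num
  have key := mass_even hk (by rw [hB]; exact_mod_cast hb0)
  have h1 : (-3 * (2 * k + 2) : ℝ) * (-(1 / 9) ^ (k + 1) + (-1 / 3) ^ (k + 1)) ≠ 0 :=
    mul_ne_zero (mul_ne_zero (by norm_num) (by positivity)) (by
      have h2 := (Rat.cast_ne_zero (α := ℝ)).2 h0
      push_cast at h2
      exact h2)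
  rw [hB, hm, mul_comm (_ * _) (mass _)] at key
  rw [← h, eq_comm]
  push_cast
  exact (div_eq_iff h1).2 key

/-- The mass of the unimodular lattices of rank fifteen without vectors of norm one. -/
theorem massNoOne_fifteen : massNoOne 15 = (3619970721202760389 / 800584443422539776000 : ℚ) := by
  have hB := bernoulli_values
  have m2 : mass 2 = (1 / 72 : ℚ) := by rw [mass_two]; norm_num
  have m3 : mass 3 = (1 / 1296 : ℚ) := by
    refine mass_odd_value (k := 1) (b := 1 / 27) (by decide) m2 ?_ ?_ ?_ ?_ <;>
      norm_num [Finset.sum_range_succ, Nat.choose, hB]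
  have m4 : mass 4 = (1 / 31104 : ℚ) := by
    refine mass_even_value (k := 1) (b := -4 / 81) (by decide) m3 ?_ ?_ ?_ ?_ <;>
      norm_num [Finset.sum_range_succ, Nat.choose, hB]
  have m5 : mass 5 = (1 / 933120 : ℚ) := by
    refine mass_odd_value (k := 2) (b := -5 / 243) (by decide) m4 ?_ ?_ ?_ ?_ <;>
      norm_num [Finset.sum_range_succ, Nat.choose, hB]
  have m6 : mass 6 = (13 / 235146240 : ℚ) := by
    refine mass_even_value (k := 2) (b := 26 / 729) (by decide) m5 ?_ ?_ ?_ ?_ <;>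
      norm_num [Finset.sum_range_succ, Nat.choose, hB]
  have m7 : mass 7 = (1 / 201553920 : ℚ) := by
    refine mass_odd_value (k := 3) (b := 49 / 2187) (by decide) m6 ?_ ?_ ?_ ?_ <;>
      norm_num [Finset.sum_range_succ, Nat.choose, hB]
  have m8 : mass 8 = (41 / 48372940800 : ℚ) := by
    refine mass_even_value (k := 3) (b := -328 / 6561) (by decide) m7 ?_ ?_ ?_ ?_ <;>
      norm_num [Finset.sum_range_succ, Nat.choose, hB]
  have m9 : mass 9 = (809 / 2612138803200 : ℚ) := by
    refine mass_odd_value (k := 4) (b := -809 / 19683) (by decide) m8 ?_ ?_ ?_ ?_ <;>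
      norm_num [Finset.sum_range_succ, Nat.choose, hB]
  have m10 : mass 10 = (8899 / 31345665638400 : ℚ) := by
    refine mass_even_value (k := 4) (b := 6710 / 59049) (by decide) m9 ?_ ?_ ?_ ?_ <;>
      norm_num [Finset.sum_range_succ, Nat.choose, hB]
  have m11 : mass 11 = (1494223 / 2068813932134400 : ℚ) := by
    refine mass_odd_value (k := 5) (b := 20317 / 177147) (by decide) m10 ?_ ?_ ?_ ?_ <;>
      norm_num [Finset.sum_range_succ, Nat.choose, hB]
  have m12 : mass 12 = (75373090789 / 13554868883344588800 : ℚ) := by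
    refine mass_even_value (k := 5) (b := -201772 / 531441) (by decide) m11 ?_ ?_ ?_ ?_ <;>
      norm_num [Finset.sum_range_succ, Nat.choose, hB]
  have m13 : mass 13 = (630862444823 / 4468638093410304000 : ℚ) := by
    refine mass_odd_value (k := 6) (b := -722813 / 1594323) (by decide) m12 ?_ ?_ ?_ ?_ <;>
      norm_num [Finset.sum_range_succ, Nat.choose, hB]
  have m14 : mass 14 = (689532652191539 / 53623657120923648000 : ℚ) := by
    refine mass_even_value (k := 6) (b := 8370194 / 4782969) (by decide) m13 ?_ ?_ ?_ ?_ <;>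
      norm_num [Finset.sum_range_succ, Nat.choose, hB]
  have m15 : mass 15 = (4366489808207046403 / 965225828176625664000 : ℚ) := by
    refine mass_odd_value (k := 7) (b := 34607305 / 14348907) (by decide) m14 ?_ ?_ ?_ ?_ <;>
      norm_num [Finset.sum_range_succ, Nat.choose, hB]
  rw [massNoOne_eq]
  simp only [Finset.sum_range_succ, Finset.sum_range_zero, Nat.reduceSub, Nat.sub_zero, Nat.sub_self,
    mass_zero, mass_one,
    m2, m3, m4, m5, m6, m7, m8, m9, m10, m11, m12, m13, m14, m15]
  norm_num [Nat.factorial]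

end Values
end EisensteinMass

namespace EisensteinMass

section Transfer

variable {n : ℕ}

/-- The complex Gram matrix of a unimodular lattice. -/
def gram (H : ULat n) : Matrix (Fin n) (Fin n) ℂ := H.1.map toC

lemma entriesIn_iff {A : Matrix (Fin n) (Fin n) ℂ} :
    EntriesIn A ↔ ∃ B : EMat n, B.map toC = A := by
  constructor
  · intro h
    choose f hf using fun i j => mem_𝓞_iff.1 (h i j)
    exact ⟨Matrix.of f, by ext i j; simp [hf]⟩
  · rintro ⟨B, rfl⟩ i j
    exact mem_𝓞_iff.2 ⟨B i j, rfl⟩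

lemma isLatVec_iff {x : Fin n → ℂ} : IsLatVec x ↔ ∃ y : Fin n → Eis, toC ∘ y = x := by
  constructor
  · intro h
    choose f hf using fun i => mem_𝓞_iff.1 (h i)
    exact ⟨f, funext hf⟩
  · rintro ⟨y, rfl⟩ i
    exact mem_𝓞_iff.2 ⟨y i, rfl⟩

lemma inGL_map {C : EMat n} (h : IsUnit C.det) : InGL (C.map toC) := by
  refine ⟨entriesIn_iff.2 ⟨C, rfl⟩, C⁻¹.map toC, entriesIn_iff.2 ⟨_, rfl⟩, ?_, ?_⟩
  · rw [← map_mul_toC, Matrix.mul_nonsing_inv _ h]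
    simp
  · rw [← map_mul_toC, Matrix.nonsing_inv_mul _ h]
    simp

lemma isUnimodular_gram (H : ULat n) : IsUnimodular (gram H) :=
  ⟨⟨entriesIn_iff.2 ⟨H.1, rfl⟩, H.2.1.1, H.2.1⟩, by
    rw [gram, det_map_toC, H.2.2, map_one]⟩

lemma exists_gram {A : Matrix (Fin n) (Fin n) ℂ} (h : IsUnimodular A) :
    ∃ H : ULat n, gram H = A := by
  obtain ⟨⟨h1, -, h2⟩, h3⟩ := h
  obtain ⟨B, rfl⟩ := entriesIn_iff.1 h1
  refine ⟨⟨B, h2, toC_injective ?_⟩, rfl⟩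
  rw [← det_map_toC, h3, map_one]

lemma normOneFree_gram (H : ULat n) : NormOneFree (gram H) ↔ rep H.1 1 = 0 := by
  have : Finite {x // nrm H.1 x = 1} := (H.2.1.finite_eq 1).to_subtype
  have key : ∀ y, latNorm (gram H) (toC ∘ y) = 1 ↔ nrm H.1 y = 1 := fun y => by
    rw [latNorm, gram, ← nrm_toC H.2.1.herm]
    norm_cast
  rw [rep, Finite.card_eq_zero_iff, isEmpty_subtype]
  refine ⟨fun h y hy => h _ (isLatVec_iff.2 ⟨y, rfl⟩) ((key y).2 hy), fun h x hx => ?_⟩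
  obtain ⟨y, rfl⟩ := isLatVec_iff.1 hx
  exact fun e => h y ((key y).1 e)

/-- Isometries in terms of complex Gram matrices. -/
lemma card_iso (H K : ULat n) : Nonempty (Iso H K ≃
    {U : Matrix (Fin n) (Fin n) ℂ // InGL U ∧ U * gram H * Uᴴ = gram K}) := by
  refine ⟨Equiv.ofBijective (fun C => ⟨C.1ᴴ.map toC, inGL_map ?_, ?_⟩) ⟨fun C D h => ?_, ?_⟩⟩
  · rw [det_conjTranspose]
    exact C.isUnit.star
  · have h := congrArg (fun A => A.map toC) C.2
    simp only [map_mul_toC] at h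
    rw [map_conj, conjTranspose_conjTranspose, ← map_conj]
    exact h
  · exact Subtype.ext (conjTranspose_injective (map_inj (congrArg Subtype.val h)))
  · rintro ⟨U, hU, h⟩
    obtain ⟨B, rfl⟩ := entriesIn_iff.1 hU.1
    refine ⟨⟨Bᴴ, map_inj ?_⟩, Subtype.ext (by simp)⟩
    rw [conjTranspose_conjTranspose, map_mul_toC, map_mul_toC, map_conj]
    exact h

lemma latIsometric_gram (H K : ULat n) : LatIsometric (gram H) (gram K) ↔ Nonempty (Iso H K) := by
  obtain ⟨e⟩ := card_iso H K
  exact ⟨fun ⟨U, hU, h⟩ => ⟨e.symm ⟨U, hU, h.symm⟩⟩,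
    fun ⟨C⟩ => ⟨(e C).1, (e C).2.1, (e C).2.2.symm⟩⟩

lemma autCard_gram (H : ULat n) : autCard (gram H) = aut H := by
  obtain ⟨e⟩ := card_iso H H
  exact (Nat.card_congr e).symm

/-- The classes without vectors of norm one, their Gram matrices, and their mass. -/
theorem exists_classes (n : ℕ) {q : ℚ} (hq : massNoOne n = q) :
    ∃ (k : ℕ) (L : Fin k → Matrix (Fin n) (Fin n) ℂ),
      (∀ a, IsUnimodular (L a) ∧ NormOneFree (L a)) ∧
      (∀ a b, LatIsometric (L a) (L b) → a = b) ∧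
      (∀ H : Matrix (Fin n) (Fin n) ℂ, IsUnimodular H → NormOneFree H →
        ∃ a, LatIsometric H (L a)) ∧
      ∑ a, (1 : ℚ) / (autCard (L a) : ℚ) = q := by
  classical
  set S := {c : Cls n // rep c.out.1 1 = 0}
  let e : S ≃ Fin (Fintype.card S) := Fintype.equivFin S
  refine ⟨Fintype.card S, fun a => gram (e.symm a).1.out, fun a => ⟨isUnimodular_gram _,
    (normOneFree_gram _).2 (e.symm a).2⟩, fun a b h => ?_, fun A hA h1 => ?_, ?_⟩
  · refine e.symm.injective (Subtype.ext ?_)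
    rw [← Quotient.out_eq (e.symm a).1, ← Quotient.out_eq (e.symm b).1]
    exact Quotient.sound ((latIsometric_gram _ _).1 h)
  · obtain ⟨H, rfl⟩ := exists_gram hA
    refine ⟨e ⟨⟦H⟧, by rw [rep_out]; exact (normOneFree_gram H).1 h1⟩, ?_⟩
    simp only [e.symm_apply_apply, latIsometric_gram]
    exact Setoid.symm (Quotient.exact (Quotient.out_eq (⟦H⟧ : Cls n)))
  · rw [← Rat.cast_inj (α := ℝ), ← hq, massNoOne, W]
    simp_rw [autCard_gram]
    rw [Equiv.sum_comp e.symm fun c : S => (1 : ℚ) / (aut c.1.out : ℚ)]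
    push_cast
    simp_rw [ite_div, zero_div]
    rw [← Finset.sum_filter]
    exact (Finset.sum_subtype _ (fun c => by rw [Finset.mem_filter_univ])
      fun c : Cls n => (1 : ℝ) / aut c.out).symm

end Transfer
end EisensteinMass

/-- The set of isometry classes of unimodular hermitian `𝓞`-lattices of rank 15 with
no vector of norm 1 is finite, and its mass `Y₁₅` equals
`3619970721202760389 / (2¹⁸·3²⁰·5³·7²·11·13)`. -/
theorem stmt_16 :
    ∃ (k : ℕ) (L : Fin k → Matrix (Fin 15) (Fin 15) ℂ),
      (∀ a, IsUnimodular (L a) ∧ NormOneFree (L a)) ∧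
      (∀ a b, LatIsometric (L a) (L b) → a = b) ∧
      (∀ H : Matrix (Fin 15) (Fin 15) ℂ, IsUnimodular H → NormOneFree H →
        ∃ a, LatIsometric H (L a)) ∧
      ∑ a, (1 : ℚ) / (autCard (L a) : ℚ) =
        3619970721202760389 / (2 ^ 18 * 3 ^ 20 * 5 ^ 3 * 7 ^ 2 * 11 * 13) := by
  refine EisensteinMass.exists_classes 15 ?_
  rw [EisensteinMass.massNoOne_fifteen]
  norm_num
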